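/- Let T1 and T2 be two rooted (nonbinary) phylogenetic 𝒳-trees. For each relevant maximum agreement forest ℱ for T1 and T2 of size k there exist binary resolutions T̂1 of T1 and T̂2 of T2 and a binary resolution ℱ̂ of ℱ such that ℱ̂ is calculated by allMAFs¹(T̂1, T̂2, T̂1, T̂2, k). -/

import Mathlib

open scoped Classical

namespace Phylo

/-! ## Rooted multifurcating phylogenetic trees, encoded as laminar families of clusters.

A rooted (possibly multi-labeled) tree is identified with the family of clusters
(= sets of taxa below a node) of its nodes.  Leaves are the minimal clusters
("blocks"); in an ordinary phylogenetic tree all blocks are singletons, while the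
trees manipulated by the algorithm may carry set labels (contracted cherries). -/

variable {β : Type} [DecidableEq β]

/-- A cluster system: candidate representation of a rooted tree. -/
abbrev Clus (β : Type) := Finset (Finset β)

/-- Ground set (taxa set / label set `ℒ`) of a cluster system. -/
def grd (G : Clus β) : Finset β := G.sup id

/-- `A` is a block (leaf label) of `G`: a minimal cluster. -/
def IsBlock (G : Clus β) (A : Finset β) : Prop :=
  A ∈ G ∧ ∀ C ∈ G, C ⊆ A → C = A

/-- `G` is (the cluster system of) a rooted tree: a laminar family of nonempty
sets containing its ground set, in which every element lies in some block. -/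
def IsTree (G : Clus β) : Prop :=
  G.Nonempty ∧ (∀ C ∈ G, C.Nonempty) ∧
  (∀ C ∈ G, ∀ D ∈ G, C ⊆ D ∨ D ⊆ C ∨ Disjoint C D) ∧
  grd G ∈ G ∧
  (∀ x ∈ grd G, ∃ A, IsBlock G A ∧ x ∈ A)

/-- `D` is a child of `C` in `G` (a maximal proper subcluster). -/
def IsChild (G : Clus β) (D C : Finset β) : Prop :=
  D ∈ G ∧ C ∈ G ∧ D ⊂ C ∧ ∀ E ∈ G, D ⊆ E → E ⊂ C → E = D

/-- `C` is the cluster of the lowest common ancestor of `A` in `G`. -/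
def IsLca (G : Clus β) (A C : Finset β) : Prop :=
  C ∈ G ∧ A ⊆ C ∧ ∀ D ∈ G, A ⊆ D → C ⊆ D

/-- Every internal node has exactly two children. -/
def IsBin (G : Clus β) : Prop :=
  ∀ C ∈ G, ¬ IsBlock G C →
    ∃ D E, D ≠ E ∧ IsChild G D C ∧ IsChild G E C ∧
      ∀ D', IsChild G D' C → D' = D ∨ D' = E

/-- `G` is a rooted phylogenetic tree on taxa set `X` (all leaves are singletons,
bijectively labeled by `X`). -/
def IsPhylo (X : Finset β) (G : Clus β) : Prop :=
  IsTree G ∧ grd G = X ∧ ∀ x ∈ X, ({x} : Finset β) ∈ G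

/-- `G'` is a refinement of `G`: `G` is obtained from `G'` by contracting edges
(removing internal clusters); leaves are untouched. -/
def Refines (G' G : Clus β) : Prop :=
  G ⊆ G' ∧ ∀ A, IsBlock G' A ↔ IsBlock G A

/-- binary resolution of a tree. -/
def BinRes (G' G : Clus β) : Prop := Refines G' G ∧ IsBin G'

/-- Restriction `G|_A` of a tree to the taxa in `A` (suppression of degree-two
nodes happens automatically, since equal clusters are identified). -/
noncomputable def restr (G : Clus β) (A : Finset β) : Clus β :=
  (G.image (· ∩ A)).erase ∅

/-- The subtree of `G` rooted at the node with cluster `P`. -/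
noncomputable def below (G : Clus β) (P : Finset β) : Clus β :=
  G.filter (fun E => E ⊆ P)

/-- The tree `G` augmented by a new root whose extra child is a new leaf
labeled by `ρ`. -/
def aug (G : Clus β) (ρ : β) : Clus β :=
  insert {ρ} (insert (insert ρ (grd G)) G)

/-! ## Forests and (acyclic) agreement forests -/

/-- A forest on the taxa set `Y`: components are trees on disjoint taxa sets
covering `Y`. -/
def IsForestOn (Y : Finset β) (F : List (Clus β)) : Prop :=
  (∀ G ∈ F, IsTree G) ∧
  F.Pairwise (fun G H => Disjoint (grd G) (grd H)) ∧
  F.foldr (fun G s => grd G ∪ s) ∅ = Y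

/-- The in-edge of the node with cluster `C` belongs to the minimal subtree
`T(A)` of `T` spanning the taxa in `A`. -/
def EdgeInSpan (T : Clus β) (A C : Finset β) : Prop :=
  C ∈ T ∧ (A ∩ C).Nonempty ∧ ¬ A ⊆ C

/-- The node with cluster `C` belongs to the minimal subtree `T(A)` of `T`
spanning the taxa in `A`. -/
def NodeInSpan (T : Clus β) (A C : Finset β) : Prop :=
  C ∈ T ∧ (A ∩ C).Nonempty ∧ (¬ A ⊆ C ∨ IsLca T A C)

/-- Agreement forest for two already `ρ`-augmented trees `U1`, `U2`:
a forest on the common taxa set, each component a refinement of the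
corresponding restrictions, one component containing `ρ`, and the spanned
subtrees pairwise edge-disjoint in `U1` and in `U2`. -/
def IsAFρ (ρ : β) (U1 U2 : Clus β) (F : List (Clus β)) : Prop :=
  IsForestOn (grd U1) F ∧ grd U2 = grd U1 ∧
  (∀ G ∈ F, IsPhylo (grd G) G) ∧
  (∀ G ∈ F, Refines G (restr U1 (grd G)) ∧ Refines G (restr U2 (grd G))) ∧
  (∃ G ∈ F, ρ ∈ grd G) ∧
  F.Pairwise (fun G H => ∀ C, ¬ (EdgeInSpan U1 (grd G) C ∧ EdgeInSpan U1 (grd H) C)) ∧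
  F.Pairwise (fun G H => ∀ C, ¬ (EdgeInSpan U2 (grd G) C ∧ EdgeInSpan U2 (grd H) C))

/-- Agreement forest for two rooted phylogenetic `X`-trees `T1`, `T2`
(each first augmented by the new taxon `ρ ∉ X`). -/
def IsAF (X : Finset β) (ρ : β) (T1 T2 : Clus β) (F : List (Clus β)) : Prop :=
  IsAFρ ρ (aug T1 ρ) (aug T2 ρ) F

/-- Maximum agreement forest: agreement forest of minimum size. -/
def IsMAF (X : Finset β) (ρ : β) (T1 T2 : Clus β) (F : List (Clus β)) : Prop :=
  IsAF X ρ T1 T2 F ∧ ∀ F', IsAF X ρ T1 T2 F' → F.length ≤ F'.length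

/-- `F'` is obtained from `F` by contracting one edge of one component. -/
def ContractEdgeF (F F' : List (Clus β)) : Prop :=
  ∃ l1 G l2 C, F = l1 ++ G :: l2 ∧ C ∈ G ∧ C ≠ grd G ∧ ¬ IsBlock G C ∧
    F' = l1 ++ G.erase C :: l2

/-- `F` is relevant: no single edge contraction yields again an agreement forest. -/
def RelevantFor (X : Finset β) (ρ : β) (T1 T2 : Clus β) (F : List (Clus β)) : Prop :=
  ∀ F', ContractEdgeF F F' → ¬ IsAF X ρ T1 T2 F'

def IsRelMAF (X : Finset β) (ρ : β) (T1 T2 : Clus β) (F : List (Clus β)) : Prop :=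
  IsMAF X ρ T1 T2 F ∧ RelevantFor X ρ T1 T2 F

/-- Edge of the ancestor-descendant graph `AG(T1,T2,F)`. -/
def AGEdge (ρ : β) (T1 T2 : Clus β) (F : List (Clus β)) (G H : Clus β) : Prop :=
  G ∈ F ∧ H ∈ F ∧ grd G ≠ grd H ∧
  ((∃ C D E, IsLca (aug T1 ρ) (grd G) C ∧ IsLca (aug T1 ρ) (grd H) D ∧
      D ⊆ E ∧ E ⊂ C ∧ EdgeInSpan (aug T1 ρ) (grd G) E) ∨
   (∃ C D E, IsLca (aug T2 ρ) (grd G) C ∧ IsLca (aug T2 ρ) (grd H) D ∧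
      D ⊆ E ∧ E ⊂ C ∧ EdgeInSpan (aug T2 ρ) (grd G) E))

/-- Acyclic agreement forest. -/
def IsAcyclicAF (X : Finset β) (ρ : β) (T1 T2 : Clus β) (F : List (Clus β)) : Prop :=
  IsAF X ρ T1 T2 F ∧ ∀ G, ¬ Relation.TransGen (AGEdge ρ T1 T2 F) G G

/-- Maximum acyclic agreement forest. -/
def IsMAAF (X : Finset β) (ρ : β) (T1 T2 : Clus β) (F : List (Clus β)) : Prop :=
  IsAcyclicAF X ρ T1 T2 F ∧ ∀ F', IsAcyclicAF X ρ T1 T2 F' → F.length ≤ F'.length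

def IsRelMAAF (X : Finset β) (ρ : β) (T1 T2 : Clus β) (F : List (Clus β)) : Prop :=
  IsMAAF X ρ T1 T2 F ∧ RelevantFor X ρ T1 T2 F

/-! ## Rooted phylogenetic networks and the hybridization number -/

/-- A finite rooted digraph with (partially) labeled vertices. -/
structure Net (β : Type) where
  n : ℕ
  edges : Finset (Fin n × Fin n)
  root : Fin n
  lab : Fin n → Option β

def Net.rel (N : Net β) (u v : Fin N.n) : Prop := (u, v) ∈ N.edges

/-- `N` is a rooted phylogenetic network on `X`: acyclic, rooted, leaves
(out-degree 0 nodes) bijectively labeled by `X`, no node with in- and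
out-degree one. -/
def Net.IsPhyloNet (N : Net β) (X : Finset β) : Prop :=
  (∀ v, ¬ Relation.TransGen N.rel v v) ∧
  (∀ v, Relation.ReflTransGen N.rel N.root v) ∧
  (∀ v, (∀ w, ¬ N.rel v w) ↔ (∃ x ∈ X, N.lab v = some x)) ∧
  (∀ v w, N.lab v ≠ none → N.lab v = N.lab w → v = w) ∧
  (∀ x ∈ X, ∃ v, N.lab v = some x) ∧
  (∀ v, ¬ ((∃! u, N.rel u v) ∧ (∃! w, N.rel v w)))

/-- The reticulation number `r(N) = |E| - |V| + 1` of a network. -/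
def Net.ret (N : Net β) : ℕ := N.edges.card + 1 - N.n

/-- `N` displays (a refinement of) the tree `T`: there is a subgraph `E'` in
which every vertex has in-degree at most one, together with an embedding `f`
of the clusters of `T` such that parent/child clusters are connected by
directed `E'`-paths, leaves carry the correct labels, and reachability in
`E'` respects clusters. -/
def Net.Displays (N : Net β) (T : Clus β) : Prop :=
  ∃ E' : Fin N.n → Fin N.n → Prop,
    (∀ u v, E' u v → N.rel u v) ∧
    (∀ v u u', E' u v → E' u' v → u = u') ∧
    ∃ f : Finset β → Fin N.n,
      Relation.ReflTransGen E' N.root (f (grd T)) ∧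
      (∀ C D, IsChild T D C → Relation.TransGen E' (f C) (f D)) ∧
      (∀ x ∈ grd T, N.lab (f {x}) = some x) ∧
      (∀ C ∈ T, ∀ x ∈ grd T, Relation.ReflTransGen E' (f C) (f {x}) → x ∈ C)

/-- The hybridization number `h(T1,T2)`: the minimum reticulation number of a
rooted phylogenetic network on `X` displaying refinements of both trees. -/
noncomputable def hyb (X : Finset β) (T1 T2 : Clus β) : ℕ :=
  sInf { r | ∃ N : Net β, N.IsPhyloNet X ∧ N.Displays T1 ∧ N.Displays T2 ∧ N.ret = r }


/-! ## The machinery of the algorithms allMulMAFs, allMulMAFs*, ProcessCherries -/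

/-- The map `M` used for undoing cherry contractions: it maps a taxa set to
`(X₁, X₂, B)` where `B : Bool` records `⊤`/`⊥`. -/
abbrev MapT (β : Type) := Finset β → Option (Finset β × Finset β × Bool)

/-- A state of the algorithm: the tree `R`, the forest `F`, and the map `M`. -/
abbrev St (β : Type) := Clus β × List (Clus β) × MapT β

/-- Re-map the entry of `A` in `M` to `⊥`. -/
noncomputable def remapBot (M : MapT β) (A : Finset β) : MapT β :=
  fun S => if S = A then (M S).map (fun p => (p.1, p.2.1, false)) else M S

/-- Conditionally re-map the entry of `A` in `M` to `⊥`. -/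
noncomputable def remapIf (c : Prop) (A : Finset β) (M : MapT β) : MapT β :=
  fun S => if S = A ∧ c then (M S).map (fun p => (p.1, p.2.1, false)) else M S

/-- Replace one occurrence of the component `G` in the forest by `new`. -/
def ReplaceIn (F F' : List (Clus β)) (G : Clus β) (new : List (Clus β)) : Prop :=
  ∃ l1 l2, F = l1 ++ G :: l2 ∧ F' = l1 ++ new ++ l2

/-- Remove the leaf with label `A` from `R` (suppressing its parent). -/
noncomputable def rmBlock (R : Clus β) (A : Finset β) : Clus β :=
  restr R (grd R \ A)

/-- Contract the cherry `{A, C}` (in either of the two ways of the paper;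
in the cluster representation both coincide). -/
def conCh (G : Clus β) (A C : Finset β) : Clus β :=
  insert (A ∪ C) ((G.erase A).erase C)

def AllChildrenBlocks (G : Clus β) (P : Finset β) : Prop :=
  ∀ D, IsChild G D P → IsBlock G D

/-- `{A, C}` is a cherry of `R`: two leaves with a common parent all of whose
children are leaves. -/
def CherryR (R : Clus β) (A C : Finset β) : Prop :=
  A ≠ C ∧ ∃ P, IsChild R A P ∧ IsChild R C P ∧ AllChildrenBlocks R P

/-- `{A, C}` is a cherry contained in the tree `G`. -/
def CherryOf (G : Clus β) (A C : Finset β) : Prop :=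
  A ≠ C ∧ IsBlock G A ∧ IsBlock G C ∧ ∃ P, IsChild G A P ∧ IsChild G C P

def CherryF (F : List (Clus β)) (A C : Finset β) : Prop := ∃ G ∈ F, CherryOf G A C

/-- common cherry of `R` and `F`. -/
def IsCommon (R : Clus β) (F : List (Clus β)) (A C : Finset β) : Prop :=
  CherryR R A C ∧ CherryF F A C

/-- contradicting cherry of `R` and `F`. -/
def IsContra (R : Clus β) (F : List (Clus β)) (A C : Finset β) : Prop :=
  CherryR R A C ∧ ¬ CherryF F A C

/-- Leaf `A` of `R` refers to an isolated node of `F`. -/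
def IsolRef (R : Clus β) (F : List (Clus β)) (A : Finset β) : Prop :=
  IsBlock R A ∧ ({A} : Clus β) ∈ F

/-- `P` has at least three children in `G`. -/
def Deg3 (G : Clus β) (P : Finset β) : Prop :=
  ∃ D1 D2 D3, IsChild G D1 P ∧ IsChild G D2 P ∧ IsChild G D3 P ∧
    D1 ≠ D2 ∧ D1 ≠ D3 ∧ D2 ≠ D3

/-- Processing a common cherry (Case 2 of allMulMAFs): contract `{A,C}` in `R`
and in its component of `F`, and record the contraction in `M` (with `⊤` iff
both parents are multifurcating). -/
def ConApply (s : St β) (A C : Finset β) (t : St β) : Prop :=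
  IsCommon s.1 s.2.1 A C ∧
  ∃ G F', G ∈ s.2.1 ∧ CherryOf G A C ∧ ReplaceIn s.2.1 F' G [conCh G A C] ∧
  ∃ PR PG, IsChild s.1 A PR ∧ IsChild G A PG ∧
  ∃ b : Bool, ((b = true) ↔ (Deg3 s.1 PR ∧ Deg3 G PG)) ∧
    t = (conCh s.1 A C, F', Function.update s.2.2 (A ∪ C) (some (A, C, b)))

/-- The update of `M` when cutting the in-edge of the leaf `A` in its
component `G` (Case 3a of allMulMAFs). -/
def CutUpd (G : Clus β) (A : Finset β) (M M' : MapT β) : Prop :=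
  (∃ P D, IsChild G A P ∧ IsChild G D P ∧ D ≠ A ∧
      (∀ E, IsChild G E P → E = A ∨ E = D) ∧ IsBlock G D ∧ M' = remapBot M D) ∨
  ((¬ ∃ P D, IsChild G A P ∧ IsChild G D P ∧ D ≠ A ∧
      (∀ E, IsChild G E P → E = A ∨ E = D) ∧ IsBlock G D) ∧ M' = M)

/-- Cut the in-edge `e_A` of the leaf labeled `A` of a contradicting cherry
`{A, C}` in the forest. -/
def CutApply (s : St β) (A C : Finset β) (t : St β) : Prop :=
  IsContra s.1 s.2.1 A C ∧
  ∃ G F' M', G ∈ s.2.1 ∧ IsBlock G A ∧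
    ReplaceIn s.2.1 F' G [({A} : Clus β), restr G (grd G \ A)] ∧
    CutUpd G A s.2.2 M' ∧ t = (s.1, F', M')

/-- `D` is a node on the path connecting the leaves `A` and `C` in `G`. -/
def PathNode (G : Clus β) (A C D : Finset β) : Prop :=
  D ∈ G ∧ D ≠ A ∧ D ≠ C ∧
  ((A ⊆ D ∧ ¬ C ⊆ D) ∨ (C ⊆ D ∧ ¬ A ⊆ D) ∨ IsLca G (A ∪ C) D)

/-- `E` is the maximal cluster of `G` below `D` containing `A`. -/
def IsMaxSub (G : Clus β) (A D E : Finset β) : Prop :=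
  E ∈ G ∧ A ⊆ E ∧ E ⊂ D ∧ ∀ E' ∈ G, A ⊆ E' → E' ⊂ D → E' ⊆ E

/-- `P` is the ground set of the (grouped) pendant subtree hanging off the
path node `D` of the path connecting `A` and `C`. -/
def PendGround (G : Clus β) (A C D P : Finset β) : Prop :=
  PathNode G A C D ∧
  ((A ⊆ D ∧ ¬ C ⊆ D ∧ ∃ E, IsMaxSub G A D E ∧ P = D \ E) ∨
   (C ⊆ D ∧ ¬ A ⊆ D ∧ ∃ E, IsMaxSub G C D E ∧ P = D \ E) ∨
   (IsLca G (A ∪ C) D ∧ ∃ E1 E2, IsMaxSub G A D E1 ∧ IsMaxSub G C D E2 ∧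
      P = D \ (E1 ∪ E2)))

/-- The (grouped) pendant component with ground set `P`. -/
noncomputable def pendComp (G : Clus β) (P : Finset β) : Clus β :=
  insert P (below G P)

/-- The component still containing `A` and `C` after cutting all pendant
edges of the `A`–`C` path (`L` = lca of `{A, C}`). -/
noncomputable def acComp (G : Clus β) (A C L : Finset β) : Clus β :=
  (G.image (fun D => D \ (L \ (A ∪ C)))).erase ∅

/-- Cutting the set `E_B` of pendant edges of `F[A ∼ C]`: the component `G`
is replaced by the `A`–`C` component together with all grouped pendant
components. -/
def CutPend (G : Clus β) (A C : Finset β) (out : List (Clus β)) : Prop :=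
  ∃ L, IsLca G (A ∪ C) L ∧
  ∃ pend : List (Clus β),
    (∀ Q ∈ pend, ∃ D P, PendGround G A C D P ∧ P.Nonempty ∧ Q = pendComp G P) ∧
    (∀ D P, PendGround G A C D P → P.Nonempty → pendComp G P ∈ pend) ∧
    pend.Nodup ∧ out = acComp G A C L :: pend

/-- The update of `M` in Case 3b of allMulMAFs. -/
def PendUpd (G : Clus β) (A C : Finset β) (M M' : MapT β) : Prop :=
  ∃ PA PC L, IsChild G A PA ∧ IsChild G C PC ∧ IsLca G (A ∪ C) L ∧
    M' = remapIf (PA ≠ L) A (remapIf (PC ≠ L) C M)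

/-- Case 3b (third branch) of allMulMAFs: cut all pendant edges of
`F[A ∼ C]`. -/
def PendApply (s : St β) (A C : Finset β) (t : St β) : Prop :=
  IsContra s.1 s.2.1 A C ∧
  ∃ G new F' M', G ∈ s.2.1 ∧ IsBlock G A ∧ IsBlock G C ∧
    CutPend G A C new ∧ ReplaceIn s.2.1 F' G new ∧
    PendUpd G A C s.2.2 M' ∧ t = (s.1, F', M')

/-- One expansion step of a contracted cherry, as prescribed by `M`
(`b = false` is `⊥`, `b = true` is `⊤`). -/
def ExpandStep (M : MapT β) (F F' : List (Clus β)) : Prop :=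
  ∃ G A X1 X2 b, IsBlock G A ∧ M A = some (X1, X2, b) ∧
    ReplaceIn F F' G
      [if b then insert X1 (insert X2 (G.erase A)) else insert X1 (insert X2 G)]

/-- Exhaustively expand the forest `F` as prescribed in `M`. -/
def Expands (M : MapT β) (F F' : List (Clus β)) : Prop :=
  Relation.ReflTransGen (ExpandStep M) F F' ∧
  ∀ G ∈ F', ∀ A, IsBlock G A → M A = none

/-- `R` consists of a single leaf. -/
def SingleLeaf (R : Clus β) : Prop := ∃ A, R = ({A} : Clus β)

/-- Case 1c of allMulMAFs: remove a leaf of `R` referring to an isolated node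
of `F`. -/
def IsolApply (s : St β) (A : Finset β) (t : St β) : Prop :=
  IsolRef s.1 s.2.1 A ∧ t = (rmBlock s.1 A, s.2.1, remapBot s.2.2 A)

/-- One recursive call of the algorithm allMulMAFs (Cases 1c, 2, 3a, 3b),
with the priority of the cases as in the paper and the abort conditions of
Cases 1a/1b as guards. -/
def AMFStep (k : ℕ) (s t : St β) : Prop :=
  s.2.1.length ≤ k ∧ ¬ SingleLeaf s.1 ∧
  ((∃ A, IsolApply s A t) ∨
   ((¬ ∃ A, IsolRef s.1 s.2.1 A) ∧ ∃ A C, ConApply s A C t) ∨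
   ((¬ ∃ A, IsolRef s.1 s.2.1 A) ∧ (¬ ∃ A C, IsCommon s.1 s.2.1 A C) ∧
     ∃ A C, (CutApply s A C t ∨ PendApply s A C t)))

/-- The initial state: `R = T1`, `F = {T2}` (both `ρ`-augmented), `M = ∅`. -/
def initSt (T1 T2 : Clus β) (ρ : β) : St β :=
  (aug T1 ρ, [aug T2 ρ], fun _ => none)

/-- `out` is one of the forests returned by `allMulMAFs(T1, {T2}, ∅, k)`. -/
def AMFRun (T1 T2 : Clus β) (ρ : β) (k : ℕ) (out : List (Clus β)) : Prop :=
  ∃ s : St β, Relation.ReflTransGen (AMFStep k) (initSt T1 T2 ρ) s ∧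
    SingleLeaf s.1 ∧ s.2.1.length ≤ k ∧ Expands s.2.2 s.2.1 out

/-- allMAFs¹ = allMAAFs¹ of Albrecht (2015) without the acyclicity check; by
Remark 2 of the paper, on binary input trees it processes cherries exactly as
allMulMAFs does. -/
def allMAFs1Run (T1 T2 : Clus β) (ρ : β) (k : ℕ) (out : List (Clus β)) : Prop :=
  AMFRun T1 T2 ρ k out

/-! ### allMulMAFs*: pseudo cherries and preparation -/

/-- proper leaf of `R` and `F`: its counterpart in `F` is a child of a root. -/
def ProperLeaf (R : Clus β) (F : List (Clus β)) (A : Finset β) : Prop :=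
  IsBlock R A ∧ ∃ G ∈ F, IsChild G A (grd G)

/-- The leaves of `R` lying below `D`. -/
noncomputable def blocksIn (R : Clus β) (D : Finset β) : Finset (Finset β) :=
  R.filter (fun E => IsBlock R E ∧ E ⊆ D)

/-- pseudo cherry `{A, C}` for `R` and `F`. -/
def PseudoCherry (R : Clus β) (F : List (Clus β)) (A C : Finset β) : Prop :=
  IsBlock R A ∧ IsBlock R C ∧ A ≠ C ∧
  ∃ L, IsLca R (A ∪ C) L ∧
    (∀ D, IsChild R D L →
      (blocksIn R D).card ≤ ((blocksIn R D).filter (fun B => ProperLeaf R F B)).card + 1) ∧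
    (∃ B, ProperLeaf R F B ∧ B ⊆ L ∧ B ≠ A ∧ B ≠ C)

/-- `B` is a leaf pendant to the path connecting `A` and `C` in `R`. -/
def PendantOnPath (R : Clus β) (A C B : Finset β) : Prop :=
  IsBlock R B ∧ B ≠ A ∧ B ≠ C ∧ ∃ P, IsChild R B P ∧ PathNode R A C P

/-- Cut the leaf labeled `B` out of its component of the forest. -/
def CutB (B : Finset β) (F F' : List (Clus β)) : Prop :=
  ∃ G, G ∈ F ∧ IsBlock G B ∧
    ReplaceIn F F' G [({B} : Clus β), restr G (grd G \ B)]

inductive CutsList : List (Finset β) → List (Clus β) → List (Clus β) → Prop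
  | nil (F) : CutsList [] F F
  | cons (B l F F1 F') : CutB B F F1 → CutsList l F1 F' → CutsList (B :: l) F F'

/-- Preparing a pseudo cherry `{A, C}`: all pendant proper leaves on the
`A`–`C` path are removed from `R`, cut in `F`, and re-mapped to `⊥` in `M`. -/
def Prep (s : St β) (A C : Finset β) (t : St β) : Prop :=
  ∃ l : List (Finset β), l.Nodup ∧
    (∀ B, B ∈ l ↔ (PendantOnPath s.1 A C B ∧ ProperLeaf s.1 s.2.1 B)) ∧
    ∃ F', CutsList l s.2.1 F' ∧
      t = (restr s.1 (grd s.1 \ l.foldr (· ∪ ·) ∅), F',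
           l.foldr (fun B M => remapBot M B) s.2.2)

/-- Prepare `{A, C}` if it is a pseudo cherry; otherwise do nothing. -/
def PrepOpt (s : St β) (A C : Finset β) (t : St β) : Prop :=
  (CherryR s.1 A C ∧ t = s) ∨ (PseudoCherry s.1 s.2.1 A C ∧ Prep s A C t)

/-- One recursive call of the modified algorithm allMulMAFs*. -/
def AMFSStep (k : ℕ) (s t : St β) : Prop :=
  s.2.1.length ≤ k ∧ ¬ SingleLeaf s.1 ∧
  ((∃ A, IsolApply s A t) ∨
   ((¬ ∃ A, IsolRef s.1 s.2.1 A) ∧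
     ∃ A C s0, (CherryR s.1 A C ∨ PseudoCherry s.1 s.2.1 A C) ∧ PrepOpt s A C s0 ∧
       (ConApply s0 A C t ∨ CutApply s0 A C t ∨ PendApply s0 A C t)))

/-- `out` is one of the forests returned by `allMulMAFs*(T1, {T2}, ∅, k)`. -/
def AMFSRun (T1 T2 : Clus β) (ρ : β) (k : ℕ) (out : List (Clus β)) : Prop :=
  ∃ s : St β, Relation.ReflTransGen (AMFSStep k) (initSt T1 T2 ρ) s ∧
    SingleLeaf s.1 ∧ s.2.1.length ≤ k ∧ Expands s.2.2 s.2.1 out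

/-! ### ProcessCherries and cherry lists -/

/-- The four ways `∪_{ac}, ∤_a, ∤_c, ∩_{ac}` of processing a cherry. -/
inductive Phi : Type
  | con : Phi
  | cutL : Phi
  | cutR : Phi
  | path : Phi

/-- A cherry action `Λᵢ = ({a, c}, φᵢ)`. -/
structure Act (β : Type) where
  A : Finset β
  C : Finset β
  phi : Phi

def RemIsolStep (s t : St β) : Prop := ∃ A, IsolApply s A t

/-- Exhaustively remove from `R` every leaf referring to an isolated node
of `F` (line 13 of Algorithm 1). -/
def RemIsolAll (s t : St β) : Prop :=
  Relation.ReflTransGen RemIsolStep s t ∧ ¬ ∃ A, IsolRef t.1 t.2.1 A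

/-- One iteration of `ProcessCherries` on the cherry action `a` (returning a
state rather than `∅`). -/
def PCStep (a : Act β) (s t : St β) : Prop :=
  (CherryR s.1 a.A a.C ∨ PseudoCherry s.1 s.2.1 a.A a.C) ∧
  ∃ s0, PrepOpt s a.A a.C s0 ∧
  ∃ s1, ((a.phi = Phi.con ∧ ConApply s0 a.A a.C s1) ∨
         (a.phi = Phi.cutL ∧ CutApply s0 a.A a.C s1) ∨
         (a.phi = Phi.cutR ∧ CutApply s0 a.C a.A s1) ∨
         (a.phi = Phi.path ∧ PendApply s0 a.A a.C s1)) ∧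
  RemIsolAll s1 t

inductive PCRun : St β → List (Act β) → St β → Prop
  | nil (s) : PCRun s [] s
  | cons (a l s s1 t) : PCStep a s s1 → PCRun s1 l t → PCRun s (a :: l) t

/-- `Λ` is a cherry list for `T1` and `T2`: `ProcessCherries(T1, {T2}, Λ)`
does not return `∅`. -/
def CherryList (T1 T2 : Clus β) (ρ : β) (Λ : List (Act β)) : Prop :=
  ∃ s, PCRun (initSt T1 T2 ρ) Λ s

/-- `out` is the forest returned by `ProcessCherries(T1, {T2}, Λ)` (after the
final expansion). -/
def PCOut (T1 T2 : Clus β) (ρ : β) (Λ : List (Act β)) (out : List (Clus β)) : Prop :=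
  ∃ s, PCRun (initSt T1 T2 ρ) Λ s ∧ Expands s.2.2 s.2.1 out

/-- every component of `Fh` is a binary resolution of a component of `F`. -/
def BinResF (Fh F : List (Clus β)) : Prop := ∀ Gh ∈ Fh, ∃ G ∈ F, BinRes Gh G

/-- pseudo binary resolution of a forest. -/
def PseudoBinResF (Fh F : List (Clus β)) : Prop :=
  ∀ Gh ∈ Fh, ∃ G ∈ F,
    BinRes Gh G ∨ ∃ D, IsChild G D (grd G) ∧ BinRes Gh (below G D)

/-! ### Trees reflecting a forest, the expanded ancestor-descendant graph,
exit nodes, and the refinement step of allMulMAAFs -/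

/-- `U` is a tree reflecting the forest `F` with respect to `T`: a refinement
of `T` in which the components of `F` embed as node-disjoint subtrees. -/
def Reflects (U T : Clus β) (F : List (Clus β)) : Prop :=
  Refines U T ∧
  (∀ G ∈ F, Refines G (restr U (grd G))) ∧
  F.Pairwise (fun G H => ∀ C, ¬ (NodeInSpan U (grd G) C ∧ NodeInSpan U (grd H) C))

/-- `φ⁻¹`: the node `v` of the reflecting tree `U` maps back to the node
`p.2` of the component `p.1` of `F`. -/
def PhiInv (U : Clus β) (F : List (Clus β)) (v : Finset β) (p : Clus β × Finset β) : Prop :=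
  p.1 ∈ F ∧ v ∈ U ∧ NodeInSpan U (grd p.1) v ∧ p.2 = v ∩ grd p.1 ∧ p.2 ∈ p.1

/-- Hybrid edge of `AG^ex` stemming from the reflecting tree `U`, pointing
from the node `x` to the root of the component `H`. -/
def HybEdgeT (U : Clus β) (F : List (Clus β)) (x : Clus β × Finset β) (H : Clus β) : Prop :=
  H ∈ F ∧ ∃ u v', IsLca U (grd H) u ∧ v' ∈ U ∧ u ⊂ v' ∧ PhiInv U F v' x ∧
    ∀ v'' ∈ U, u ⊂ v'' → (∃ q, PhiInv U F v'' q) → v' ⊆ v''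

def Hyb1 (ρ : β) (U1 : Clus β) (F : List (Clus β)) (x y : Clus β × Finset β) : Prop :=
  ∃ H, H ∈ F ∧ ρ ∉ grd H ∧ y = (H, grd H) ∧ HybEdgeT U1 F x H

/-- Edge of the expanded ancestor-descendant graph
`AG^ex(U1, U2, F)`: a tree edge inside a component or a hybrid edge. -/
def ExEdge (ρ : β) (U1 U2 : Clus β) (F : List (Clus β)) (x y : Clus β × Finset β) : Prop :=
  (x.1 ∈ F ∧ x.1 = y.1 ∧ IsChild x.1 y.2 x.2) ∨ Hyb1 ρ U1 F x y ∨ Hyb1 ρ U2 F x y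

/-- Exit node of `AG^ex(U1, U2, F)`: the source of a hybrid edge on a directed
cycle whose preceding hybrid edge along the cycle stems from the other tree. -/
def IsExitNode (ρ : β) (U1 U2 : Clus β) (F : List (Clus β)) (v : Clus β × Finset β) : Prop :=
  ∃ m : ℕ, 0 < m ∧ ∃ c : ZMod m → Clus β × Finset β,
    (∀ i, ExEdge ρ U1 U2 F (c i) (c (i + 1))) ∧
    ∃ i : ZMod m, c i = v ∧ ∃ d : ℕ, 0 < d ∧ d < m ∧
      ((Hyb1 ρ U1 F (c i) (c (i + 1)) ∧
          Hyb1 ρ U2 F (c (i - (d : ZMod m))) (c (i - (d : ZMod m) + 1))) ∨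
       (Hyb1 ρ U2 F (c i) (c (i + 1)) ∧
          Hyb1 ρ U1 F (c (i - (d : ZMod m))) (c (i - (d : ZMod m) + 1)))) ∧
      ∀ e : ℕ, 0 < e → e < d →
        (¬ Hyb1 ρ U1 F (c (i - (e : ZMod m))) (c (i - (e : ZMod m) + 1)) ∧
         ¬ Hyb1 ρ U2 F (c (i - (e : ZMod m))) (c (i - (e : ZMod m) + 1)))

/-- Ground set of the piece obtained at the chain node `E` when cutting every
edge on the path from the node `C` to the root of its component. -/
def ChainGround (G : Clus β) (C E P : Finset β) : Prop :=
  E ∈ G ∧ C ⊂ E ∧ ∃ E', IsMaxSub G C E E' ∧ P = E \ E'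

/-- Fixing the exit node `(G, C)`: cut every edge on the path connecting `C`
with the root of `G`. -/
def FixExit (G : Clus β) (C : Finset β) (out : List (Clus β)) : Prop :=
  ∃ pend : List (Clus β),
    (∀ Q ∈ pend, ∃ E P, ChainGround G C E P ∧ Q = pendComp G P) ∧
    (∀ E P, ChainGround G C E P → pendComp G P ∈ pend) ∧
    pend.Nodup ∧ out = below G C :: pend

/-- Fix one exit node of `AG^ex(U1, U2, F)` in the forest `F`. -/
def FixExitF (ρ : β) (U1 U2 : Clus β) (F F' : List (Clus β)) : Prop :=
  ∃ v, IsExitNode ρ U1 U2 F v ∧ ∃ out, FixExit v.1 v.2 out ∧ ReplaceIn F F' v.1 out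

/-- One round of the refinement step of allMulMAAFs: build reflecting trees
`T1(F)`, `T2(F)`, build `AG^ex`, and fix an exit node. -/
def RefStep (ρ : β) (T1 T2 : Clus β) (F F' : List (Clus β)) : Prop :=
  ∃ U1 U2, Reflects U1 (aug T1 ρ) F ∧ Reflects U2 (aug T2 ρ) F ∧ FixExitF ρ U1 U2 F F'

/-- `out` is one of the forests returned by `allMulMAAFs(T1, {T2}, ∅, k)`:
an agreement forest produced by allMulMAFs, refined by repeatedly fixing exit
nodes into an acyclic agreement forest of size at most `k`. -/
def AMAAFRun (T1 T2 : Clus β) (ρ : β) (k : ℕ) (out : List (Clus β)) : Prop :=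
  ∃ mid, AMFRun T1 T2 ρ k mid ∧
    Relation.ReflTransGen (fun F F' => RefStep ρ T1 T2 F F' ∧ F'.length ≤ k) mid out ∧
    out.length ≤ k ∧ (∀ G, ¬ Relation.TransGen (AGEdge ρ T1 T2 out) G G)

/-! ### Resolving and cutting -/

/-- componentwise refinement of a forest. -/
def ResolvesF (F F' : List (Clus β)) : Prop :=
  List.Forall₂ (fun G G' => Refines G' G) F F'

/-- Cut one edge (the in-edge of the node with cluster `C`) in one component. -/
def CutF (F F' : List (Clus β)) : Prop :=
  ∃ l1 G l2 C, F = l1 ++ G :: l2 ∧ C ∈ G ∧ C ≠ grd G ∧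
    F' = l1 ++ below G C :: restr G (grd G \ C) :: l2

/-- `F'` is obtained from `F` by first resolving some multifurcating nodes and
then cutting some edges. -/
def ObtainedRC (F F' : List (Clus β)) : Prop :=
  ∃ Fm, ResolvesF F Fm ∧ Relation.ReflTransGen CutF Fm F'


def Bn (G : Clus β) : Prop := ∀ C ∈ G, ¬ IsBlock G C → ∃ D ∈ G, ∃ E ∈ G, Disjoint D E ∧
  C = D ∪ E ∧ ∀ F ∈ G, F ⊂ C → F ⊆ D ∨ F ⊆ E

structure Tr (G : Clus β) : Prop where
  ne : ∀ C ∈ G, C.Nonempty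
  lam : ∀ C ∈ G, ∀ D ∈ G, C ⊆ D ∨ D ⊆ C ∨ Disjoint C D
  top : grd G ∈ G
  bn : Bn G

lemma sub_grd {G : Clus β} {C : Finset β} (h : C ∈ G) : C ⊆ grd G := by
  have := Finset.le_sup (f := id) h
  simpa [grd] using this

lemma grd_eq {G : Clus β} {W : Finset β} (h : W ∈ G) (h' : ∀ C ∈ G, C ⊆ W) : grd G = W := by
  apply Finset.Subset.antisymm
  · unfold grd
    exact Finset.sup_le (fun C hC => h' C hC)
  · exact sub_grd h

lemma mem_restr {G : Clus β} {S E : Finset β} :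
    E ∈ restr G S ↔ E.Nonempty ∧ ∃ D ∈ G, D ∩ S = E := by
  simp [restr, Finset.nonempty_iff_ne_empty]

lemma block_or {G : Clus β} (hG : Tr G) {B D : Finset β} (hB : IsBlock G B) (hD : D ∈ G) :
    B ⊆ D ∨ Disjoint B D := by
  rcases hG.lam B hB.1 D hD with h | h | h
  · exact Or.inl h
  · left; rw [hB.2 D hD h]
  · exact Or.inr h

lemma block_eq {G : Clus β} (hG : Tr G) {B D : Finset β} (hB : IsBlock G B) (hD : IsBlock G D)
    (h : ¬ Disjoint B D) : B = D := by
  rcases block_or hG hB hD.1 with h' | h'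
  · exact hD.2 B hB.1 h'
  · exact absurd h' h

lemma exists_block {G : Clus β} (hG : Tr G) {C : Finset β} (hC : C ∈ G) {x : β} (hx : x ∈ C) :
    ∃ B, IsBlock G B ∧ x ∈ B ∧ B ⊆ C := by
  induction C using Finset.strongInduction with
  | H C ih =>
    by_cases hb : IsBlock G C
    · exact ⟨C, hb, hx, Finset.Subset.refl _⟩
    · obtain ⟨D, hD, E, hE, hdis, rfl, -⟩ := hG.bn C hC hb
      have hDn := hG.ne D hD
      have hEn := hG.ne E hE
      rcases Finset.mem_union.1 hx with h | h
      · obtain ⟨B, h1, h2, h3⟩ := ih D (by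
          refine ⟨Finset.subset_union_left, fun hh => ?_⟩
          obtain ⟨y, hy⟩ := hEn
          exact Finset.disjoint_left.1 hdis (hh (Finset.mem_union_right _ hy)) hy) hD h
        exact ⟨B, h1, h2, h3.trans Finset.subset_union_left⟩
      · obtain ⟨B, h1, h2, h3⟩ := ih E (by
          refine ⟨Finset.subset_union_right, fun hh => ?_⟩
          obtain ⟨y, hy⟩ := hDn
          exact Finset.disjoint_left.1 hdis hy (hh (Finset.mem_union_left _ hy))) hE h
        exact ⟨B, h1, h2, h3.trans Finset.subset_union_right⟩

def Sat (G : Clus β) (S : Finset β) : Prop := ∀ B, IsBlock G B → B ⊆ S ∨ Disjoint B S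

lemma restr_restr {G : Clus β} {S Y : Finset β} (h : Y ⊆ S) : restr (restr G S) Y = restr G Y := by
  ext E
  simp only [mem_restr]
  constructor
  · rintro ⟨hE, D, ⟨hD, D', hD', rfl⟩, rfl⟩
    refine ⟨hE, D', hD', ?_⟩
    rw [Finset.inter_assoc, Finset.inter_eq_right.2 h]
  · rintro ⟨hE, D, hD, rfl⟩
    refine ⟨hE, D ∩ S, ⟨hE.mono (Finset.inter_subset_inter_left h), D, hD, rfl⟩, ?_⟩
    rw [Finset.inter_assoc, Finset.inter_eq_right.2 h]

lemma restr_grd {G : Clus β} (hG : grd G ∈ G) {S : Finset β} (hS : S ⊆ grd G) (hn : S.Nonempty) :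
    grd (restr G S) = S ∧ S ∈ restr G S := by
  have h1 : S ∈ restr G S := mem_restr.2 ⟨hn, grd G, hG, Finset.inter_eq_right.2 hS⟩
  refine ⟨grd_eq h1 ?_, h1⟩
  intro C hC
  obtain ⟨-, D, -, rfl⟩ := mem_restr.1 hC
  exact Finset.inter_subset_right

lemma restr_block {G : Clus β} (hG : Tr G) {S : Finset β} (hS : Sat G S) (B : Finset β) :
    IsBlock (restr G S) B ↔ IsBlock G B ∧ B ⊆ S := by
  constructor
  · rintro ⟨h1, h2⟩
    obtain ⟨⟨x, hx⟩, D, hD, rfl⟩ := mem_restr.1 h1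
    have hx' := Finset.mem_inter.1 hx
    obtain ⟨B, hB, hxB, hBD⟩ := exists_block hG hD hx'.1
    have hBS : B ⊆ S := by
      rcases hS B hB with h | h
      · exact h
      · exact absurd hx'.2 (Finset.disjoint_left.1 h hxB)
    have := h2 B (mem_restr.2 ⟨⟨x, hxB⟩, B, hB.1, Finset.inter_eq_left.2 hBS⟩)
      (Finset.subset_inter hBD hBS)
    rw [← this]
    exact ⟨hB, hBS⟩
  · rintro ⟨hB, hBS⟩
    refine ⟨mem_restr.2 ⟨hG.ne B hB.1, B, hB.1, Finset.inter_eq_left.2 hBS⟩, ?_⟩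
    intro C hC hCB
    obtain ⟨⟨x, hx⟩, D, hD, rfl⟩ := mem_restr.1 hC
    apply Finset.Subset.antisymm hCB
    rcases block_or hG hB hD with h | h
    · exact Finset.subset_inter h hBS
    · exact absurd (Finset.mem_inter.1 hx).1 (Finset.disjoint_left.1 h (hCB hx))

lemma restr_Tr {G : Clus β} (hG : Tr G) {S : Finset β} (hS : Sat G S) (hSG : S ⊆ grd G)
    (hn : S.Nonempty) : Tr (restr G S) where
  ne := fun C hC => (mem_restr.1 hC).1
  lam := by
    intro C hC D hD
    obtain ⟨-, C', hC', rfl⟩ := mem_restr.1 hC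
    obtain ⟨-, D', hD', rfl⟩ := mem_restr.1 hD
    rcases hG.lam C' hC' D' hD' with h | h | h
    · exact Or.inl (Finset.inter_subset_inter_right h)
    · exact Or.inr (Or.inl (Finset.inter_subset_inter_right h))
    · exact Or.inr (Or.inr (h.mono Finset.inter_subset_left Finset.inter_subset_left))
  top := by
    have := restr_grd hG.top hSG hn
    rw [this.1]; exact this.2
  bn := by
    intro C hC hCb
    obtain ⟨hCn, C0, hC0, hCe⟩ := mem_restr.1 hC
    -- minimal representative
    obtain ⟨M, hM, hmin⟩ := Finset.exists_min_image (G.filter (fun D => D ∩ S = C)) Finset.card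
      ⟨C0, Finset.mem_filter.2 ⟨hC0, hCe⟩⟩
    obtain ⟨hMG, hMC⟩ := Finset.mem_filter.1 hM
    have hMb : ¬ IsBlock G M := by
      intro h
      apply hCb
      rw [restr_block hG hS]
      obtain ⟨x, hx⟩ := hCn
      rcases hS M h with h' | h'
      · rw [← hMC, Finset.inter_eq_left.2 h']; exact ⟨h, h'⟩
      · rw [← hMC] at hx
        exact absurd (Finset.mem_inter.1 hx).2 (Finset.disjoint_left.1 h' (Finset.mem_inter.1 hx).1)
    obtain ⟨D, hD, E, hE, hdis, hMe, hsub⟩ := hG.bn M hMG hMb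
    have hDn := hG.ne D hD
    have hEn := hG.ne E hE
    have hlt : ∀ K ∈ G, K ∩ S = C → M.card ≤ K.card := fun K hK h =>
      hmin K (Finset.mem_filter.2 ⟨hK, h⟩)
    have hcard : M.card = D.card + E.card := by rw [hMe, Finset.card_union_of_disjoint hdis]
    have hDp := hDn.card_pos
    have hEp := hEn.card_pos
    have hCDE : C = D ∩ S ∪ E ∩ S := by rw [← hMC, hMe, Finset.union_inter_distrib_right]
    have hDS : (D ∩ S).Nonempty := by
      by_contra h
      rw [Finset.not_nonempty_iff_eq_empty] at h
      have := hlt E hE (by rw [hCDE, h, Finset.empty_union])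
      omega
    have hES : (E ∩ S).Nonempty := by
      by_contra h
      rw [Finset.not_nonempty_iff_eq_empty] at h
      have := hlt D hD (by rw [hCDE, h, Finset.union_empty])
      omega
    refine ⟨D ∩ S, mem_restr.2 ⟨hDS, D, hD, rfl⟩, E ∩ S, mem_restr.2 ⟨hES, E, hE, rfl⟩,
      hdis.mono Finset.inter_subset_left Finset.inter_subset_left, hCDE, ?_⟩
    intro F hF hFC
    obtain ⟨⟨x, hx⟩, F', hF', rfl⟩ := mem_restr.1 hF
    rcases hG.lam F' hF' M hMG with h | h | h
    · rcases eq_or_ne F' M with rfl | hne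
      · exact absurd hMC hFC.ne
      · rcases hsub F' hF' (lt_of_le_of_ne h hne) with h' | h'
        · exact Or.inl (Finset.inter_subset_inter_right h')
        · exact Or.inr (Finset.inter_subset_inter_right h')
    · exact absurd (hMC ▸ Finset.inter_subset_inter_right h : C ⊆ F' ∩ S) hFC.2
    · exfalso
      have := hFC.1 hx
      rw [← hMC] at this
      exact Finset.disjoint_left.1 h (Finset.mem_inter.1 hx).1 (Finset.mem_inter.1 this).1


def Cr (Y D : Finset β) : Prop := (Y ∩ D).Nonempty ∧ ¬ Y ⊆ D

structure Phy (W : Finset β) (U : Clus β) : Prop where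
  ne : ∀ C ∈ U, C.Nonempty
  sub : ∀ C ∈ U, C ⊆ W
  lam : ∀ C ∈ U, ∀ D ∈ U, C ⊆ D ∨ D ⊆ C ∨ Disjoint C D
  top : W ∈ U
  sing : ∀ x ∈ W, ({x} : Finset β) ∈ U

lemma Phy.grd {W : Finset β} {U : Clus β} (h : Phy W U) : grd U = W := grd_eq h.top h.sub

lemma Phy.block {W : Finset β} {U : Clus β} (h : Phy W U) (B : Finset β) :
    IsBlock U B ↔ ∃ x ∈ W, B = {x} := by
  constructor
  · rintro ⟨h1, h2⟩
    obtain ⟨x, hx⟩ := h.ne B h1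
    have hxW := h.sub B h1 hx
    exact ⟨x, hxW, (h2 _ (h.sing x hxW) (Finset.singleton_subset_iff.2 hx)).symm⟩
  · rintro ⟨x, hx, rfl⟩
    refine ⟨h.sing x hx, fun C hC hCx => ?_⟩
    rcases Finset.subset_singleton_iff.1 hCx with h' | h'
    · exact absurd h' (h.ne C hC).ne_empty
    · exact h'

lemma Phy.isPhylo {W : Finset β} {U : Clus β} (h : Phy W U) : IsPhylo W U := by
  refine ⟨⟨⟨W, h.top⟩, h.ne, h.lam, by rw [h.grd]; exact h.top, ?_⟩, h.grd, h.sing⟩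
  intro x hx
  rw [h.grd] at hx
  exact ⟨{x}, (h.block _).2 ⟨x, hx, rfl⟩, by simp⟩

lemma IsPhylo.phy {W : Finset β} {U : Clus β} (h : IsPhylo W U) : Phy W U := by
  obtain ⟨⟨h1, h2, h3, h4, h5⟩, h6, h7⟩ := h
  exact ⟨h2, fun C hC => h6 ▸ sub_grd hC, h3, h6 ▸ h4, h7⟩

lemma Phy.tr {W : Finset β} {U : Clus β} (h : Phy W U) (hb : Bn U) : Tr U :=
  ⟨h.ne, h.lam, by rw [h.grd]; exact h.top, hb⟩

lemma Phy.restr {W : Finset β} {U : Clus β} (h : Phy W U) {S : Finset β} (hS : S ⊆ W)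
    (hn : S.Nonempty) : Phy S (restr U S) where
  ne := fun C hC => (mem_restr.1 hC).1
  lam := by
    intro C hC D hD
    obtain ⟨-, C', hC', rfl⟩ := mem_restr.1 hC
    obtain ⟨-, D', hD', rfl⟩ := mem_restr.1 hD
    rcases h.lam C' hC' D' hD' with h | h | h
    · exact Or.inl (Finset.inter_subset_inter_right h)
    · exact Or.inr (Or.inl (Finset.inter_subset_inter_right h))
    · exact Or.inr (Or.inr (h.mono Finset.inter_subset_left Finset.inter_subset_left))
  top := mem_restr.2 ⟨hn, W, h.top, Finset.inter_eq_right.2 hS⟩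
  sub := by
    intro C hC
    obtain ⟨-, D, -, rfl⟩ := mem_restr.1 hC
    exact Finset.inter_subset_right
  sing := by
    intro x hx
    exact mem_restr.2 ⟨⟨x, by simp⟩, {x}, h.sing x (hS hx), by simp [hx]⟩

lemma child_ge {U : Clus β} {F C : Finset β} (hF : F ∈ U) (hC : C ∈ U) (h : F ⊂ C) :
    ∃ D, IsChild U D C ∧ F ⊆ D := by
  obtain ⟨M, hM, hmax⟩ := Finset.exists_max_image (U.filter (fun D => F ⊆ D ∧ D ⊂ C)) Finset.card
      ⟨F, Finset.mem_filter.2 ⟨hF, Finset.Subset.refl _, h⟩⟩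
  obtain ⟨hMU, hFM, hMC⟩ := Finset.mem_filter.1 hM
  refine ⟨M, ⟨hMU, hC, hMC, ?_⟩, hFM⟩
  intro E hE hME hEC
  have := hmax E (Finset.mem_filter.2 ⟨hE, hFM.trans hME, hEC⟩)
  exact (Finset.eq_of_subset_of_card_le hME this).symm

lemma child_disj {U : Clus β} (lam : ∀ C ∈ U, ∀ D ∈ U, C ⊆ D ∨ D ⊆ C ∨ Disjoint C D)
    {C D E : Finset β} (hD : IsChild U D C) (hE : IsChild U E C) : D = E ∨ Disjoint D E := by
  rcases lam D hD.1 E hE.1 with h | h | h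
  · exact Or.inl (hD.2.2.2 E hE.1 h hE.2.2.1).symm
  · exact Or.inl (hE.2.2.2 D hD.1 h hD.2.2.1)
  · exact Or.inr h

noncomputable def kidU (U : Clus β) (C : Finset β) (p : Finset β → Prop) : Finset β :=
  (U.filter (fun D => IsChild U D C ∧ p D)).sup id

lemma mem_kidU {U : Clus β} {C : Finset β} {p : Finset β → Prop} {x : β} :
    x ∈ kidU U C p ↔ ∃ D, IsChild U D C ∧ p D ∧ x ∈ D := by
  simp only [kidU, Finset.mem_sup, Finset.mem_filter, id]
  constructor
  · rintro ⟨D, ⟨-, h1, h2⟩, h3⟩; exact ⟨D, h1, h2, h3⟩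
  · rintro ⟨D, h1, h2, h3⟩; exact ⟨D, ⟨h1.1, h1, h2⟩, h3⟩

lemma kidU_compat {U : Clus β} (lam : ∀ C ∈ U, ∀ D ∈ U, C ⊆ D ∨ D ⊆ C ∨ Disjoint C D)
    {C : Finset β} (hC : C ∈ U) (p : Finset β → Prop) {F : Finset β} (hF : F ∈ U) :
    kidU U C p ⊆ F ∨ F ⊆ kidU U C p ∨ Disjoint (kidU U C p) F := by
  have hsub : kidU U C p ⊆ C := by
    intro x hx
    obtain ⟨D, hD, -, hxD⟩ := mem_kidU.1 hx
    exact hD.2.2.1.1 hxD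
  rcases lam F hF C hC with h | h | h
  · rcases eq_or_ne F C with rfl | hne
    · exact Or.inl hsub
    · obtain ⟨D, hD, hFD⟩ := child_ge hF hC (lt_of_le_of_ne h hne)
      by_cases hp : p D
      · right; left
        intro x hx
        exact mem_kidU.2 ⟨D, hD, hp, hFD hx⟩
      · right; right
        rw [Finset.disjoint_left]
        intro x hx hxF
        obtain ⟨E, hE, hpE, hxE⟩ := mem_kidU.1 hx
        rcases child_disj lam hD hE with rfl | h'
        · exact hp hpE
        · exact Finset.disjoint_left.1 h' (hFD hxF) hxE
  · exact Or.inl (hsub.trans h)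
  · exact Or.inr (Or.inr (h.symm.mono_left hsub))

lemma bn_of_closed {W : Finset β} {U : Clus β} (𝒴 : Finset (Finset β)) (g : Finset β → Clus β)
    (hU : Phy W U) (hg : ∀ Y ∈ 𝒴, Phy Y (g Y) ∧ Bn (g Y))
    (hr : ∀ Y ∈ 𝒴, restr U Y ⊆ g Y)
    (he : ∀ Y ∈ 𝒴, ∀ Z ∈ 𝒴, Y ≠ Z → ∀ D ∈ U, ¬ (Cr Y D ∧ Cr Z D))
    (hmax : ∀ Q : Finset β, Q.Nonempty → Q ⊆ W → (∀ F ∈ U, Q ⊆ F ∨ F ⊆ Q ∨ Disjoint Q F) →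
      (∀ Y ∈ 𝒴, (Q ∩ Y).Nonempty → Q ∩ Y ∈ g Y) →
      (∀ Y ∈ 𝒴, ∀ Z ∈ 𝒴, Y ≠ Z → ¬ (Cr Y Q ∧ Cr Z Q)) → Q ∈ U) : Bn U := by
  intro C hC hCb
  have kid : ∀ x ∈ C, ∃ D, IsChild U D C ∧ x ∈ D := by
    intro x hx
    have hxW := hU.sub C hC hx
    obtain ⟨D, hD, hxD⟩ := child_ge (hU.sing x hxW) hC (by
      refine lt_of_le_of_ne (Finset.singleton_subset_iff.2 hx) ?_
      rintro rfl
      exact hCb ((hU.block _).2 ⟨x, hxW, rfl⟩))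
    exact ⟨D, hD, Finset.singleton_subset_iff.1 hxD⟩
  by_contra hno
  have hmem : ∀ Y ∈ 𝒴, ∀ D ∈ U, (D ∩ Y).Nonempty → D ∩ Y ∈ g Y := fun Y hY D hD hn =>
    hr Y hY (mem_restr.2 ⟨hn, D, hD, rfl⟩)
  -- complements of children are not in U
  have h1 : ∀ D, IsChild U D C → C \ D ∉ U := by
    intro D hD hmemU
    apply hno
    refine ⟨D, hD.1, C \ D, hmemU, Finset.disjoint_sdiff,
      (Finset.union_sdiff_of_subset hD.2.2.1.1).symm, ?_⟩
    intro F hF hFC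
    rcases hU.lam F hF D hD.1 with h | h | h
    · exact Or.inl h
    · left; rw [hD.2.2.2 F hF h hFC]
    · right; exact Finset.subset_sdiff.2 ⟨hFC.1, h⟩
  -- every child is crossed
  have h2 : ∀ D, IsChild U D C → ∃ Y ∈ 𝒴, Cr Y D := by
    intro D hD
    by_contra hc
    push Not at hc
    apply h1 D hD
    have hYD : ∀ Y ∈ 𝒴, Y ⊆ D ∨ Disjoint Y D := by
      intro Y hY
      by_cases h : Y ⊆ D
      · exact Or.inl h
      · right
        have := hc Y hY
        rw [Finset.disjoint_iff_inter_eq_empty, ← Finset.not_nonempty_iff_eq_empty]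
        exact fun h' => this ⟨h', h⟩
    apply hmax
    · rw [Finset.sdiff_nonempty]; exact hD.2.2.1.2
    · exact Finset.sdiff_subset.trans (hU.sub C hC)
    · intro F hF
      rcases hU.lam F hF C hC with h | h | h
      · rcases eq_or_ne F C with rfl | hne
        · exact Or.inl Finset.sdiff_subset
        · rcases hU.lam F hF D hD.1 with h' | h' | h'
          · right; right
            exact Finset.sdiff_disjoint.mono_right h'
          · right; right
            rw [hD.2.2.2 F hF h' (lt_of_le_of_ne h hne)]
            exact Finset.sdiff_disjoint
          · right; left; exact Finset.subset_sdiff.2 ⟨h, h'⟩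
      · exact Or.inl (Finset.sdiff_subset.trans h)
      · exact Or.inr (Or.inr (h.symm.mono_left Finset.sdiff_subset))
    · intro Y hY hn
      rcases hYD Y hY with h | h
      · obtain ⟨x, hx⟩ := hn
        simp only [Finset.mem_inter, Finset.mem_sdiff] at hx
        exact absurd (h hx.2) hx.1.2
      · have : (C \ D) ∩ Y = C ∩ Y := by
          ext x
          simp only [Finset.mem_inter, Finset.mem_sdiff]
          have := @Finset.disjoint_left _ Y D
          have := this.1 h
          grind
        rw [this] at hn ⊢
        exact hmem Y hY C hC hn
    · rintro Y hY Z hZ hne ⟨hcY, hcZ⟩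
      have key : ∀ Y ∈ 𝒴, Cr Y (C \ D) → Cr Y C := by
        intro Y hY hc
        refine ⟨hc.1.mono (Finset.inter_subset_inter_left Finset.sdiff_subset), fun h => ?_⟩
        rcases hYD Y hY with h' | h'
        · obtain ⟨x, hx⟩ := hc.1
          simp only [Finset.mem_inter, Finset.mem_sdiff] at hx
          exact hx.2.2 (h' hx.1)
        · exact hc.2 (Finset.subset_sdiff.2 ⟨h, h'⟩)
      exact he Y hY Z hZ hne C hC ⟨key Y hY hcY, key Z hZ hcZ⟩
  -- a component inside C crossing one child meets all
  have h3 : ∀ Y ∈ 𝒴, Y ⊆ C → ∀ D, IsChild U D C → Cr Y D → ∀ E, IsChild U E C → Cr Y E := by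
    intro Y hY hYC D hD hYD
    have hnot : ∀ E, IsChild U E C → ¬ Y ⊆ E := by
      intro E hE hYE
      obtain ⟨x, hx⟩ := hYD.1
      rw [Finset.mem_inter] at hx
      rcases child_disj hU.lam hD hE with rfl | h
      · exact hYD.2 hYE
      · exact Finset.disjoint_left.1 h hx.2 (hYE hx.1)
    by_contra hE
    push Not at hE
    obtain ⟨E, hE, hYE⟩ := hE
    have hdE : Disjoint Y E := by
      rw [Finset.disjoint_iff_inter_eq_empty, ← Finset.not_nonempty_iff_eq_empty]
      exact fun h' => hYE ⟨h', hnot E hE⟩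
    set Q := kidU U C (fun D => (Y ∩ D).Nonempty) with hQ
    have hYQ : Y ⊆ Q := by
      intro x hx
      obtain ⟨D', hD', hxD'⟩ := kid x (hYC hx)
      exact mem_kidU.2 ⟨D', hD', ⟨x, Finset.mem_inter.2 ⟨hx, hxD'⟩⟩, hxD'⟩
    have hQC : Q ⊆ C := by
      intro x hx
      obtain ⟨D, hD, -, hxD⟩ := mem_kidU.1 hx
      exact hD.2.2.1.1 hxD
    have hDQ : D ⊆ Q := fun x hx => mem_kidU.2 ⟨D, hD, hYD.1, hx⟩
    have hQE : Disjoint Q E := by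
      rw [Finset.disjoint_left]
      intro x hx hxE
      obtain ⟨D', hD', hp, hxD'⟩ := mem_kidU.1 hx
      rcases child_disj hU.lam hD' hE with rfl | h
      · exact hYE ⟨hp, hnot _ hD'⟩
      · exact Finset.disjoint_left.1 h hxD' hxE
    have hothers : ∀ Z ∈ 𝒴, Z ≠ Y → (Z ∩ Q).Nonempty → Z ⊆ Q := by
      intro Z hZ hne ⟨x, hx⟩
      rw [Finset.mem_inter] at hx
      obtain ⟨D', hD', hp, hxD'⟩ := mem_kidU.1 hx.2
      have hYD' : Cr Y D' := ⟨hp, hnot D' hD'⟩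
      have : Z ⊆ D' := by
        by_contra h
        exact he Y hY Z hZ hne.symm D' hD'.1 ⟨hYD', ⟨x, Finset.mem_inter.2 ⟨hx.1, hxD'⟩⟩, h⟩
      exact this.trans (fun x hx => mem_kidU.2 ⟨D', hD', hp, hx⟩)
    have hQU : Q ∈ U := by
      apply hmax
      · exact (hU.ne D hD.1).mono hDQ
      · exact hQC.trans (hU.sub C hC)
      · intro F hF; exact kidU_compat hU.lam hC _ hF
      · intro Z hZ hn
        have hZQ : Z ⊆ Q := by
          by_cases h : Z = Y
          · rw [h]; exact hYQ
          · exact hothers Z hZ h (by rwa [Finset.inter_comm])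
        rw [Finset.inter_eq_right.2 hZQ]
        exact (hg Z hZ).1.top
      · have : ∀ Z ∈ 𝒴, ¬ Cr Z Q := by
          intro Z hZ hc
          by_cases h : Z = Y
          · exact hc.2 (h ▸ hYQ)
          · exact hc.2 (hothers Z hZ h hc.1)
        rintro Z hZ Z' - - ⟨h, -⟩
        exact this Z hZ h
    have hQne : Q ⊂ C := by
      refine lt_of_le_of_ne hQC ?_
      intro h
      obtain ⟨x, hx⟩ := hU.ne E hE.1
      exact Finset.disjoint_left.1 hQE (h ▸ hE.2.2.1.1 hx) hx
    have := hD.2.2.2 Q hQU hDQ hQne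
    exact hYD.2 (this ▸ hYQ)
  -- one component crosses all children
  obtain ⟨x0, hx0⟩ := hU.ne C hC
  obtain ⟨D0, hD0, hxD0⟩ := kid x0 hx0
  obtain ⟨Y, hY, hYD0⟩ := h2 D0 hD0
  have h4 : ∀ E, IsChild U E C → Cr Y E := by
    by_cases hYC : Y ⊆ C
    · exact h3 Y hY hYC D0 hD0 hYD0
    · intro E hE
      obtain ⟨Z, hZ, hZE⟩ := h2 E hE
      by_cases hZY : Z = Y
      · exact hZY ▸ hZE
      · exfalso
        by_cases hZC : Z ⊆ C
        · exact he Z hZ Y hY hZY D0 hD0.1 ⟨h3 Z hZ hZC E hE hZE D0 hD0, hYD0⟩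
        · exact he Z hZ Y hY hZY C hC
            ⟨⟨hZE.1.mono (Finset.inter_subset_inter_left hE.2.2.1.1), hZC⟩,
             ⟨hYD0.1.mono (Finset.inter_subset_inter_left hD0.2.2.1.1), hYC⟩⟩
  have hCY : C ∩ Y ∈ g Y := by
    apply hmem Y hY C hC
    rw [Finset.inter_comm]
    exact hYD0.1.mono (Finset.inter_subset_inter_left hD0.2.2.1.1)
  have hkidY : ∀ E, IsChild U E C → E ∩ Y ∈ g Y ∧ E ∩ Y ⊂ C ∩ Y := by
    intro E hE
    refine ⟨hmem Y hY E hE.1 (by rw [Finset.inter_comm]; exact (h4 E hE).1), ?_⟩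
    refine ⟨Finset.inter_subset_inter_right hE.2.2.1.1, fun hh => ?_⟩
    obtain ⟨x, hx⟩ : (C \ E).Nonempty := Finset.sdiff_nonempty.2 hE.2.2.1.2
    rw [Finset.mem_sdiff] at hx
    obtain ⟨E', hE', hxE'⟩ := kid x hx.1
    obtain ⟨y, hy⟩ := (h4 E' hE').1
    rw [Finset.mem_inter] at hy
    have := hh (Finset.mem_inter.2 ⟨hE'.2.2.1.1 hy.2, hy.1⟩)
    rw [Finset.mem_inter] at this
    rcases child_disj hU.lam hE hE' with rfl | h
    · exact hx.2 hxE'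
    · exact Finset.disjoint_left.1 h this.1 hy.2
  have hnb : ¬ IsBlock (g Y) (C ∩ Y) := by
    intro hb
    have := hkidY D0 hD0
    exact this.2.ne (hb.2 _ this.1 this.2.1)
  obtain ⟨E1, hE1, E2, hE2, hdis, hun, hsub⟩ := (hg Y hY).2 _ hCY hnb
  have gen : ∀ E ∈ g Y, (∀ E' , IsChild U E' C → E' ∩ Y ⊆ E ∨ Disjoint (E' ∩ Y) E) → E ⊆ C ∩ Y →
      kidU U C (fun D => D ∩ Y ⊆ E) ∈ U := by
    intro E hE hEk hEs
    set Q := kidU U C (fun D => D ∩ Y ⊆ E) with hQ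
    have hQC : Q ⊆ C := by
      intro x hx
      obtain ⟨D, hD, -, hxD⟩ := mem_kidU.1 hx
      exact hD.2.2.1.1 hxD
    have hQY : Q ∩ Y = E := by
      ext x
      rw [Finset.mem_inter]
      constructor
      · rintro ⟨hxQ, hxY⟩
        obtain ⟨D, hD, hp, hxD⟩ := mem_kidU.1 hxQ
        exact hp (Finset.mem_inter.2 ⟨hxD, hxY⟩)
      · intro hx
        have hx' := Finset.mem_inter.1 (hEs hx)
        obtain ⟨D, hD, hxD⟩ := kid x hx'.1
        refine ⟨mem_kidU.2 ⟨D, hD, ?_, hxD⟩, hx'.2⟩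
        rcases hEk D hD with h | h
        · exact h
        · exact absurd hx (Finset.disjoint_left.1 h (Finset.mem_inter.2 ⟨hxD, hx'.2⟩))
    have hothers : ∀ Z ∈ 𝒴, Z ≠ Y → (Z ∩ Q).Nonempty → Z ⊆ Q := by
      intro Z hZ hne ⟨x, hx⟩
      rw [Finset.mem_inter] at hx
      obtain ⟨D', hD', hp, hxD'⟩ := mem_kidU.1 hx.2
      have : Z ⊆ D' := by
        by_contra h
        exact he Y hY Z hZ hne.symm D' hD'.1
          ⟨h4 D' hD', ⟨x, Finset.mem_inter.2 ⟨hx.1, hxD'⟩⟩, h⟩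
      exact this.trans (fun x hx => mem_kidU.2 ⟨D', hD', hp, hx⟩)
    have hEne : E.Nonempty := (hg Y hY).1.ne E hE
    apply hmax
    · exact hEne.mono (hQY ▸ Finset.inter_subset_left)
    · exact hQC.trans (hU.sub C hC)
    · intro F hF; exact kidU_compat hU.lam hC _ hF
    · intro Z hZ hn
      by_cases h : Z = Y
      · rw [h, hQY]; exact hE
      · rw [Finset.inter_eq_right.2 (hothers Z hZ h (by rwa [Finset.inter_comm]))]
        exact (hg Z hZ).1.top
    · rintro Z hZ Z' hZ' hne ⟨h, h'⟩
      by_cases hh : Z = Y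
      · have : Z' ≠ Y := fun e => hne (hh.trans e.symm)
        exact h'.2 (hothers Z' hZ' this h'.1)
      · exact h.2 (hothers Z hZ hh h.1)
  have hor : ∀ E', IsChild U E' C → E' ∩ Y ⊆ E1 ∨ E' ∩ Y ⊆ E2 := fun E' hE' =>
    hsub _ (hkidY E' hE').1 (hkidY E' hE').2
  have hQ1 := gen E1 hE1 (fun E' hE' => (hor E' hE').imp id (fun h => hdis.symm.mono_left h))
    (hun ▸ Finset.subset_union_left)
  have hQ2 := gen E2 hE2 (fun E' hE' => ((hor E' hE').imp (fun h => hdis.mono_left h) id).symm)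
    (hun ▸ Finset.subset_union_right)
  apply hno
  refine ⟨_, hQ1, _, hQ2, ?_, ?_, ?_⟩
  · rw [Finset.disjoint_left]
    intro x hx hx'
    obtain ⟨D, hD, hp, hxD⟩ := mem_kidU.1 hx
    obtain ⟨D', hD', hp', hxD'⟩ := mem_kidU.1 hx'
    rcases child_disj hU.lam hD hD' with rfl | h
    · obtain ⟨y, hy⟩ := (h4 D hD).1
      rw [Finset.inter_comm] at hy
      exact Finset.disjoint_left.1 hdis (hp hy) (hp' hy)
    · exact Finset.disjoint_left.1 h hxD hxD'
  · ext x
    rw [Finset.mem_union]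
    constructor
    · intro hx
      obtain ⟨D, hD, hxD⟩ := kid x hx
      rcases hor D hD with h | h
      · exact Or.inl (mem_kidU.2 ⟨D, hD, h, hxD⟩)
      · exact Or.inr (mem_kidU.2 ⟨D, hD, h, hxD⟩)
    · rintro (hx | hx) <;>
      · obtain ⟨D, hD, -, hxD⟩ := mem_kidU.1 hx
        exact hD.2.2.1.1 hxD
  · intro F hF hFC
    obtain ⟨D, hD, hFD⟩ := child_ge hF hC hFC
    rcases hor D hD with h | h
    · exact Or.inl (fun x hx => mem_kidU.2 ⟨D, hD, h, hFD hx⟩)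
    · exact Or.inr (fun x hx => mem_kidU.2 ⟨D, hD, h, hFD hx⟩)

lemma exists_bin_ext {W : Finset β} {T : Clus β} (𝒴 : Finset (Finset β)) (g : Finset β → Clus β)
    (hT : Phy W T) (hg : ∀ Y ∈ 𝒴, Phy Y (g Y) ∧ Bn (g Y))
    (hr : ∀ Y ∈ 𝒴, restr T Y ⊆ g Y)
    (he : ∀ Y ∈ 𝒴, ∀ Z ∈ 𝒴, Y ≠ Z → ∀ D ∈ T, ¬ (Cr Y D ∧ Cr Z D)) :
    ∃ U, T ⊆ U ∧ Phy W U ∧ Bn U ∧ (∀ Y ∈ 𝒴, restr U Y ⊆ g Y) ∧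
      (∀ Y ∈ 𝒴, ∀ Z ∈ 𝒴, Y ≠ Z → ∀ D ∈ U, ¬ (Cr Y D ∧ Cr Z D)) := by
  obtain ⟨U, hU, hmax⟩ := Finset.exists_max_image
    (W.powerset.powerset.filter (fun U => T ⊆ U ∧ Phy W U ∧ (∀ Y ∈ 𝒴, restr U Y ⊆ g Y) ∧
      (∀ Y ∈ 𝒴, ∀ Z ∈ 𝒴, Y ≠ Z → ∀ D ∈ U, ¬ (Cr Y D ∧ Cr Z D)))) Finset.card
    ⟨T, Finset.mem_filter.2 ⟨Finset.mem_powerset.2 (fun C hC => Finset.mem_powerset.2 (hT.sub C hC)),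
      Finset.Subset.refl _, hT, hr, he⟩⟩
  obtain ⟨-, hTU, hUp, hUr, hUe⟩ := Finset.mem_filter.1 hU
  refine ⟨U, hTU, hUp, ?_, hUr, hUe⟩
  apply bn_of_closed 𝒴 g hUp hg hUr hUe
  intro Q hQn hQW hQc hQg hQe
  by_contra hQU
  have hP : Phy W (insert Q U) := by
    refine ⟨?_, ?_, ?_, Finset.mem_insert_of_mem hUp.top,
      fun x hx => Finset.mem_insert_of_mem (hUp.sing x hx)⟩
    · intro C hC
      rcases Finset.mem_insert.1 hC with rfl | h
      · exact hQn
      · exact hUp.ne C h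
    · intro C hC
      rcases Finset.mem_insert.1 hC with rfl | h
      · exact hQW
      · exact hUp.sub C h
    · intro C hC D hD
      rcases Finset.mem_insert.1 hC with rfl | h <;> rcases Finset.mem_insert.1 hD with rfl | h'
      · exact Or.inl (Finset.Subset.refl _)
      · exact hQc D h'
      · have := hQc C h
        rw [disjoint_comm] at this
        tauto
      · exact hUp.lam C h D h'
  have := hmax (insert Q U) (Finset.mem_filter.2
    ⟨Finset.mem_powerset.2 (fun C hC => Finset.mem_powerset.2 (hP.sub C hC)),
      hTU.trans (Finset.subset_insert _ _), hP, ?_, ?_⟩)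
  · rw [Finset.card_insert_of_notMem hQU] at this
    omega
  · intro Y hY E hE
    obtain ⟨hEn, D, hD, rfl⟩ := mem_restr.1 hE
    rcases Finset.mem_insert.1 hD with rfl | h
    · exact hQg Y hY hEn
    · exact hUr Y hY (mem_restr.2 ⟨hEn, D, h, rfl⟩)
  · intro Y hY Z hZ hne D hD
    rcases Finset.mem_insert.1 hD with rfl | h
    · exact hQe Y hY Z hZ hne
    · exact hUe Y hY Z hZ hne D h

/-- binary trees are maximal -/
lemma bin_max {Y : Finset β} {H G : Clus β} (hH : Phy Y H) (hb : Bn H) (hG : Phy Y G)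
    (h : H ⊆ G) : G = H := by
  apply Finset.Subset.antisymm _ h
  intro E hE
  obtain ⟨C, hC, hmin⟩ := Finset.exists_min_image (H.filter (fun D => E ⊆ D)) Finset.card
    ⟨Y, Finset.mem_filter.2 ⟨hH.top, hG.sub E hE⟩⟩
  obtain ⟨hCH, hEC⟩ := Finset.mem_filter.1 hC
  have hlt : ∀ K ∈ H, E ⊆ K → C.card ≤ K.card := fun K hK h =>
      hmin K (Finset.mem_filter.2 ⟨hK, h⟩)
  by_cases hbl : IsBlock H C
  · obtain ⟨x, hx, rfl⟩ := (hH.block C).1 hbl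
    rcases Finset.subset_singleton_iff.1 hEC with h' | h'
    · exact absurd h' (hG.ne E hE).ne_empty
    · rw [h']; exact hCH
  · obtain ⟨D, hD, D', hD', hdis, rfl, -⟩ := hb C hCH hbl
    rw [Finset.card_union_of_disjoint hdis] at hlt
    have hp := (hH.ne D hD).card_pos
    have hp' := (hH.ne D' hD').card_pos
    have n1 : ¬ E ⊆ D := fun h => by have := hlt D hD h; omega
    have n2 : ¬ E ⊆ D' := fun h => by have := hlt D' hD' h; omega
    have a1 : D ⊆ E := by
      rcases hG.lam E hE D (h hD) with h' | h' | h'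
      · exact absurd h' n1
      · exact h'
      · exact absurd (h'.left_le_of_le_sup_left hEC) n2
    have a2 : D' ⊆ E := by
      rcases hG.lam E hE D' (h hD') with h' | h' | h'
      · exact absurd h' n2
      · exact h'
      · exact absurd (h'.left_le_of_le_sup_right hEC) n1
    rw [Finset.Subset.antisymm hEC (Finset.union_subset a1 a2)]
    exact hCH


structure Inv (R : Clus β) (F : List (Clus β)) : Prop where
  trR : Tr R
  trF : ∀ G ∈ F, Tr G
  dis : F.Pairwise (fun G H => Disjoint (grd G) (grd H))
  cond : ∀ G ∈ F, (grd G ⊆ grd R ∧ ∀ B, IsBlock G B → IsBlock R B) ∨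
    (Disjoint (grd G) (grd R) ∧ G = {grd G})
  cov : ∀ x ∈ grd R, ∃ G ∈ F, x ∈ grd G

structure AFs (R : Clus β) (F : List (Clus β)) (𝒴 : Finset (Finset β)) : Prop where
  ne : ∀ Y ∈ 𝒴, Y.Nonempty
  dis : ∀ Y ∈ 𝒴, ∀ Z ∈ 𝒴, Y ≠ Z → Disjoint Y Z
  inF : ∀ Y ∈ 𝒴, ∃ G ∈ F, Y ⊆ grd G
  cov : ∀ G ∈ F, ∀ x ∈ grd G, ∃ Y ∈ 𝒴, x ∈ Y
  sat : ∀ G ∈ F, ∀ Y ∈ 𝒴, Sat G Y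
  agr : ∀ G ∈ F, ∀ Y ∈ 𝒴, Y ⊆ grd G → Y ⊆ grd R → restr R Y = restr G Y
  eR : ∀ Y ∈ 𝒴, ∀ Z ∈ 𝒴, Y ≠ Z → ∀ D ∈ R, ¬ (Cr Y D ∧ Cr Z D)
  eF : ∀ G ∈ F, ∀ Y ∈ 𝒴, ∀ Z ∈ 𝒴, Y ≠ Z → ∀ D ∈ G, ¬ (Cr Y D ∧ Cr Z D)

@[simp] lemma grd_single (A : Finset β) : grd ({A} : Clus β) = A := by simp [grd]

lemma Tr.gne {G : Clus β} (h : Tr G) : (grd G).Nonempty := h.ne _ h.top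

lemma pw_all {α : Type} {r : α → α → Prop} (hr : ∀ a b, r a b → r b a) {l : List α}
    (h : l.Pairwise r) {a b : α} (ha : a ∈ l) (hb : b ∈ l) (hne : a ≠ b) : r a b := by
  induction l with
  | nil => simp at ha
  | cons c l ih =>
    rw [List.pairwise_cons] at h
    rcases List.mem_cons.1 ha with rfl | ha'
    · rcases List.mem_cons.1 hb with rfl | hb'
      · exact absurd rfl hne
      · exact h.1 _ hb'
    · rcases List.mem_cons.1 hb with rfl | hb'
      · exact hr _ _ (h.1 _ ha')
      · exact ih h.2 ha' hb'

lemma pw_uniq {F : List (Clus β)} (h : F.Pairwise (fun G H => Disjoint (grd G) (grd H)))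
    {G H : Clus β} (hG : G ∈ F) (hH : H ∈ F) {x : β} (hx : x ∈ grd G) (hx' : x ∈ grd H) : G = H := by
  by_contra hne
  have := pw_all (r := fun G H : Clus β => Disjoint (grd G) (grd H))
    (fun _ _ h => h.symm) h hG hH hne
  exact Finset.disjoint_left.1 this hx hx'

lemma Inv.blk {R : Clus β} {F : List (Clus β)} (h : Inv R F) {G : Clus β} (hG : G ∈ F)
    {B : Finset β} (hB : IsBlock R B) {x : β} (hx : x ∈ B) (hxG : x ∈ grd G) : IsBlock G B := by
  obtain ⟨B', hB', hxB', -⟩ := exists_block (h.trF G hG) (h.trF G hG).top hxG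
  rcases h.cond G hG with ⟨-, h'⟩ | ⟨h', -⟩
  · have := block_eq h.trR hB (h' B' hB') (fun hd => Finset.disjoint_left.1 hd hx hxB')
    rw [this]; exact hB'
  · exact absurd (sub_grd hB.1 hx) (Finset.disjoint_left.1 h' hxG)

lemma Inv.blkEx {R : Clus β} {F : List (Clus β)} (h : Inv R F) {B : Finset β}
    (hB : IsBlock R B) : ∃ G ∈ F, IsBlock G B := by
  obtain ⟨x, hx⟩ := h.trR.ne B hB.1
  obtain ⟨G, hG, hxG⟩ := h.cov x (sub_grd hB.1 hx)
  exact ⟨G, hG, h.blk hG hB hx hxG⟩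

lemma Inv.left {R : Clus β} {F : List (Clus β)} (h : Inv R F) {G : Clus β} (hG : G ∈ F)
    {x : β} (hx : x ∈ grd G) (hxR : x ∈ grd R) :
    grd G ⊆ grd R ∧ ∀ B, IsBlock G B → IsBlock R B := by
  rcases h.cond G hG with h' | ⟨h', -⟩
  · exact h'
  · exact absurd hxR (Finset.disjoint_left.1 h' hx)

lemma AFs.satR {R : Clus β} {F : List (Clus β)} {𝒴 : Finset (Finset β)} (h : Inv R F)
    (hA : AFs R F 𝒴) {Y : Finset β} (hY : Y ∈ 𝒴) : Sat R Y := by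
  intro B hB
  obtain ⟨G, hG, hBG⟩ := h.blkEx hB
  exact hA.sat G hG Y hY B hBG

lemma AFs.eq {R : Clus β} {F : List (Clus β)} {𝒴 : Finset (Finset β)}
    (hA : AFs R F 𝒴) {Y Z : Finset β} (hY : Y ∈ 𝒴) (hZ : Z ∈ 𝒴) {x : β} (hx : x ∈ Y)
    (hx' : x ∈ Z) : Y = Z := by
  by_contra h
  exact Finset.disjoint_left.1 (hA.dis Y hY Z hZ h) hx hx'

lemma not_cr_block {G : Clus β} (hG : Tr G) {A D : Finset β} (hA : IsBlock G A) (hD : D ∈ G) :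
    ¬ Cr A D := by
  rintro ⟨⟨x, hx⟩, h⟩
  rcases block_or hG hA hD with h' | h'
  · exact h h'
  · exact Finset.disjoint_left.1 h' (Finset.mem_inter.1 hx).1 (Finset.mem_inter.1 hx).2

lemma restr_block_self {G : Clus β} (hG : Tr G) {A : Finset β} (hA : IsBlock G A) :
    restr G A = {A} := by
  ext E
  rw [mem_restr, Finset.mem_singleton]
  constructor
  · rintro ⟨⟨x, hx⟩, D, hD, rfl⟩
    rcases block_or hG hA hD with h | h
    · exact Finset.inter_eq_right.2 h
    · exact absurd (Finset.mem_inter.1 hx).1 (Finset.disjoint_left.1 h (Finset.mem_inter.1 hx).2)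
  · rintro rfl
    exact ⟨hG.ne _ hA.1, E, hA.1, Finset.inter_self _⟩

lemma sat_compl {G : Clus β} (hG : Tr G) {A : Finset β} (hA : IsBlock G A) :
    Sat G (grd G \ A) := by
  intro B hB
  by_cases h : B = A
  · right; rw [h]; exact Finset.disjoint_sdiff
  · left
    rw [Finset.subset_sdiff]
    refine ⟨sub_grd hB.1, ?_⟩
    by_contra hd
    exact h (block_eq hG hB hA hd)

lemma grd_block {G : Clus β} (hG : Tr G) {A : Finset β} (hA : IsBlock G A)
    (h : ¬ (grd G \ A).Nonempty) : G = {A} := by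
  rw [Finset.sdiff_nonempty, not_not] at h
  ext E
  rw [Finset.mem_singleton]
  constructor
  · intro hE
    exact hA.2 E hE ((sub_grd hE).trans h)
  · rintro rfl; exact hA.1

/-- a component sitting in an isolated leaf -/
lemma AFs.isol {R : Clus β} {F : List (Clus β)} {𝒴 : Finset (Finset β)} 
    (hd : F.Pairwise (fun G H => Disjoint (grd G) (grd H)))
    (hA : AFs R F 𝒴) {A : Finset β} (hAF : ({A} : Clus β) ∈ F) {Y : Finset β} (hY : Y ∈ 𝒴)
    {x : β} (hx : x ∈ Y) (hxA : x ∈ A) : Y = A := by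
  obtain ⟨G, hG, hYG⟩ := hA.inF Y hY
  have := pw_uniq hd hAF hG (x := x) (by simpa using hxA) (hYG hx)
  subst this
  rw [grd_single] at hYG
  rcases hA.sat _ hAF Y hY A (by simp [IsBlock]) with h | h
  · exact Finset.Subset.antisymm hYG h
  · exact absurd hx (Finset.disjoint_left.1 h hxA)

lemma isol_step {R : Clus β} {F : List (Clus β)} (h : Inv R F) {A : Finset β}
    (hA : IsBlock R A) (hAF : ({A} : Clus β) ∈ F) (hs : ¬ SingleLeaf R) :
    Inv (rmBlock R A) F ∧ (∀ 𝒴, AFs R F 𝒴 ↔ AFs (rmBlock R A) F 𝒴) ∧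
    (rmBlock R A).card < R.card ∧ grd (rmBlock R A) = grd R \ A := by
  have hn : (grd R \ A).Nonempty := by
    by_contra hn
    exact hs ⟨A, grd_block h.trR hA hn⟩
  have hsat := sat_compl h.trR hA
  have hg : grd (rmBlock R A) = grd R \ A :=
    (restr_grd h.trR.top Finset.sdiff_subset hn).1
  have hmemA : ∀ G ∈ F, ∀ x ∈ grd G, x ∈ A → G = {A} := fun G hG x hx hxA =>
    (pw_uniq h.dis hAF hG (x := x) (by simpa using hxA) hx).symm
  have hdA : ∀ G ∈ F, G = {A} ∨ Disjoint (grd G) A := by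
    intro G hG
    by_cases hd : Disjoint (grd G) A
    · exact Or.inr hd
    · left
      rw [Finset.not_disjoint_iff] at hd
      obtain ⟨x, hx, hxA⟩ := hd
      exact hmemA G hG x hx hxA
  refine ⟨⟨restr_Tr h.trR hsat Finset.sdiff_subset hn, h.trF, h.dis, ?_, ?_⟩, ?_, ?_, hg⟩
  · intro G hG
    rw [hg]
    rcases hdA G hG with rfl | hd
    · right
      rw [grd_single]
      exact ⟨Finset.disjoint_sdiff, rfl⟩
    · rcases h.cond G hG with ⟨h1, h2⟩ | ⟨h1, h2⟩
      · left
        refine ⟨Finset.subset_sdiff.2 ⟨h1, hd⟩, ?_⟩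
        intro B hB
        rw [rmBlock, restr_block h.trR hsat]
        exact ⟨h2 B hB, Finset.subset_sdiff.2
          ⟨(sub_grd hB.1).trans h1, hd.mono_left (sub_grd hB.1)⟩⟩
      · right
        exact ⟨h1.mono_right Finset.sdiff_subset, h2⟩
  · intro x hx
    rw [hg, Finset.mem_sdiff] at hx
    exact h.cov x hx.1
  · have htr : ∀ 𝒴 (R' : Clus β), AFs R' F 𝒴 → ∀ Y ∈ 𝒴, Y = A ∨ Disjoint Y A := by
      intro 𝒴 R' hAF' Y hY
      by_cases hd : Disjoint Y A
      · exact Or.inr hd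
      · left
        rw [Finset.not_disjoint_iff] at hd
        obtain ⟨x, hx, hxA⟩ := hd
        exact hAF'.isol h.dis hAF hY hx hxA
    intro 𝒴
    constructor
    · intro hf
      refine ⟨hf.ne, hf.dis, hf.inF, hf.cov, hf.sat, ?_, ?_, hf.eF⟩
      · intro G hG Y hY hYG hYR
        rw [hg] at hYR
        rw [rmBlock, restr_restr hYR]
        exact hf.agr G hG Y hY hYG (hYR.trans Finset.sdiff_subset)
      · intro Y hY Z hZ hne D hD hc
        obtain ⟨-, D', hD', rfl⟩ := mem_restr.1 hD
        have key : ∀ Y ∈ 𝒴, Cr Y (D' ∩ (grd R \ A)) → Cr Y D' := by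
          intro Y hY hc
          refine ⟨hc.1.mono (Finset.inter_subset_inter_left Finset.inter_subset_left), fun h' => ?_⟩
          rcases htr 𝒴 R hf Y hY with rfl | hd
          · obtain ⟨x, hx⟩ := hc.1
            simp at hx
            grind
          · exact hc.2 (Finset.subset_inter h' (Finset.subset_sdiff.2 ⟨h'.trans (sub_grd hD'), hd⟩))
        exact hf.eR Y hY Z hZ hne D' hD' ⟨key Y hY hc.1, key Z hZ hc.2⟩
    · intro hf
      refine ⟨hf.ne, hf.dis, hf.inF, hf.cov, hf.sat, ?_, ?_, hf.eF⟩
      · intro G hG Y hY hYG hYR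
        rcases htr 𝒴 _ hf Y hY with rfl | hd
        · obtain ⟨x, hx⟩ := hf.ne Y hY
          rw [hmemA G hG x (hYG hx) hx, restr_block_self h.trR hA]
          ext E
          simp only [mem_restr, Finset.mem_singleton]
          constructor
          · rintro rfl
            exact ⟨hf.ne _ hY, _, rfl, by simp⟩
          · rintro ⟨-, D, rfl, h⟩
            simpa using h.symm
        · have hY' : Y ⊆ grd R \ A := Finset.subset_sdiff.2 ⟨hYR, hd⟩
          rw [← hf.agr G hG Y hY hYG (by rw [hg]; exact hY'), rmBlock, restr_restr hY']
      · intro Y hY Z hZ hne D hD hc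
        have key : ∀ Y ∈ 𝒴, Cr Y D → Cr Y (D ∩ (grd R \ A)) := by
          intro Y hY hc
          rcases htr 𝒴 _ hf Y hY with rfl | hd
          · exact absurd hc (not_cr_block h.trR hA hD)
          · refine ⟨?_, fun h' => hc.2 (h'.trans Finset.inter_subset_left)⟩
            obtain ⟨x, hx⟩ := hc.1
            rw [Finset.mem_inter] at hx
            refine ⟨x, ?_⟩
            simp only [Finset.mem_inter, Finset.mem_sdiff]
            exact ⟨hx.1, hx.2, sub_grd hD hx.2, Finset.disjoint_left.1 hd hx.1⟩
        have k1 := key Y hY hc.1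
        refine hf.eR Y hY Z hZ hne _ (mem_restr.2 ⟨?_, D, hD, rfl⟩) ⟨k1, key Z hZ hc.2⟩
        exact k1.1.mono Finset.inter_subset_right
  · unfold rmBlock restr
    refine lt_of_lt_of_le (Finset.card_erase_lt_of_mem ?_) Finset.card_image_le
    rw [Finset.mem_image]
    refine ⟨A, hA.1, ?_⟩
    rw [← Finset.disjoint_iff_inter_eq_empty]
    exact Finset.disjoint_sdiff

structure Split (G : Clus β) (new : List (Clus β)) : Prop where
  each : ∀ H ∈ new, (grd H).Nonempty ∧ grd H ⊆ grd G ∧ H = restr G (grd H) ∧ Sat G (grd H)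
  dis : new.Pairwise (fun G H => Disjoint (grd G) (grd H))
  cov : ∀ x ∈ grd G, ∃ H ∈ new, x ∈ grd H
  edge : ∀ H ∈ new, ∀ H' ∈ new, H ≠ H' → ∀ D ∈ G, ¬ (Cr (grd H) D ∧ Cr (grd H') D)

lemma pw_replace {l1 l2 new : List (Clus β)} {G : Clus β}
    (h : (l1 ++ G :: l2).Pairwise (fun G H => Disjoint (grd G) (grd H)))
    (hn : new.Pairwise (fun G H => Disjoint (grd G) (grd H)))
    (hs : ∀ H ∈ new, grd H ⊆ grd G) :
    (l1 ++ new ++ l2).Pairwise (fun G H => Disjoint (grd G) (grd H)) := by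
  rw [List.pairwise_append, List.pairwise_cons] at h
  rw [List.append_assoc, List.pairwise_append, List.pairwise_append]
  obtain ⟨a, ⟨b, c⟩, d⟩ := h
  refine ⟨a, ⟨hn, c, fun H hH K hK => (b K hK).mono_left (hs H hH)⟩, ?_⟩
  intro H hH K hK
  rcases List.mem_append.1 hK with h | h
  · exact (d H hH G (by simp)).mono_right (hs K h)
  · exact d H hH K (by simp [h])

lemma split_step {R : Clus β} {l1 l2 new : List (Clus β)} {G : Clus β}
    (h : Inv R (l1 ++ G :: l2)) (hGR : grd G ⊆ grd R) (hS : Split G new) :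
    Inv R (l1 ++ new ++ l2) ∧
    (∀ 𝒴, AFs R (l1 ++ new ++ l2) 𝒴 → AFs R (l1 ++ G :: l2) 𝒴) ∧
    (∀ 𝒴, AFs R (l1 ++ G :: l2) 𝒴 → (∀ Y ∈ 𝒴, Y ⊆ grd G → ∃ H ∈ new, Y ⊆ grd H) →
      AFs R (l1 ++ new ++ l2) 𝒴) := by
  obtain ⟨O, hO, hO'⟩ : ∃ O : List (Clus β), (∀ H, H ∈ l1 ++ G :: l2 ↔ H = G ∨ H ∈ O) ∧
      (∀ H, H ∈ l1 ++ new ++ l2 ↔ H ∈ new ∨ H ∈ O) := by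
    refine ⟨l1 ++ l2, fun H => ?_, fun H => ?_⟩ <;> simp <;> tauto
  have hdis' := pw_replace h.dis hS.dis (fun H hH => (hS.each H hH).2.1)
  have hdis := h.dis
  have hcov := h.cov
  have hcond := h.cond
  have htrF := h.trF
  have hblk := @Inv.left _ _ _ _ h
  have hIcond := h.cond
  obtain ⟨trR, -, -, -, -⟩ := h
  generalize l1 ++ G :: l2 = F at *
  generalize l1 ++ new ++ l2 = F' at *
  have hG : G ∈ F := (hO G).2 (Or.inl rfl)
  have trG := htrF G hG
  have hblkG : ∀ B, IsBlock G B → IsBlock R B := by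
    obtain ⟨x, hx⟩ := trG.gne
    exact (hblk hG hx (hGR hx)).2
  refine ⟨⟨trR, ?_, hdis', ?_, ?_⟩, ?_, ?_⟩
  · intro H hH
    rcases (hO' H).1 hH with h | h
    · obtain ⟨h1, h2, h3, h4⟩ := hS.each H h
      rw [h3]
      exact restr_Tr trG h4 h2 h1
    · exact htrF H ((hO H).2 (Or.inr h))
  · intro H hH
    rcases (hO' H).1 hH with h | h
    · left
      obtain ⟨h1, h2, h3, h4⟩ := hS.each H h
      refine ⟨h2.trans hGR, fun B hB => ?_⟩
      rw [h3, restr_block trG h4] at hB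
      exact hblkG B hB.1
    · exact hcond H ((hO H).2 (Or.inr h))
  · intro x hx
    obtain ⟨H, hH, hxH⟩ := hcov x hx
    rcases (hO H).1 hH with rfl | h
    · obtain ⟨H', hH', hx'⟩ := hS.cov x hxH
      exact ⟨H', (hO' H').2 (Or.inl hH'), hx'⟩
    · exact ⟨H, (hO' H).2 (Or.inr h), hxH⟩
  · intro 𝒴 hf
    have hin : ∀ Y ∈ 𝒴, ∀ x ∈ Y, x ∈ grd G → ∃ H ∈ new, Y ⊆ grd H := by
      intro Y hY x hx hxG
      obtain ⟨H', hH', hx'⟩ := hS.cov x hxG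
      obtain ⟨K, hK, hYK⟩ := hf.inF Y hY
      have := pw_uniq hdis' ((hO' H').2 (Or.inl hH')) hK hx' (hYK hx)
      subst this
      exact ⟨H', hH', hYK⟩
    refine ⟨hf.ne, hf.dis, ?_, ?_, ?_, ?_, hf.eR, ?_⟩
    · intro Y hY
      obtain ⟨K, hK, hYK⟩ := hf.inF Y hY
      rcases (hO' K).1 hK with h | h
      · exact ⟨G, hG, hYK.trans (hS.each K h).2.1⟩
      · exact ⟨K, (hO K).2 (Or.inr h), hYK⟩
    · intro H hH x hx
      rcases (hO H).1 hH with rfl | h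
      · obtain ⟨H', hH', hx'⟩ := hS.cov x hx
        exact hf.cov H' ((hO' H').2 (Or.inl hH')) x hx'
      · exact hf.cov H ((hO' H).2 (Or.inr h)) x hx
    · intro H hH Y hY B hB
      rcases (hO H).1 hH with rfl | h
      · obtain ⟨x, hx⟩ := trG.ne B hB.1
        obtain ⟨H', hH', hx'⟩ := hS.cov x (sub_grd hB.1 hx)
        obtain ⟨h1, h2, h3, h4⟩ := hS.each H' hH'
        refine hf.sat H' ((hO' H').2 (Or.inl hH')) Y hY B ?_
        rw [h3, restr_block trG h4]
        refine ⟨hB, ?_⟩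
        rcases h4 B hB with h | h
        · exact h
        · exact absurd hx' (Finset.disjoint_left.1 h hx)
      · exact hf.sat H ((hO' H).2 (Or.inr h)) Y hY B hB
    · intro H hH Y hY hYH hYR
      rcases (hO H).1 hH with rfl | h
      · obtain ⟨x, hx⟩ := hf.ne Y hY
        obtain ⟨H', hH', hYH'⟩ := hin Y hY x hx (hYH hx)
        rw [hf.agr H' ((hO' H').2 (Or.inl hH')) Y hY hYH' hYR]
        obtain ⟨h1, h2, h3, h4⟩ := hS.each H' hH'
        rw [h3, restr_restr hYH']
      · exact hf.agr H ((hO' H).2 (Or.inr h)) Y hY hYH hYR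
    · intro H hH Y hY Z hZ hne D hD hc
      rcases (hO H).1 hH with rfl | h
      · obtain ⟨x, hx⟩ := hc.1.1
        obtain ⟨z, hz⟩ := hc.2.1
        rw [Finset.mem_inter] at hx hz
        obtain ⟨H1, hH1, hYH1⟩ := hin Y hY x hx.1 (sub_grd hD hx.2)
        obtain ⟨H2, hH2, hZH2⟩ := hin Z hZ z hz.1 (sub_grd hD hz.2)
        by_cases heq : H1 = H2
        · subst heq
          obtain ⟨h1, h2, h3, h4⟩ := hS.each H1 hH1
          refine hf.eF H1 ((hO' H1).2 (Or.inl hH1)) Y hY Z hZ hne (D ∩ grd H1) ?_ ⟨⟨?_, ?_⟩, ⟨?_, ?_⟩⟩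
          · rw [h3, mem_restr, ← h3]
            exact ⟨⟨x, Finset.mem_inter.2 ⟨hx.2, hYH1 hx.1⟩⟩, D, hD, rfl⟩
          · exact ⟨x, by simp [hx.1, hx.2, hYH1 hx.1]⟩
          · exact fun h => hc.1.2 (h.trans Finset.inter_subset_left)
          · exact ⟨z, by simp [hz.1, hz.2, hZH2 hz.1]⟩
          · exact fun h => hc.2.2 (h.trans Finset.inter_subset_left)
        · exact hS.edge H1 hH1 H2 hH2 heq D hD
            ⟨⟨hc.1.1.mono (Finset.inter_subset_inter_right hYH1), fun h => hc.1.2 (hYH1.trans h)⟩,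
             ⟨hc.2.1.mono (Finset.inter_subset_inter_right hZH2), fun h => hc.2.2 (hZH2.trans h)⟩⟩
      · exact hf.eF H ((hO' H).2 (Or.inr h)) Y hY Z hZ hne D hD hc
  · intro 𝒴 hf hin
    have hin' : ∀ H ∈ new, ∀ Y ∈ 𝒴, ∀ x ∈ Y, x ∈ grd H → Y ⊆ grd H := by
      intro H hH Y hY x hx hxH
      obtain ⟨K, hK, hYK⟩ := hf.inF Y hY
      have := pw_uniq hdis hG hK ((hS.each H hH).2.1 hxH) (hYK hx)
      subst this
      obtain ⟨H', hH', hYH'⟩ := hin Y hY hYK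
      have := pw_uniq hdis' ((hO' H').2 (Or.inl hH')) ((hO' H).2 (Or.inl hH)) (hYH' hx) hxH
      subst this
      exact hYH'
    refine ⟨hf.ne, hf.dis, ?_, ?_, ?_, ?_, hf.eR, ?_⟩
    · intro Y hY
      obtain ⟨K, hK, hYK⟩ := hf.inF Y hY
      rcases (hO K).1 hK with rfl | h
      · obtain ⟨H, hH, h'⟩ := hin Y hY hYK
        exact ⟨H, (hO' H).2 (Or.inl hH), h'⟩
      · exact ⟨K, (hO' K).2 (Or.inr h), hYK⟩
    · intro H hH x hx
      rcases (hO' H).1 hH with h | h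
      · exact hf.cov G hG x ((hS.each H h).2.1 hx)
      · exact hf.cov H ((hO H).2 (Or.inr h)) x hx
    · intro H hH Y hY B hB
      rcases (hO' H).1 hH with h | h
      · obtain ⟨h1, h2, h3, h4⟩ := hS.each H h
        rw [h3, restr_block trG h4] at hB
        exact hf.sat G hG Y hY B hB.1
      · exact hf.sat H ((hO H).2 (Or.inr h)) Y hY B hB
    · intro H hH Y hY hYH hYR
      rcases (hO' H).1 hH with h | h
      · obtain ⟨h1, h2, h3, h4⟩ := hS.each H h
        rw [h3, restr_restr hYH]
        exact hf.agr G hG Y hY (hYH.trans h2) hYR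
      · exact hf.agr H ((hO H).2 (Or.inr h)) Y hY hYH hYR
    · intro H hH Y hY Z hZ hne D hD hc
      rcases (hO' H).1 hH with h | h
      · obtain ⟨h1, h2, h3, h4⟩ := hS.each H h
        have hDH : D ⊆ grd H := sub_grd hD
        rw [h3, mem_restr] at hD
        obtain ⟨-, D', hD', hDe⟩ := hD
        have hDD : D ⊆ D' := hDe ▸ Finset.inter_subset_left
        have key : ∀ Y ∈ 𝒴, Cr Y D → Cr Y D' := by
          intro Y hY hc
          obtain ⟨x, hx⟩ := hc.1
          rw [Finset.mem_inter] at hx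
          refine ⟨⟨x, Finset.mem_inter.2 ⟨hx.1, hDD hx.2⟩⟩, fun h' => hc.2 ?_⟩
          rw [← hDe]
          exact Finset.subset_inter h' (hin' H h Y hY x hx.1 (hDH hx.2))
        exact hf.eF G hG Y hY Z hZ hne D' hD' ⟨key Y hY hc.1, key Z hZ hc.2⟩
      · exact hf.eF H ((hO H).2 (Or.inr h)) Y hY Z hZ hne D hD hc


/-- binary cherry -/
structure Ch (G : Clus β) (A C : Finset β) : Prop where
  tr : Tr G
  a : IsBlock G A
  c : IsBlock G C
  ne : A ≠ C
  u : A ∪ C ∈ G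

lemma Ch.symm {G : Clus β} {A C : Finset β} (h : Ch G A C) : Ch G C A :=
  ⟨h.tr, h.c, h.a, h.ne.symm, by rw [Finset.union_comm]; exact h.u⟩

lemma Ch.dis {G : Clus β} {A C : Finset β} (h : Ch G A C) : Disjoint A C := by
  by_contra hd
  exact h.ne (block_eq h.tr h.a h.c hd)

lemma child_pair {G : Clus β} (hG : Tr G) {A C P : Finset β} (hne : A ≠ C) (hA : IsChild G A P)
    (hC : IsChild G C P) : P = A ∪ C := by
  obtain ⟨a1, a2, a3, a4⟩ := hA
  obtain ⟨c1, -, c3, c4⟩ := hC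
  have hb : ¬ IsBlock G P := fun h => a3.ne (h.2 A a1 a3.1)
  obtain ⟨D, hD, E, hE, hdis, rfl, hsub⟩ := hG.bn P a2 hb
  have hDn := hG.ne D hD
  have hEn := hG.ne E hE
  have hDs : D ⊂ D ∪ E := by
    refine ⟨Finset.subset_union_left, fun h => ?_⟩
    obtain ⟨x, hx⟩ := hEn
    exact Finset.disjoint_left.1 hdis (h (Finset.mem_union_right _ hx)) hx
  have hEs : E ⊂ D ∪ E := by
    refine ⟨Finset.subset_union_right, fun h => ?_⟩
    obtain ⟨x, hx⟩ := hDn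
    exact Finset.disjoint_left.1 hdis hx (h (Finset.mem_union_left _ hx))
  rcases hsub A a1 a3 with h | h <;> rcases hsub C c1 c3 with h' | h'
  · exact absurd ((a4 D hD h hDs).symm.trans (c4 D hD h' hDs)) hne
  · rw [a4 D hD h hDs, c4 E hE h' hEs]
  · rw [a4 E hE h hEs, c4 D hD h' hDs, Finset.union_comm]
  · exact absurd ((a4 E hE h hEs).symm.trans (c4 E hE h' hEs)) hne

lemma Ch.cases {G : Clus β} {A C : Finset β} (h : Ch G A C) {D : Finset β} (hD : D ∈ G) :
    D = A ∨ D = C ∨ A ∪ C ⊆ D ∨ Disjoint (A ∪ C) D := by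
  rcases block_or h.tr h.a hD with ha | ha <;> rcases block_or h.tr h.c hD with hc | hc
  · exact Or.inr (Or.inr (Or.inl (Finset.union_subset ha hc)))
  · left
    rcases h.tr.lam D hD _ h.u with h' | h' | h'
    · apply Finset.Subset.antisymm _ ha
      intro x hx
      rcases Finset.mem_union.1 (h' hx) with h'' | h''
      · exact h''
      · exact absurd hx (Finset.disjoint_left.1 hc h'')
    · obtain ⟨x, hx⟩ := h.tr.ne _ h.c.1
      exact absurd (h' (Finset.mem_union_right _ hx)) (Finset.disjoint_left.1 hc hx)
    · obtain ⟨x, hx⟩ := h.tr.ne _ h.a.1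
      exact absurd (Finset.mem_union_left _ hx) (Finset.disjoint_left.1 h' (ha hx))
  · right; left
    rcases h.tr.lam D hD _ h.u with h' | h' | h'
    · apply Finset.Subset.antisymm _ hc
      intro x hx
      rcases Finset.mem_union.1 (h' hx) with h'' | h''
      · exact absurd hx (Finset.disjoint_left.1 ha h'')
      · exact h''
    · obtain ⟨x, hx⟩ := h.tr.ne _ h.a.1
      exact absurd (h' (Finset.mem_union_left _ hx)) (Finset.disjoint_left.1 ha hx)
    · obtain ⟨x, hx⟩ := h.tr.ne _ h.c.1
      exact absurd (Finset.mem_union_right _ hx) (Finset.disjoint_left.1 h' (hc hx))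
  · exact Or.inr (Or.inr (Or.inr (Finset.disjoint_union_left.2 ⟨ha, hc⟩)))

lemma Ch.child {G : Clus β} {A C : Finset β} (h : Ch G A C) : IsChild G A (A ∪ C) := by
  obtain ⟨x, hx⟩ := h.tr.ne _ h.a.1
  obtain ⟨y, hy⟩ := h.tr.ne _ h.c.1
  have hd := h.dis
  refine ⟨h.a.1, h.u, ⟨Finset.subset_union_left, fun h' => ?_⟩, ?_⟩
  · exact Finset.disjoint_left.1 hd (h' (Finset.mem_union_right _ hy)) hy
  · intro E hE hAE hs
    rcases h.cases hE with h' | h' | h' | h'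
    · exact h'
    · subst h'
      exact absurd (hAE hx) (Finset.disjoint_left.1 hd hx)
    · exact absurd h' hs.2
    · exact absurd (hAE hx) (Finset.disjoint_left.1 h' (Finset.mem_union_left _ hx))

lemma Ch.ne1 {G : Clus β} {A C : Finset β} (h : Ch G A C) : A ∪ C ≠ A := h.child.2.2.1.ne.symm
lemma Ch.ne2 {G : Clus β} {A C : Finset β} (h : Ch G A C) : A ∪ C ≠ C := by
  have := h.symm.ne1
  rwa [Finset.union_comm] at this

lemma mem_con {G : Clus β} {A C : Finset β} (h : Ch G A C) {D : Finset β} :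
    D ∈ conCh G A C ↔ D ∈ G ∧ D ≠ A ∧ D ≠ C := by
  have h1 := h.ne1
  have h2 := h.ne2
  have h3 := h.u
  simp only [conCh, Finset.mem_insert, Finset.mem_erase]
  constructor
  · rintro (rfl | ⟨a, b, c⟩)
    · exact ⟨h3, h1, h2⟩
    · exact ⟨c, b, a⟩
  · rintro ⟨a, b, c⟩
    exact Or.inr ⟨c, b, a⟩

lemma con_grd {G : Clus β} {A C : Finset β} (h : Ch G A C) :
    grd (conCh G A C) = grd G ∧ grd G ∈ conCh G A C := by
  have : grd G ∈ conCh G A C := by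
    rw [mem_con h]
    have h1 := h.child.2.2.1
    have h2 := h.symm.child.2.2.1
    refine ⟨h.tr.top, fun he => ?_, fun he => ?_⟩
    · have := sub_grd h.u
      rw [he] at this
      exact h1.2 this
    · have := sub_grd h.symm.u
      rw [he] at this
      exact h2.2 this
  exact ⟨grd_eq this (fun D hD => sub_grd ((mem_con h).1 hD).1), this⟩

lemma con_block {G : Clus β} {A C : Finset β} (h : Ch G A C) (B : Finset β) :
    IsBlock (conCh G A C) B ↔ B = A ∪ C ∨ (IsBlock G B ∧ B ≠ A ∧ B ≠ C) := by
  constructor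
  · rintro ⟨h1, h2⟩
    rw [mem_con h] at h1
    by_cases hb : IsBlock G B
    · exact Or.inr ⟨hb, h1.2⟩
    · left
      obtain ⟨D, hD, E, hE, hdis, rfl, -⟩ := h.tr.bn B h1.1 hb
      have hDn := h.tr.ne D hD
      have hEn := h.tr.ne E hE
      have hD' : D = A ∨ D = C := by
        by_contra hh
        push Not at hh
        have := h2 D ((mem_con h).2 ⟨hD, hh⟩) Finset.subset_union_left
        obtain ⟨x, hx⟩ := hEn
        exact Finset.disjoint_left.1 hdis (this ▸ Finset.mem_union_right _ hx) hx
      have hE' : E = A ∨ E = C := by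
        by_contra hh
        push Not at hh
        have := h2 E ((mem_con h).2 ⟨hE, hh⟩) Finset.subset_union_right
        obtain ⟨x, hx⟩ := hDn
        exact Finset.disjoint_left.1 hdis hx (this ▸ Finset.mem_union_left _ hx)
      have hne : D ≠ E := by
        rintro rfl
        obtain ⟨x, hx⟩ := hDn
        exact Finset.disjoint_left.1 hdis hx hx
      rcases hD' with rfl | rfl <;> rcases hE' with rfl | rfl
      · exact absurd rfl hne
      · rfl
      · exact Finset.union_comm _ _
      · exact absurd rfl hne
  · rintro (rfl | ⟨h1, h2⟩)
    · refine ⟨(mem_con h).2 ⟨h.u, h.ne1, h.ne2⟩, ?_⟩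
      intro K hK hs
      rw [mem_con h] at hK
      rcases h.cases hK.1 with h' | h' | h' | h'
      · exact absurd h' hK.2.1
      · exact absurd h' hK.2.2
      · exact Finset.Subset.antisymm hs h'
      · obtain ⟨x, hx⟩ := h.tr.ne K hK.1
        exact absurd hx (Finset.disjoint_left.1 h' (hs hx))
    · exact ⟨(mem_con h).2 ⟨h1.1, h2⟩, fun K hK hs => h1.2 K ((mem_con h).1 hK).1 hs⟩

lemma con_Tr {G : Clus β} {A C : Finset β} (h : Ch G A C) : Tr (conCh G A C) where
  ne := fun D hD => h.tr.ne D ((mem_con h).1 hD).1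
  lam := fun D hD E hE => h.tr.lam D ((mem_con h).1 hD).1 E ((mem_con h).1 hE).1
  top := by rw [(con_grd h).1]; exact (con_grd h).2
  bn := by
    intro K hK hb
    rw [con_block h] at hb
    push Not at hb
    rw [mem_con h] at hK
    have hKb : ¬ IsBlock G K := by
      intro hh
      have := hb.2 hh
      tauto
    obtain ⟨D, hD, E, hE, hdis, rfl, hsub⟩ := h.tr.bn K hK.1 hKb
    have hmem : ∀ D E : Finset β, D ∈ G → E ∈ G → Disjoint D E → D ∪ E ∈ G → D ∪ E ≠ A ∪ C →
        (∀ F ∈ G, F ⊂ D ∪ E → F ⊆ D ∨ F ⊆ E) → ∀ A C, Ch G A C → D ∪ E ≠ A ∪ C → D ≠ A := by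
      intro D E hD hE hdis hu _ hsub A C h hne hDA
      subst hDA
      obtain ⟨x, hx⟩ := h.tr.ne D hD
      obtain ⟨y, hy⟩ := h.tr.ne C h.c.1
      have hss : D ∪ C ⊂ D ∪ E := by
        rcases h.cases hu with h' | h' | h' | h'
        · obtain ⟨z, hz⟩ := h.tr.ne E hE
          have hz' : z ∈ D := by rw [← h']; exact Finset.mem_union_right _ hz
          exact absurd hz (Finset.disjoint_left.1 hdis hz')
        · have : x ∈ C := h' ▸ Finset.mem_union_left _ hx
          exact absurd this (Finset.disjoint_left.1 h.dis hx)
        · exact lt_of_le_of_ne h' hne.symm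
        · exact absurd (Finset.mem_union_left _ hx)
            (Finset.disjoint_left.1 h' (Finset.mem_union_left _ hx))
      rcases hsub _ h.u hss with h' | h'
      · exact h.child.2.2.1.2 h'
      · exact Finset.disjoint_left.1 hdis hx (h' (Finset.mem_union_left _ hx))
    have hsub' : ∀ F ∈ G, F ⊂ E ∪ D → F ⊆ E ∨ F ⊆ D := by
      intro F hF hs
      rw [Finset.union_comm] at hs
      exact (hsub F hF hs).symm
    have huc : D ∪ E ≠ C ∪ A := by rw [Finset.union_comm C A]; exact hb.1
    have huc1 : E ∪ D ≠ A ∪ C := by rw [Finset.union_comm E D]; exact hb.1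
    have huc2 : E ∪ D ≠ C ∪ A := by rw [Finset.union_comm E D]; exact huc
    have hu2 : E ∪ D ∈ G := by rw [Finset.union_comm E D]; exact hK.1
    refine ⟨D, (mem_con h).2 ⟨hD, ?_, ?_⟩, E, (mem_con h).2 ⟨hE, ?_, ?_⟩, hdis, rfl,
      fun F hF => hsub F ((mem_con h).1 hF).1⟩
    · exact hmem D E hD hE hdis hK.1 hb.1 hsub A C h hb.1
    · exact hmem D E hD hE hdis hK.1 hb.1 hsub C A h.symm huc
    · exact hmem E D hE hD hdis.symm hu2 huc1 hsub' A C h huc1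
    · exact hmem E D hE hD hdis.symm hu2 huc1 hsub' C A h.symm huc2

lemma con_restr_dis {G : Clus β} {A C Y : Finset β} (h : Ch G A C) (hd : Disjoint (A ∪ C) Y) :
    restr (conCh G A C) Y = restr G Y := by
  rw [Finset.disjoint_union_left] at hd
  ext E
  simp only [mem_restr, mem_con h]
  constructor
  · rintro ⟨a, D, hD, e⟩
    exact ⟨a, D, hD.1, e⟩
  · rintro ⟨⟨x, hx⟩, D, hD, rfl⟩
    refine ⟨⟨x, hx⟩, D, ⟨hD, ?_, ?_⟩, rfl⟩
    · rintro rfl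
      exact Finset.disjoint_left.1 hd.1 (Finset.mem_inter.1 hx).1 (Finset.mem_inter.1 hx).2
    · rintro rfl
      exact Finset.disjoint_left.1 hd.2 (Finset.mem_inter.1 hx).1 (Finset.mem_inter.1 hx).2

lemma con_restr_sub {G : Clus β} {A C Y : Finset β} (h : Ch G A C) (hd : A ∪ C ⊆ Y) :
    restr G Y = insert A (insert C (restr (conCh G A C) Y)) ∧
    restr (conCh G A C) Y = ((restr G Y).erase A).erase C := by
  have hAn := h.tr.ne A h.a.1
  have hCn := h.tr.ne C h.c.1
  have hAY : A ∩ Y = A := Finset.inter_eq_left.2 (Finset.union_subset_left hd)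
  have hCY : C ∩ Y = C := Finset.inter_eq_left.2 (Finset.union_subset_right hd)
  have key : ∀ A C : Finset β, Ch G A C → A ∪ C ⊆ Y → ∀ D ∈ G, D ∩ Y = A → D = A := by
    intro A C h hd D hD he
    obtain ⟨x, hx⟩ := h.tr.ne A h.a.1
    obtain ⟨y, hy⟩ := h.tr.ne C h.c.1
    have hxD : x ∈ D := (Finset.mem_inter.1 (he ▸ hx : x ∈ D ∩ Y)).1
    rcases h.cases hD with h' | h' | h' | h'
    · exact h'
    · subst h'
      exact absurd hxD (Finset.disjoint_left.1 h.dis hx)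
    · have : y ∈ D ∩ Y := Finset.mem_inter.2 ⟨h' (Finset.mem_union_right _ hy),
        hd (Finset.mem_union_right _ hy)⟩
      rw [he] at this
      exact absurd hy (Finset.disjoint_left.1 h.dis this)
    · exact absurd hxD (Finset.disjoint_left.1 h' (Finset.mem_union_left _ hx))
  have kA := key A C h hd
  have kC := key C A h.symm (by rw [Finset.union_comm]; exact hd)
  constructor
  · ext E
    simp only [Finset.mem_insert, mem_restr, mem_con h]
    constructor
    · rintro ⟨a, D, hD, rfl⟩
      by_cases hDA : D = A
      · left; rw [hDA, hAY]
      by_cases hDC : D = C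
      · right; left; rw [hDC, hCY]
      exact Or.inr (Or.inr ⟨a, D, ⟨hD, hDA, hDC⟩, rfl⟩)
    · rintro (rfl | rfl | ⟨a, D, hD, e⟩)
      · exact ⟨hAn, E, h.a.1, hAY⟩
      · exact ⟨hCn, E, h.c.1, hCY⟩
      · exact ⟨a, D, hD.1, e⟩
  · ext E
    simp only [Finset.mem_erase, mem_restr, mem_con h]
    constructor
    · rintro ⟨a, D, ⟨hD, h1, h2⟩, rfl⟩
      exact ⟨fun he => h2 (kC D hD he), fun he => h1 (kA D hD he), a, D, hD, rfl⟩
    · rintro ⟨h1, h2, a, D, hD, rfl⟩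
      refine ⟨a, D, ⟨hD, ?_, ?_⟩, rfl⟩
      · rintro rfl; exact h2 hAY
      · rintro rfl; exact h1 hCY

lemma con_restr_eq {R G : Clus β} {A C Y : Finset β} (hR : Ch R A C) (hG : Ch G A C)
    (hd : A ∪ C ⊆ Y ∨ Disjoint (A ∪ C) Y) :
    restr R Y = restr G Y ↔ restr (conCh R A C) Y = restr (conCh G A C) Y := by
  rcases hd with h | h
  · obtain ⟨a1, a2⟩ := con_restr_sub hR h
    obtain ⟨b1, b2⟩ := con_restr_sub hG h
    constructor
    · intro he
      rw [a2, b2, he]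
    · intro he
      rw [a1, b1, he]
  · rw [con_restr_dis hR h, con_restr_dis hG h]

lemma con_card {R : Clus β} {A C : Finset β} (h : Ch R A C) : (conCh R A C).card < R.card := by
  apply Finset.card_lt_card
  refine ⟨fun D hD => ((mem_con h).1 hD).1, fun hs => ?_⟩
  exact ((mem_con h).1 (hs h.a.1)).2.1 rfl

lemma con_step {R : Clus β} {l1 l2 : List (Clus β)} {G : Clus β} {A C : Finset β}
    (h : Inv R (l1 ++ G :: l2)) (hR : Ch R A C) (hG : Ch G A C) :
    Inv (conCh R A C) (l1 ++ [conCh G A C] ++ l2) ∧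
    (∀ 𝒴, AFs (conCh R A C) (l1 ++ [conCh G A C] ++ l2) 𝒴 → AFs R (l1 ++ G :: l2) 𝒴) ∧
    (∀ 𝒴, AFs R (l1 ++ G :: l2) 𝒴 → (∃ Y ∈ 𝒴, A ∪ C ⊆ Y) →
      AFs (conCh R A C) (l1 ++ [conCh G A C] ++ l2) 𝒴) := by
  obtain ⟨O, hO, hO', hOd⟩ : ∃ O : List (Clus β), (∀ H, H ∈ l1 ++ G :: l2 ↔ H = G ∨ H ∈ O) ∧
      (∀ H, H ∈ l1 ++ [conCh G A C] ++ l2 ↔ H = conCh G A C ∨ H ∈ O) ∧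
      (∀ H ∈ O, Disjoint (grd H) (grd G)) := by
    refine ⟨l1 ++ l2, fun H => ?_, fun H => ?_, ?_⟩
    · simp; tauto
    · simp; tauto
    · have := h.dis
      rw [List.pairwise_append, List.pairwise_cons] at this
      intro H hH
      rcases List.mem_append.1 hH with h' | h'
      · exact this.2.2 H h' G (by simp)
      · exact (this.2.1.1 H h').symm
  have hgG := (con_grd hG).1
  have hgR := (con_grd hR).1
  have hdis' := pw_replace (new := [conCh G A C]) h.dis (by simp) (by simp [hgG])
  obtain ⟨trR, trF, hdis, hcond, hcov⟩ := h
  generalize l1 ++ G :: l2 = F at *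
  generalize l1 ++ [conCh G A C] ++ l2 = F' at *
  have hGF : G ∈ F := (hO G).2 (Or.inl rfl)
  have hGF' : conCh G A C ∈ F' := (hO' _).2 (Or.inl rfl)
  obtain ⟨x0, hx0⟩ := trR.ne A hR.a.1
  have hx0G := sub_grd hG.a.1 hx0
  have hAG := sub_grd hG.a.1
  have hCG := sub_grd hG.c.1
  have hUG := sub_grd hG.u
  have hGl : grd G ⊆ grd R ∧ ∀ B, IsBlock G B → IsBlock R B := by
    rcases hcond G hGF with h' | h'
    · exact h'
    · exact absurd (sub_grd hR.a.1 hx0) (Finset.disjoint_left.1 h'.1 hx0G)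
  have key : ∀ 𝒴 : Finset (Finset β), (∀ Y ∈ 𝒴, A ∪ C ⊆ Y ∨ Disjoint (A ∪ C) Y) →
      (AFs R F 𝒴 ↔ AFs (conCh R A C) F' 𝒴) := by
    intro 𝒴 hd
    have hcr : ∀ (𝒴' : Finset (Finset β)) (K : Clus β), Ch K A C →
        (∀ Y ∈ 𝒴, ∀ Z ∈ 𝒴, Y ≠ Z → Disjoint Y Z) →
        ∀ Y ∈ 𝒴, ∀ Z ∈ 𝒴, Y ≠ Z → ∀ D ∈ K, (Cr Y D ∧ Cr Z D) → D ∈ conCh K A C := by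
      intro _ K hK hdd Y hY Z hZ hne D hD hc
      rw [mem_con hK]
      have aux : ∀ Y ∈ 𝒴, (Y ∩ A).Nonempty → A ∪ C ⊆ Y := by
        intro Y hY ⟨x, hx⟩
        rcases hd Y hY with h | h
        · exact h
        · exact absurd (Finset.mem_inter.1 hx).1
            (Finset.disjoint_left.1 h (Finset.mem_union_left _ (Finset.mem_inter.1 hx).2))
      have aux2 : ∀ Y ∈ 𝒴, (Y ∩ C).Nonempty → A ∪ C ⊆ Y := by
        intro Y hY ⟨x, hx⟩
        rcases hd Y hY with h | h
        · exact h
        · exact absurd (Finset.mem_inter.1 hx).1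
            (Finset.disjoint_left.1 h (Finset.mem_union_right _ (Finset.mem_inter.1 hx).2))
      refine ⟨hD, ?_, ?_⟩
      · rintro rfl
        exact Finset.disjoint_left.1 (hdd Y hY Z hZ hne)
          (aux Y hY hc.1.1 (Finset.mem_union_left _ hx0))
          (aux Z hZ hc.2.1 (Finset.mem_union_left _ hx0))
      · rintro rfl
        exact Finset.disjoint_left.1 (hdd Y hY Z hZ hne)
          (aux2 Y hY hc.1.1 (Finset.mem_union_left _ hx0))
          (aux2 Z hZ hc.2.1 (Finset.mem_union_left _ hx0))
    have hOA : ∀ H ∈ O, ∀ Y ∈ 𝒴, Y.Nonempty → Y ⊆ grd H → Disjoint (A ∪ C) Y := by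
      intro H hH Y hY hn hs
      exact ((hOd H hH).symm.mono_left hUG).mono_right hs
    constructor
    · intro hf
      refine ⟨hf.ne, hf.dis, ?_, ?_, ?_, ?_, ?_, ?_⟩
      · intro Y hY
        obtain ⟨H, hH, hs⟩ := hf.inF Y hY
        rcases (hO H).1 hH with rfl | h'
        · exact ⟨_, hGF', by rw [hgG]; exact hs⟩
        · exact ⟨H, (hO' H).2 (Or.inr h'), hs⟩
      · intro H hH x hx
        rcases (hO' H).1 hH with rfl | h'
        · exact hf.cov G hGF x (by rw [← hgG]; exact hx)
        · exact hf.cov H ((hO H).2 (Or.inr h')) x hx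
      · intro H hH Y hY B hB
        rcases (hO' H).1 hH with rfl | h'
        · rcases (con_block hG B).1 hB with rfl | h''
          · exact hd Y hY
          · exact hf.sat G hGF Y hY B h''.1
        · exact hf.sat H ((hO H).2 (Or.inr h')) Y hY B hB
      · intro H hH Y hY hYH hYR
        rw [hgR] at hYR
        rcases (hO' H).1 hH with rfl | h'
        · rw [hgG] at hYH
          exact (con_restr_eq hR hG (hd Y hY)).1 (hf.agr G hGF Y hY hYH hYR)
        · rw [con_restr_dis hR (hOA H h' Y hY (hf.ne Y hY) hYH)]
          exact hf.agr H ((hO H).2 (Or.inr h')) Y hY hYH hYR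
      · intro Y hY Z hZ hne D hD
        exact hf.eR Y hY Z hZ hne D ((mem_con hR).1 hD).1
      · intro H hH Y hY Z hZ hne D hD
        rcases (hO' H).1 hH with rfl | h'
        · exact hf.eF G hGF Y hY Z hZ hne D ((mem_con hG).1 hD).1
        · exact hf.eF H ((hO H).2 (Or.inr h')) Y hY Z hZ hne D hD
    · intro hf
      refine ⟨hf.ne, hf.dis, ?_, ?_, ?_, ?_, ?_, ?_⟩
      · intro Y hY
        obtain ⟨H, hH, hs⟩ := hf.inF Y hY
        rcases (hO' H).1 hH with rfl | h'
        · exact ⟨_, hGF, by rw [← hgG]; exact hs⟩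
        · exact ⟨H, (hO H).2 (Or.inr h'), hs⟩
      · intro H hH x hx
        rcases (hO H).1 hH with rfl | h'
        · exact hf.cov _ hGF' x (by rw [hgG]; exact hx)
        · exact hf.cov H ((hO' H).2 (Or.inr h')) x hx
      · intro H hH Y hY B hB
        rcases (hO H).1 hH with rfl | h'
        · by_cases hBA : B = A
          · subst hBA
            exact (hd Y hY).imp Finset.union_subset_left (fun h => (Finset.disjoint_union_left.1 h).1)
          by_cases hBC : B = C
          · subst hBC
            exact (hd Y hY).imp Finset.union_subset_right (fun h => (Finset.disjoint_union_left.1 h).2)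
          exact hf.sat _ hGF' Y hY B ((con_block hG B).2 (Or.inr ⟨hB, hBA, hBC⟩))
        · exact hf.sat H ((hO' H).2 (Or.inr h')) Y hY B hB
      · intro H hH Y hY hYH hYR
        rcases (hO H).1 hH with rfl | h'
        · exact (con_restr_eq hR hG (hd Y hY)).2 (hf.agr _ hGF' Y hY (by rw [hgG]; exact hYH)
            (by rw [hgR]; exact hYR))
        · rw [← con_restr_dis hR (hOA H h' Y hY (hf.ne Y hY) hYH)]
          exact hf.agr H ((hO' H).2 (Or.inr h')) Y hY hYH (by rw [hgR]; exact hYR)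
      · intro Y hY Z hZ hne D hD hc
        exact hf.eR Y hY Z hZ hne D (hcr 𝒴 R hR hf.dis Y hY Z hZ hne D hD hc) hc
      · intro H hH Y hY Z hZ hne D hD hc
        rcases (hO H).1 hH with rfl | h'
        · exact hf.eF _ hGF' Y hY Z hZ hne D (hcr 𝒴 _ hG hf.dis Y hY Z hZ hne D hD hc) hc
        · exact hf.eF H ((hO' H).2 (Or.inr h')) Y hY Z hZ hne D hD hc
  refine ⟨⟨con_Tr hR, ?_, hdis', ?_, ?_⟩, ?_, ?_⟩
  · intro H hH
    rcases (hO' H).1 hH with rfl | h'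
    · exact con_Tr hG
    · exact trF H ((hO H).2 (Or.inr h'))
  · intro H hH
    rw [hgR]
    rcases (hO' H).1 hH with rfl | h'
    · left
      rw [hgG]
      refine ⟨hGl.1, fun B hB => ?_⟩
      rw [con_block hG] at hB
      rw [con_block hR]
      exact hB.imp_right (fun h => ⟨hGl.2 B h.1, h.2⟩)
    · refine (hcond H ((hO H).2 (Or.inr h'))).imp_left (fun hh => ⟨hh.1, fun B hB => ?_⟩)
      rw [con_block hR]
      have hBd : Disjoint B (grd G) := (hOd H h').mono_left (sub_grd hB.1)
      obtain ⟨y, hy⟩ := trF H ((hO H).2 (Or.inr h')) |>.ne B hB.1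
      refine Or.inr ⟨hh.2 B hB, ?_, ?_⟩
      · rintro rfl
        exact Finset.disjoint_left.1 hBd hy (hAG hy)
      · rintro rfl
        exact Finset.disjoint_left.1 hBd hy (hCG hy)
  · intro x hx
    rw [hgR] at hx
    obtain ⟨H, hH, hxH⟩ := hcov x hx
    rcases (hO H).1 hH with rfl | h'
    · exact ⟨_, hGF', by rw [hgG]; exact hxH⟩
    · exact ⟨H, (hO' H).2 (Or.inr h'), hxH⟩
  · intro 𝒴 hf
    refine (key 𝒴 ?_).2 hf
    intro Y hY
    exact hf.sat _ hGF' Y hY _ ((con_block hG _).2 (Or.inl rfl))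
  · rintro 𝒴 hf ⟨Y0, hY0, hs⟩
    refine (key 𝒴 ?_).1 hf
    intro Y hY
    by_cases he : Y = Y0
    · subst he; exact Or.inl hs
    · exact Or.inr ((hf.dis Y hY Y0 hY0 he).symm.mono_left hs)

lemma tricho {R : Clus β} {F : List (Clus β)} {𝒴 : Finset (Finset β)} {A C : Finset β}
    (h : Inv R F) (hf : AFs R F 𝒴) (hR : Ch R A C) :
    ∃ Y ∈ 𝒴, ∃ Z ∈ 𝒴, A ⊆ Y ∧ C ⊆ Z ∧ (Y = Z ∨ Y = A ∨ Z = C) := by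
  have ex : ∀ A, IsBlock R A → ∃ Y ∈ 𝒴, A ⊆ Y := by
    intro A hA
    obtain ⟨x, hx⟩ := h.trR.ne A hA.1
    obtain ⟨G, hG, hxG⟩ := h.cov x (sub_grd hA.1 hx)
    obtain ⟨Y, hY, hxY⟩ := hf.cov G hG x hxG
    rcases hf.satR h hY A hA with h' | h'
    · exact ⟨Y, hY, h'⟩
    · exact absurd hxY (Finset.disjoint_left.1 h' hx)
  obtain ⟨Y, hY, hAY⟩ := ex A hR.a
  obtain ⟨Z, hZ, hCZ⟩ := ex C hR.c
  refine ⟨Y, hY, Z, hZ, hAY, hCZ, ?_⟩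
  by_cases hne : Y = Z
  · exact Or.inl hne
  right
  have hd := hf.dis Y hY Z hZ hne
  obtain ⟨x, hx⟩ := hR.tr.ne _ hR.a.1
  obtain ⟨y, hy⟩ := hR.tr.ne _ hR.c.1
  have := hf.eR Y hY Z hZ hne _ hR.u
  by_cases hs : Y ⊆ A ∪ C
  · left
    apply Finset.Subset.antisymm _ hAY
    intro z hz
    rcases Finset.mem_union.1 (hs hz) with h' | h'
    · exact h'
    · exact absurd (hCZ h') (Finset.disjoint_left.1 hd hz)
  by_cases hs' : Z ⊆ A ∪ C
  · right
    apply Finset.Subset.antisymm _ hCZ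
    intro z hz
    rcases Finset.mem_union.1 (hs' hz) with h' | h'
    · exact absurd hz (Finset.disjoint_left.1 hd (hAY h'))
    · exact h'
  exact absurd ⟨⟨⟨x, by simp [hAY hx, hx]⟩, hs⟩, ⟨⟨y, by simp [hCZ hy, hy]⟩, hs'⟩⟩ this

lemma restr_merge {G : Clus β} {A C Z : Finset β} (h : Ch G A C) (hCZ : C ⊆ Z)
    (hAZ : Disjoint A Z) (E : Finset β) : E ∈ restr G (A ∪ Z) ↔
    E = A ∨ E = C ∨ ∃ E0 ∈ restr G Z, E = if C ⊆ E0 then A ∪ E0 else E0 := by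
  have hAn := h.tr.ne A h.a.1
  have hCn := h.tr.ne C h.c.1
  rw [mem_restr]
  constructor
  · rintro ⟨hn, D, hD, rfl⟩
    rcases h.cases hD with rfl | rfl | h' | h'
    · left; simp
    · right; left
      exact Finset.inter_eq_left.2 (hCZ.trans Finset.subset_union_right)
    · right; right
      have hCD := Finset.union_subset_right h'
      refine ⟨D ∩ Z, mem_restr.2 ⟨hCn.mono (Finset.subset_inter hCD hCZ), D, hD, rfl⟩, ?_⟩
      rw [if_pos (Finset.subset_inter hCD hCZ), Finset.inter_union_distrib_left,
        Finset.inter_eq_right.2 (Finset.union_subset_left h')]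
    · right; right
      rw [Finset.disjoint_union_left] at h'
      have he : D ∩ (A ∪ Z) = D ∩ Z := by
        rw [Finset.inter_union_distrib_left, Finset.disjoint_iff_inter_eq_empty.1 h'.1.symm,
          Finset.empty_union]
      rw [he] at hn ⊢
      refine ⟨D ∩ Z, mem_restr.2 ⟨hn, D, hD, rfl⟩, ?_⟩
      rw [if_neg]
      intro hs
      obtain ⟨y, hy⟩ := hCn
      exact Finset.disjoint_left.1 h'.2 hy (Finset.mem_inter.1 (hs hy)).1
  · rintro (rfl | rfl | ⟨E0, hE0, rfl⟩)
    · exact ⟨hAn, E, h.a.1, by simp⟩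
    · exact ⟨hCn, E, h.c.1, Finset.inter_eq_left.2 (hCZ.trans Finset.subset_union_right)⟩
    · obtain ⟨hn, D, hD, rfl⟩ := mem_restr.1 hE0
      have hn' := hn
      obtain ⟨x, hx⟩ := hn
      rw [Finset.mem_inter] at hx
      rcases h.cases hD with rfl | rfl | h' | h'
      · exact absurd hx.2 (Finset.disjoint_left.1 hAZ hx.1)
      · rw [Finset.inter_eq_left.2 hCZ, if_pos (Finset.Subset.refl _)]
        exact ⟨hAn.mono Finset.subset_union_left, _, h.u,
          Finset.inter_eq_left.2 (Finset.union_subset_union_right hCZ)⟩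
      · rw [if_pos (Finset.subset_inter (Finset.union_subset_right h') hCZ)]
        refine ⟨hAn.mono Finset.subset_union_left, D, hD, ?_⟩
        rw [Finset.inter_union_distrib_left, Finset.inter_eq_right.2 (Finset.union_subset_left h')]
      · rw [Finset.disjoint_union_left] at h'
        rw [if_neg]
        · refine ⟨hn', D, hD, ?_⟩
          rw [Finset.inter_union_distrib_left, Finset.disjoint_iff_inter_eq_empty.1 h'.1.symm,
            Finset.empty_union]
        · intro hs
          obtain ⟨y, hy⟩ := hCn
          exact Finset.disjoint_left.1 h'.2 hy (Finset.mem_inter.1 (hs hy)).1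

lemma cr_merge {G : Clus β} {A C Z Z' D : Finset β} (h : Ch G A C) (hCZ : C ⊆ Z)
    (h1 : Disjoint Z' A) (h2 : Disjoint Z' C) (hD : D ∈ G) (hc : Cr (A ∪ Z) D) (hc' : Cr Z' D) :
    Cr Z D := by
  have hCn := h.tr.ne C h.c.1
  obtain ⟨x, hx⟩ := hc'.1
  rw [Finset.mem_inter] at hx
  rcases h.cases hD with rfl | rfl | h' | h'
  · exact absurd hx.2 (Finset.disjoint_left.1 h1 hx.1)
  · exact absurd hx.2 (Finset.disjoint_left.1 h2 hx.1)
  · refine ⟨hCn.mono (Finset.subset_inter hCZ (Finset.union_subset_right h')), fun hs => ?_⟩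
    exact hc.2 (Finset.union_subset (Finset.union_subset_left h') hs)
  · rw [Finset.disjoint_union_left] at h'
    obtain ⟨y, hy⟩ := hc.1
    rw [Finset.mem_inter, Finset.mem_union] at hy
    refine ⟨⟨y, ?_⟩, fun hs => ?_⟩
    · rcases hy.1 with h'' | h''
      · exact absurd hy.2 (Finset.disjoint_left.1 h'.1 h'')
      · exact Finset.mem_inter.2 ⟨h'', hy.2⟩
    · obtain ⟨z, hz⟩ := hCn
      exact Finset.disjoint_left.1 h'.2 hz (hs (hCZ hz))

lemma merge {R : Clus β} {F : List (Clus β)} {𝒴 : Finset (Finset β)} {A C Z : Finset β}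
    {G : Clus β} (h : Inv R F) (hf : AFs R F 𝒴) (hGF : G ∈ F) (hR : Ch R A C) (hG : Ch G A C)
    (hA : A ∈ 𝒴) (hZ : Z ∈ 𝒴) (hCZ : C ⊆ Z) :
    ∃ 𝒴', AFs R F 𝒴' ∧ 𝒴'.card < 𝒴.card := by
  have hAn := hR.tr.ne A hR.a.1
  have hCn := hR.tr.ne C hR.c.1
  have hZA : Z ≠ A := by
    rintro rfl
    obtain ⟨y, hy⟩ := hCn
    exact Finset.disjoint_left.1 hR.dis (hCZ hy) hy
  have hAZ : Disjoint A Z := hf.dis A hA Z hZ hZA.symm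
  have hZG : Z ⊆ grd G := by
    obtain ⟨H, hH, hs⟩ := hf.inF Z hZ
    obtain ⟨y, hy⟩ := hCn
    rw [pw_uniq h.dis hGF hH (sub_grd hG.c.1 hy) (hs (hCZ hy))]
    exact hs
  have hAG := sub_grd hG.a.1
  have hGR : grd G ⊆ grd R := by
    obtain ⟨x, hx⟩ := hAn
    exact (h.left hGF (hAG hx) (sub_grd hR.a.1 hx)).1
  have hm : ∀ Y, Y ∈ insert (A ∪ Z) ((𝒴.erase A).erase Z) ↔
      Y = A ∪ Z ∨ (Y ∈ 𝒴 ∧ Y ≠ A ∧ Y ≠ Z) := by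
    intro Y
    simp only [Finset.mem_insert, Finset.mem_erase]
    tauto
  refine ⟨insert (A ∪ Z) ((𝒴.erase A).erase Z), ?_, ?_⟩
  swap
  · have h1 := Finset.card_insert_le (A ∪ Z) ((𝒴.erase A).erase Z)
    have h2 : ((𝒴.erase A).erase Z).card < (𝒴.erase A).card :=
      Finset.card_erase_lt_of_mem (Finset.mem_erase.2 ⟨hZA, hZ⟩)
    have h3 : (𝒴.erase A).card < 𝒴.card := Finset.card_erase_lt_of_mem hA
    omega
  have hdd : ∀ Y ∈ 𝒴, Y ≠ A → Y ≠ Z → Disjoint Y (A ∪ Z) := by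
    intro Y hY h1 h2
    exact Finset.disjoint_union_right.2 ⟨hf.dis Y hY A hA h1, hf.dis Y hY Z hZ h2⟩
  -- crossing
  have hcr : ∀ K : Clus β, (K = R ∨ K ∈ F) → ∀ Y ∈ 𝒴, Y ≠ A → Y ≠ Z → ∀ D ∈ K,
      Cr (A ∪ Z) D → Cr Y D → Cr Z D := by
    intro K hK Y hY h1 h2 D hD hc hc'
    have hYA : Disjoint Y A := hf.dis Y hY A hA h1
    have hYC : Disjoint Y C := (hf.dis Y hY Z hZ h2).mono_right hCZ
    rcases hK with rfl | hK
    · exact cr_merge hR hCZ hYA hYC hD hc hc'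
    · by_cases he : K = G
      · subst he
        exact cr_merge hG hCZ hYA hYC hD hc hc'
      · exfalso
        obtain ⟨x, hx⟩ := hc.1
        rw [Finset.mem_inter] at hx
        exact he (pw_uniq h.dis hK hGF (sub_grd hD hx.2) (Finset.union_subset hAG hZG hx.1))
  have heK : ∀ K : Clus β, (K = R ∨ K ∈ F) →
      ∀ Y ∈ 𝒴, ∀ Z ∈ 𝒴, Y ≠ Z → ∀ D ∈ K, ¬ (Cr Y D ∧ Cr Z D) := by
    rintro K (rfl | hK)
    · exact hf.eR
    · exact hf.eF K hK
  have heK' : ∀ K : Clus β, (K = R ∨ K ∈ F) → ∀ Y ∈ insert (A ∪ Z) ((𝒴.erase A).erase Z),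
      ∀ Z' ∈ insert (A ∪ Z) ((𝒴.erase A).erase Z), Y ≠ Z' → ∀ D ∈ K, ¬ (Cr Y D ∧ Cr Z' D) := by
    intro K hK Y hY Z' hZ' hne D hD hc
    rw [hm] at hY hZ'
    rcases hY with rfl | ⟨hY, y1, y2⟩ <;> rcases hZ' with rfl | ⟨hZ', z1, z2⟩
    · exact hne rfl
    · exact heK K hK Z hZ Z' hZ' z2.symm D hD ⟨hcr K hK Z' hZ' z1 z2 D hD hc.1 hc.2, hc.2⟩
    · exact heK K hK Z hZ Y hY y2.symm D hD ⟨hcr K hK Y hY y1 y2 D hD hc.2 hc.1, hc.1⟩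
    · exact heK K hK Y hY Z' hZ' hne D hD hc
  refine ⟨?_, ?_, ?_, ?_, ?_, ?_, heK' R (Or.inl rfl), fun K hK => heK' K (Or.inr hK)⟩
  · intro Y hY
    rcases (hm Y).1 hY with rfl | hY
    · exact hAn.mono Finset.subset_union_left
    · exact hf.ne Y hY.1
  · intro Y hY Z' hZ' hne
    rw [hm] at hY hZ'
    rcases hY with rfl | ⟨hY, y1, y2⟩ <;> rcases hZ' with rfl | ⟨hZ', z1, z2⟩
    · exact absurd rfl hne
    · exact (hdd Z' hZ' z1 z2).symm
    · exact hdd Y hY y1 y2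
    · exact hf.dis Y hY Z' hZ' hne
  · intro Y hY
    rcases (hm Y).1 hY with rfl | hY
    · exact ⟨G, hGF, Finset.union_subset hAG hZG⟩
    · exact hf.inF Y hY.1
  · intro H hH x hx
    obtain ⟨Y, hY, hxY⟩ := hf.cov H hH x hx
    by_cases h1 : Y = A
    · exact ⟨A ∪ Z, (hm _).2 (Or.inl rfl), Finset.mem_union_left _ (h1 ▸ hxY)⟩
    by_cases h2 : Y = Z
    · exact ⟨A ∪ Z, (hm _).2 (Or.inl rfl), Finset.mem_union_right _ (h2 ▸ hxY)⟩
    exact ⟨Y, (hm _).2 (Or.inr ⟨hY, h1, h2⟩), hxY⟩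
  · intro H hH Y hY B hB
    rcases (hm Y).1 hY with rfl | hY
    · rcases hf.sat H hH A hA B hB with h' | h'
      · exact Or.inl (h'.trans Finset.subset_union_left)
      · rcases hf.sat H hH Z hZ B hB with h'' | h''
        · exact Or.inl (h''.trans Finset.subset_union_right)
        · exact Or.inr (Finset.disjoint_union_right.2 ⟨h', h''⟩)
    · exact hf.sat H hH Y hY.1 B hB
  · intro H hH Y hY hYH hYR
    rcases (hm Y).1 hY with rfl | hY
    · obtain ⟨x, hx⟩ := hAn
      have := pw_uniq h.dis hH hGF (hYH (Finset.mem_union_left _ hx)) (hAG hx)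
      subst this
      have := hf.agr H hH Z hZ hZG (hZG.trans hGR)
      ext E
      rw [restr_merge hR hCZ hAZ, restr_merge hG hCZ hAZ, this]
    · exact hf.agr H hH Y hY.1 hYH hYR


lemma block_sat {G : Clus β} (hG : Tr G) {P : Finset β} (hP : P ∈ G) : Sat G P :=
  fun _ hB => block_or hG hB hP

lemma cut_split {G : Clus β} (hG : Tr G) {A : Finset β} (hA : IsBlock G A) (hne : G ≠ {A}) :
    Split G [({A} : Clus β), restr G (grd G \ A)] := by
  have hn : (grd G \ A).Nonempty := by
    by_contra h
    exact hne (grd_block hG hA h)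
  have hg := (restr_grd hG.top Finset.sdiff_subset hn).1
  have hAG := sub_grd hA.1
  refine ⟨?_, ?_, ?_, ?_⟩
  · intro H hH
    simp only [List.mem_cons, List.not_mem_nil, or_false] at hH
    rcases hH with rfl | rfl
    · rw [grd_single, restr_block_self hG hA]
      exact ⟨hG.ne A hA.1, hAG, rfl, block_sat hG hA.1⟩
    · rw [hg]
      exact ⟨hn, Finset.sdiff_subset, rfl, sat_compl hG hA⟩
  · simp only [List.pairwise_cons, List.mem_singleton, forall_eq, grd_single, hg]
    refine ⟨Finset.disjoint_sdiff, ?_⟩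
    simp
  · intro x hx
    by_cases h : x ∈ A
    · exact ⟨{A}, by simp, by simpa using h⟩
    · exact ⟨_, List.mem_cons_of_mem _ (List.mem_singleton_self _), by rw [hg]; simp [hx, h]⟩
  · intro H hH H' hH' hne' D hD hc
    simp only [List.mem_cons, List.not_mem_nil, or_false] at hH hH'
    rcases hH with rfl | rfl <;> rcases hH' with rfl | rfl
    · exact hne' rfl
    · rw [grd_single] at hc
      exact not_cr_block hG hA hD hc.1
    · rw [grd_single] at hc
      exact not_cr_block hG hA hD hc.2
    · exact hne' rfl

def PF (G : Clus β) (A C P : Finset β) : Prop :=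
  P.Nonempty ∧ ∃ D ∈ G, ∃ E, A ⊆ D ∧ ¬ C ⊆ D ∧ IsMaxSub G A D E ∧ P = D \ E

/-- splitting a non-block cluster above a block -/
lemma split_at {G : Clus β} (hG : Tr G) {A D : Finset β} (hA : IsBlock G A) (hD : D ∈ G)
    (h : A ⊂ D) : ∃ E ∈ G, ∃ P ∈ G, Disjoint E P ∧ D = E ∪ P ∧ A ⊆ E ∧ IsMaxSub G A D E ∧
      P = D \ E ∧ ∀ F ∈ G, F ⊂ D → F ⊆ E ∨ F ⊆ P := by
  have hb : ¬ IsBlock G D := fun hb => h.ne (hb.2 A hA.1 h.1)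
  have key : ∀ E ∈ G, ∀ P ∈ G, Disjoint E P → (∀ F ∈ G, F ⊂ E ∪ P → F ⊆ E ∨ F ⊆ P) → A ⊆ E →
      IsMaxSub G A (E ∪ P) E ∧ P = (E ∪ P) \ E := by
    intro E hE P hP hd hs hAE
    obtain ⟨x, hx⟩ := hG.ne A hA.1
    obtain ⟨y, hy⟩ := hG.ne P hP
    refine ⟨⟨hE, hAE, ⟨Finset.subset_union_left, fun h' => ?_⟩, ?_⟩, ?_⟩
    · exact Finset.disjoint_left.1 hd (h' (Finset.mem_union_right _ hy)) hy
    · intro E' hE' hAE' hss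
      rcases hs E' hE' hss with h' | h'
      · exact h'
      · exact absurd (h' (hAE' hx)) (Finset.disjoint_left.1 hd (hAE hx))
    · rw [Finset.union_sdiff_left, Finset.sdiff_eq_self_of_disjoint hd.symm]
  obtain ⟨E, hE, P, hP, hd, rfl, hs⟩ := hG.bn D hD hb
  rcases hs A hA.1 h with h' | h'
  · obtain ⟨k1, k2⟩ := key E hE P hP hd hs h'
    exact ⟨E, hE, P, hP, hd, rfl, h', k1, k2, hs⟩
  · rw [Finset.union_comm] at hs ⊢
    have hs' : ∀ F ∈ G, F ⊂ P ∪ E → F ⊆ P ∨ F ⊆ E := fun F hF h => (hs F hF h).symm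
    obtain ⟨k1, k2⟩ := key P hP E hE hd.symm hs' h'
    exact ⟨P, hP, E, hE, hd.symm, rfl, h', k1, k2, hs'⟩

lemma maxSub_uniq {G : Clus β} {A D E E' : Finset β} (h : IsMaxSub G A D E)
    (h' : IsMaxSub G A D E') : E = E' :=
  Finset.Subset.antisymm (h'.2.2.2 E h.1 h.2.1 h.2.2.1) (h.2.2.2 E' h'.1 h'.2.1 h'.2.2.1)

lemma PF.mem {G : Clus β} (hG : Tr G) {A C P : Finset β} (hA : IsBlock G A) (h : PF G A C P) :
    P ∈ G := by
  obtain ⟨hn, D, hD, E, h1, h2, h3, rfl⟩ := h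
  obtain ⟨E', hE', P', hP', -, -, -, h4, h5, -⟩ := split_at hG hA hD
    (lt_of_le_of_lt h3.2.1 h3.2.2.1)
  rw [maxSub_uniq h3 h4, ← h5]
  exact hP'

lemma PF.dis {G : Clus β} (hG : Tr G) {A C P P' : Finset β} (hA : IsBlock G A)
    (h : PF G A C P) (h' : PF G A C P') (hne : P ≠ P') : Disjoint P P' := by
  obtain ⟨hn, D, hD, E, h1, h2, h3, rfl⟩ := h
  obtain ⟨hn', D', hD', E', h1', h2', h3', rfl⟩ := h'
  obtain ⟨x, hx⟩ := hG.ne A hA.1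
  have key : ∀ D E D' E' : Finset β, D ∈ G → A ⊆ D → IsMaxSub G A D' E' → D ⊂ D' →
      Disjoint (D \ E) (D' \ E') := by
    intro D E D' E' hD hAD hm hs
    have := hm.2.2.2 D hD hAD hs
    exact Disjoint.mono_left (Finset.sdiff_subset.trans this) Finset.disjoint_sdiff
  by_cases he : D = D'
  · subst he
    rw [maxSub_uniq h3 h3'] at hne
    exact absurd rfl hne
  rcases hG.lam D hD D' hD' with h | h | h
  · exact key D E D' E' hD h1 h3' (lt_of_le_of_ne h he)
  · exact (key D' E' D E hD' h1' h3 (lt_of_le_of_ne h (Ne.symm he))).symm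
  · exact absurd (h1' hx) (Finset.disjoint_left.1 h (h1 hx))

lemma PF.dis2 {G : Clus β} (hG : Tr G) {A C P P' : Finset β} 
    (h : PF G A C P) (h' : PF G C A P') : Disjoint P P' := by
  obtain ⟨hn, D, hD, E, h1, h2, h3, rfl⟩ := h
  obtain ⟨hn', D', hD', E', h1', h2', h3', rfl⟩ := h'
  rcases hG.lam D hD D' hD' with h | h | h
  · exact absurd (h1.trans h) h2'
  · exact absurd (h1'.trans h) h2
  · exact h.mono Finset.sdiff_subset Finset.sdiff_subset

lemma PF.sub {G : Clus β} (hG : Tr G) {A C P L : Finset β} (hA : IsBlock G A) (hC : IsBlock G C)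
    (hL : IsLca G (A ∪ C) L) (h : PF G A C P) : P ⊆ L \ (A ∪ C) := by
  obtain ⟨hn, D, hD, E, h1, h2, h3, rfl⟩ := h
  obtain ⟨x, hx⟩ := hG.ne A hA.1
  have hDL : D ⊆ L := by
    rcases hG.lam D hD L hL.1 with h | h | h
    · exact h
    · exact absurd ((Finset.union_subset_right hL.2.1).trans h) h2
    · exact absurd (hL.2.1 (Finset.mem_union_left _ hx)) (Finset.disjoint_left.1 h (h1 hx))
  have hCD : Disjoint C D := (block_or hG hC hD).resolve_left h2
  intro z hz
  rw [Finset.mem_sdiff] at hz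
  rw [Finset.mem_sdiff, Finset.mem_union]
  refine ⟨hDL hz.1, ?_⟩
  rintro (h | h)
  · exact hz.2 (h3.2.1 h)
  · exact Finset.disjoint_left.1 hCD h hz.1

lemma PF.pend {G : Clus β} {A C P : Finset β} (h : PF G A C P) :
    ∃ D, PendGround G A C D P := by
  obtain ⟨hn, D, hD, E, h1, h2, h3, rfl⟩ := h
  refine ⟨D, ⟨hD, ?_, ?_, Or.inl ⟨h1, h2⟩⟩, Or.inl ⟨h1, h2, E, h3, rfl⟩⟩
  · rintro rfl
    exact h3.2.2.1.2 h3.2.1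
  · rintro rfl
    exact h2 (Finset.Subset.refl _)

lemma PF.pend2 {G : Clus β} {A C P : Finset β} (h : PF G C A P) :
    ∃ D, PendGround G A C D P := by
  obtain ⟨hn, D, hD, E, h1, h2, h3, rfl⟩ := h
  refine ⟨D, ⟨hD, ?_, ?_, Or.inr (Or.inl ⟨h1, h2⟩)⟩, Or.inr (Or.inl ⟨h1, h2, E, h3, rfl⟩)⟩
  · rintro rfl
    exact h2 (Finset.Subset.refl _)
  · rintro rfl
    exact h3.2.2.1.2 h3.2.1

lemma lca_split {G : Clus β} (hG : Tr G) {A C L : Finset β} (hA : IsBlock G A) (hC : IsBlock G C)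
    (hne : A ≠ C) (hL : IsLca G (A ∪ C) L) : ∃ E ∈ G, ∃ P ∈ G, Disjoint E P ∧ L = E ∪ P ∧
      A ⊆ E ∧ C ⊆ P := by
  obtain ⟨x, hx⟩ := hG.ne A hA.1
  obtain ⟨y, hy⟩ := hG.ne C hC.1
  have hd : Disjoint A C := by
    by_contra hd
    exact hne (block_eq hG hA hC hd)
  have hAs : A ⊂ L := by
    refine ⟨Finset.union_subset_left hL.2.1, fun h => ?_⟩
    exact Finset.disjoint_left.1 hd (h (hL.2.1 (Finset.mem_union_right _ hy))) hy
  have hCs : C ⊂ L := by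
    refine ⟨Finset.union_subset_right hL.2.1, fun h => ?_⟩
    exact Finset.disjoint_left.1 hd hx (h (hL.2.1 (Finset.mem_union_left _ hx)))
  obtain ⟨E, hE, P, hP, hdis, he, hAE, hm, -, hs⟩ := split_at hG hA hL.1 hAs
  refine ⟨E, hE, P, hP, hdis, he, hAE, ?_⟩
  rcases hs C hC.1 hCs with h | h
  · exact absurd (hL.2.2 E hE (Finset.union_subset hAE h)) hm.2.2.1.2
  · exact h

lemma pend_PF {G : Clus β} (hG : Tr G) {A C D P : Finset β} (hA : IsBlock G A) (hC : IsBlock G C)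
    (hne : A ≠ C) (h : PendGround G A C D P) (hP : P.Nonempty) : PF G A C P ∨ PF G C A P := by
  obtain ⟨h0, ⟨h1, h2, E, h3, rfl⟩ | ⟨h1, h2, E, h3, rfl⟩ | ⟨h1, E1, E2, h2, h3, rfl⟩⟩ := h
  · exact Or.inl ⟨hP, D, h0.1, E, h1, h2, h3, rfl⟩
  · exact Or.inr ⟨hP, D, h0.1, E, h1, h2, h3, rfl⟩
  · exfalso
    obtain ⟨D1, hD1, D2, hD2, hd, rfl, hA1, hC2⟩ := lca_split hG hA hC hne h1
    obtain ⟨x, hx⟩ := hG.ne D1 hD1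
    obtain ⟨y, hy⟩ := hG.ne D2 hD2
    have k1 := h2.2.2.2 D1 hD1 hA1 ⟨Finset.subset_union_left, fun h' =>
      Finset.disjoint_left.1 hd (h' (Finset.mem_union_right _ hy)) hy⟩
    have k2 := h3.2.2.2 D2 hD2 hC2 ⟨Finset.subset_union_right, fun h' =>
      Finset.disjoint_left.1 hd hx (h' (Finset.mem_union_left _ hx))⟩
    obtain ⟨z, hz⟩ := hP
    rw [Finset.mem_sdiff] at hz
    exact hz.2 (Finset.union_subset_union k1 k2 hz.1)

lemma pend_cov {G : Clus β} (hG : Tr G) {A C L : Finset β} (hA : IsBlock G A) (hC : IsBlock G C)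
    (hne : A ≠ C) (hL : IsLca G (A ∪ C) L) {x : β} (hx : x ∈ L \ (A ∪ C)) :
    ∃ P, (PF G A C P ∨ PF G C A P) ∧ x ∈ P := by
  have key : ∀ A C D1 D2 : Finset β, IsBlock G A → IsBlock G C → D1 ∈ G → Disjoint D1 D2 → A ⊆ D1 →
      C ⊆ D2 → x ∈ D1 → x ∉ A → ∃ P, PF G A C P ∧ x ∈ P := by
    intro A C D1 D2 hA hC hD1 hd hA1 hC2 hx hxA
    obtain ⟨D, hD, hmin⟩ := Finset.exists_min_image
      (G.filter (fun D => A ⊆ D ∧ x ∈ D ∧ D ⊆ D1)) Finset.card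
      ⟨D1, Finset.mem_filter.2 ⟨hD1, hA1, hx, Finset.Subset.refl _⟩⟩
    obtain ⟨hDG, hAD, hxD, hDD⟩ := Finset.mem_filter.1 hD
    obtain ⟨E, hE, P, hP, hdis, he, hAE, hm, hPe, -⟩ := split_at hG hA hDG
      ⟨hAD, fun h => hxA (h hxD)⟩
    have hxP : x ∈ P := by
      by_contra hxP
      have hxE : x ∈ E := by
        rw [he] at hxD
        exact (Finset.mem_union.1 hxD).resolve_right hxP
      have := hmin E (Finset.mem_filter.2 ⟨hE, hAE, hxE, hm.2.2.1.1.trans hDD⟩)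
      exact absurd (Finset.card_lt_card hm.2.2.1) (by omega)
    refine ⟨P, ⟨⟨x, hxP⟩, D, hDG, E, hAD, fun h => ?_, hm, hPe⟩, hxP⟩
    obtain ⟨y, hy⟩ := hG.ne C hC.1
    exact Finset.disjoint_left.1 hd (hDD (h hy)) (hC2 hy)
  obtain ⟨D1, hD1, D2, hD2, hd, rfl, hA1, hC2⟩ := lca_split hG hA hC hne hL
  rw [Finset.mem_sdiff, Finset.mem_union, Finset.mem_union, not_or] at hx
  rcases hx.1 with h | h
  · obtain ⟨P, h1, h2⟩ := key A C D1 D2 hA hC hD1 hd hA1 hC2 h hx.2.1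
    exact ⟨P, Or.inl h1, h2⟩
  · obtain ⟨P, h1, h2⟩ := key C A D2 D1 hC hA hD2 hd.symm hC2 hA1 h hx.2.2
    exact ⟨P, Or.inr h1, h2⟩

lemma pendComp_eq {G : Clus β} (hG : Tr G) {P : Finset β} (hP : P ∈ G) :
    pendComp G P = restr G P := by
  ext E
  simp only [pendComp, below, Finset.mem_insert, Finset.mem_filter, mem_restr]
  constructor
  · rintro (rfl | ⟨h1, h2⟩)
    · exact ⟨hG.ne _ hP, E, hP, Finset.inter_self _⟩
    · exact ⟨hG.ne _ h1, E, h1, Finset.inter_eq_left.2 h2⟩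
  · rintro ⟨⟨x, hx⟩, D, hD, rfl⟩
    rcases hG.lam D hD P hP with h | h | h
    · right
      rw [Finset.inter_eq_left.2 h]
      exact ⟨hD, h⟩
    · left
      exact Finset.inter_eq_right.2 h
    · exact absurd (Finset.mem_inter.1 hx).2 (Finset.disjoint_left.1 h (Finset.mem_inter.1 hx).1)

lemma exists_lca {G : Clus β} (hG : Tr G) {S : Finset β} (hS : S ⊆ grd G) (hn : S.Nonempty) :
    ∃ L, IsLca G S L := by
  obtain ⟨L, hL, hmin⟩ := Finset.exists_min_image (G.filter (fun D => S ⊆ D)) Finset.card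
      ⟨grd G, Finset.mem_filter.2 ⟨hG.top, hS⟩⟩
  obtain ⟨h1, h2⟩ := Finset.mem_filter.1 hL
  refine ⟨L, h1, h2, ?_⟩
  intro D hD hSD
  obtain ⟨x, hx⟩ := hn
  rcases hG.lam L h1 D hD with h | h | h
  · exact h
  · have := hmin D (Finset.mem_filter.2 ⟨hD, hSD⟩)
    rw [Finset.eq_of_subset_of_card_le h this]
  · exact absurd (hSD hx) (Finset.disjoint_left.1 h (h2 hx))

lemma exists_parent {G : Clus β} (hG : Tr G) {A : Finset β} (hA : A ∈ G) (hne : A ≠ grd G) :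
    ∃ P, IsChild G A P := by
  obtain ⟨P, hP, hmin⟩ := Finset.exists_min_image (G.filter (fun D => A ⊂ D)) Finset.card
      ⟨grd G, Finset.mem_filter.2 ⟨hG.top, lt_of_le_of_ne (sub_grd hA) hne⟩⟩
  obtain ⟨h1, h2⟩ := Finset.mem_filter.1 hP
  refine ⟨P, hA, h1, h2, ?_⟩
  intro E hE hAE hEP
  by_contra hne'
  have := hmin E (Finset.mem_filter.2 ⟨hE, lt_of_le_of_ne hAE (Ne.symm hne')⟩)
  exact absurd (Finset.card_lt_card hEP) (by omega)

lemma pend_split {G : Clus β} (hG : Tr G) {A C : Finset β} (hA : IsBlock G A) (hC : IsBlock G C)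
    (hne : A ≠ C) (hu : A ∪ C ∉ G) :
    ∃ new, CutPend G A C new ∧ Split G new ∧ 2 ≤ new.length ∧
      ∃ L, IsLca G (A ∪ C) L ∧
      (∀ S, Disjoint S (L \ (A ∪ C)) → S ⊆ grd G → ∃ H ∈ new, S ⊆ grd H) ∧
      (∀ P, (PF G A C P ∨ PF G C A P) → ∃ H ∈ new, P ⊆ grd H) := by
  obtain ⟨x0, hx0⟩ := hG.ne A hA.1
  have hUG : A ∪ C ⊆ grd G := Finset.union_subset (sub_grd hA.1) (sub_grd hC.1)
  obtain ⟨L, hL⟩ := exists_lca hG hUG ⟨x0, Finset.mem_union_left _ hx0⟩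
  set N : Finset (Finset β) := G.filter (fun P => PF G A C P ∨ PF G C A P) with hN
  have hmN : ∀ P, P ∈ N ↔ (PF G A C P ∨ PF G C A P) := by
    intro P
    rw [hN, Finset.mem_filter]
    refine ⟨fun h => h.2, fun h => ⟨?_, h⟩⟩
    rcases h with h | h
    · exact h.mem hG hA
    · exact h.mem hG hC
  have hNG : ∀ P ∈ N, P ∈ G := fun P hP => (Finset.mem_filter.1 hP).1
  have hL' : IsLca G (C ∪ A) L := by rw [Finset.union_comm]; exact hL
  have hNs : ∀ P ∈ N, P ⊆ L \ (A ∪ C) := by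
    intro P hP
    rcases (hmN P).1 hP with h | h
    · exact h.sub hG hA hC hL
    · rw [Finset.union_comm]
      exact h.sub hG hC hA hL'
  have hNd : ∀ P ∈ N, ∀ P' ∈ N, P ≠ P' → Disjoint P P' := by
    intro P hP P' hP' hn
    rcases (hmN P).1 hP with h | h <;> rcases (hmN P').1 hP' with h' | h'
    · exact h.dis hG hA h' hn
    · exact h.dis2 hG h'
    · exact (h'.dis2 hG h).symm
    · exact h.dis hG hC h' hn
  have hgP : ∀ P ∈ N, grd (pendComp G P) = P := by
    intro P hP
    rw [pendComp_eq hG (hNG P hP)]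
    exact (restr_grd hG.top (sub_grd (hNG P hP)) (hG.ne P (hNG P hP))).1
  set S := grd G \ (L \ (A ∪ C)) with hS
  have hAS : A ∪ C ⊆ S := by
    intro z hz
    rw [hS, Finset.mem_sdiff, Finset.mem_sdiff]
    exact ⟨hUG hz, fun h => h.2 hz⟩
  have hSn : S.Nonempty := ⟨x0, hAS (Finset.mem_union_left _ hx0)⟩
  have hac : acComp G A C L = restr G S := by
    unfold acComp restr
    congr 1
    apply Finset.image_congr
    intro D hD
    have := sub_grd (Finset.mem_coe.1 hD)
    ext z
    simp only [hS, Finset.mem_sdiff, Finset.mem_inter]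
    constructor
    · rintro ⟨a, b⟩
      exact ⟨a, this a, b⟩
    · rintro ⟨a, -, b⟩
      exact ⟨a, b⟩
  have hgS : grd (acComp G A C L) = S := by
    rw [hac]
    exact (restr_grd hG.top Finset.sdiff_subset hSn).1
  have hmem : ∀ H, H ∈ acComp G A C L :: (N.image (pendComp G)).toList ↔
      H = acComp G A C L ∨ ∃ P ∈ N, pendComp G P = H := by
    intro H
    simp
  refine ⟨acComp G A C L :: (N.image (pendComp G)).toList, ⟨L, hL, _, ?_, ?_, Finset.nodup_toList _, rfl⟩,
    ⟨?_, ?_, ?_, ?_⟩, ?_, L, hL, ?_, ?_⟩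
  · intro Q hQ
    rw [Finset.mem_toList, Finset.mem_image] at hQ
    obtain ⟨P, hP, rfl⟩ := hQ
    rcases (hmN P).1 hP with h | h
    · obtain ⟨D, hD⟩ := h.pend
      exact ⟨D, P, hD, h.1, rfl⟩
    · obtain ⟨D, hD⟩ := h.pend2
      exact ⟨D, P, hD, h.1, rfl⟩
  · intro D P hP hPn
    rw [Finset.mem_toList]
    exact Finset.mem_image_of_mem _ ((hmN P).2 (pend_PF hG hA hC hne hP hPn))
  · intro H hH
    rcases (hmem H).1 hH with rfl | ⟨P, hP, rfl⟩
    · rw [hgS]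
      refine ⟨hSn, Finset.sdiff_subset, hac, ?_⟩
      intro B hB
      by_cases hd : Disjoint B (A ∪ C)
      · rcases block_or hG hB hL.1 with h | h
        · right
          exact Disjoint.mono_left (Finset.subset_sdiff.2 ⟨h, hd⟩) Finset.disjoint_sdiff
        · left
          exact Finset.subset_sdiff.2 ⟨sub_grd hB.1, h.mono_right Finset.sdiff_subset⟩
      · left
        rw [Finset.disjoint_union_right, not_and_or] at hd
        rcases hd with h | h
        · rw [block_eq hG hB hA h]
          exact Finset.union_subset_left hAS
        · rw [block_eq hG hB hC h]
          exact Finset.union_subset_right hAS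
    · rw [hgP P hP]
      exact ⟨hG.ne P (hNG P hP), sub_grd (hNG P hP), pendComp_eq hG (hNG P hP),
        block_sat hG (hNG P hP)⟩
  · rw [List.pairwise_cons]
    constructor
    · intro H hH
      rw [Finset.mem_toList, Finset.mem_image] at hH
      obtain ⟨P, hP, rfl⟩ := hH
      rw [hgS, hgP P hP]
      exact Disjoint.mono_right (hNs P hP) Finset.sdiff_disjoint
    · apply List.Nodup.pairwise_of_forall_ne (Finset.nodup_toList _)
      intro H hH H' hH' hn
      rw [Finset.mem_toList, Finset.mem_image] at hH hH'
      obtain ⟨P, hP, rfl⟩ := hH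
      obtain ⟨P', hP', rfl⟩ := hH'
      rw [hgP P hP, hgP P' hP']
      apply hNd P hP P' hP'
      rintro rfl
      exact hn rfl
  · intro x hx
    by_cases hxL : x ∈ L \ (A ∪ C)
    · obtain ⟨P, hP, hxP⟩ := pend_cov hG hA hC hne hL hxL
      have := (hmN P).2 hP
      exact ⟨pendComp G P, (hmem _).2 (Or.inr ⟨P, this, rfl⟩), by rw [hgP P this]; exact hxP⟩
    · exact ⟨_, (hmem _).2 (Or.inl rfl), by rw [hgS, hS]; exact Finset.mem_sdiff.2 ⟨hx, hxL⟩⟩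
  · have key : ∀ P ∈ N, ∀ D ∈ G, Cr P D → D ⊆ P := by
      intro P hP D hD hc
      rcases hG.lam P (hNG P hP) D hD with h | h | h
      · exact absurd h hc.2
      · exact h
      · obtain ⟨z, hz⟩ := hc.1
        rw [Finset.mem_inter] at hz
        exact absurd hz.2 (Finset.disjoint_left.1 h hz.1)
    have key2 : ∀ P ∈ N, ∀ D ∈ G, ∀ Q : Finset β, Disjoint P Q → Cr P D → Cr Q D → False := by
      intro P hP D hD Q hd hc hc'
      obtain ⟨z, hz⟩ := hc'.1
      rw [Finset.mem_inter] at hz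
      exact Finset.disjoint_left.1 hd (key P hP D hD hc hz.2) hz.1
    have hSP : ∀ P ∈ N, Disjoint P S := by
      intro P hP
      exact Disjoint.mono_left (hNs P hP) Finset.disjoint_sdiff
    intro H hH H' hH' hn D hD hc
    rcases (hmem H).1 hH with rfl | ⟨P, hP, rfl⟩ <;> rcases (hmem H').1 hH' with rfl | ⟨P', hP', rfl⟩
    · exact hn rfl
    · rw [hgS, hgP P' hP'] at hc
      exact key2 P' hP' D hD S (hSP P' hP') hc.2 hc.1
    · rw [hgS, hgP P hP] at hc
      exact key2 P hP D hD S (hSP P hP) hc.1 hc.2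
    · rw [hgP P hP, hgP P' hP'] at hc
      refine key2 P hP D hD P' (hNd P hP P' hP' ?_) hc.1 hc.2
      rintro rfl
      exact hn rfl
  · have : (L \ (A ∪ C)).Nonempty := by
      rw [Finset.sdiff_nonempty]
      intro h
      exact hu (Finset.Subset.antisymm hL.2.1 h ▸ hL.1)
    obtain ⟨x, hx⟩ := this
    obtain ⟨P, hP, hxP⟩ := pend_cov hG hA hC hne hL hx
    have : 0 < (N.image (pendComp G)).card :=
      Finset.card_pos.2 ⟨_, Finset.mem_image_of_mem _ ((hmN P).2 hP)⟩
    rw [List.length_cons, Finset.length_toList]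
    omega
  · intro S' hd hs
    refine ⟨_, (hmem _).2 (Or.inl rfl), ?_⟩
    rw [hgS, hS]
    exact Finset.subset_sdiff.2 ⟨hs, hd⟩
  · intro P hP
    have := (hmN P).2 hP
    exact ⟨pendComp G P, (hmem _).2 (Or.inr ⟨P, this, rfl⟩), by rw [hgP P this]⟩

lemma pend_AF {R : Clus β} {F : List (Clus β)} {𝒴 : Finset (Finset β)} {A C Y L : Finset β}
    {G : Clus β} (hGF : G ∈ F) (hGR : grd G ⊆ grd R) (hf : AFs R F 𝒴) (hG : Tr G)
    (hA : IsBlock G A) (hC : IsBlock G C) (hne : A ≠ C)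
    (hu : A ∪ C ∈ R) (hY : Y ∈ 𝒴) (hYA : A ∪ C ⊆ Y) (hYG : Y ⊆ grd G)
    (hL : IsLca G (A ∪ C) L) :
    ∀ Z ∈ 𝒴, Z ⊆ grd G → Disjoint Z (L \ (A ∪ C)) ∨ ∃ P, (PF G A C P ∨ PF G C A P) ∧ Z ⊆ P := by
  intro Z hZ hZG
  obtain ⟨x0, hx0⟩ := hG.ne A hA.1
  by_cases he : Z = Y
  · subst he
    left
    have hag := hf.agr G hGF Z hZ hZG (hZG.trans hGR)
    have h1 : A ∪ C ∈ restr R Z := mem_restr.2 ⟨⟨x0, Finset.mem_union_left _ hx0⟩, _, hu,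
      Finset.inter_eq_left.2 hYA⟩
    rw [hag] at h1
    obtain ⟨-, D, hD, hDe⟩ := mem_restr.1 h1
    have hLD : L ⊆ D := hL.2.2 D hD (by rw [← hDe]; exact Finset.inter_subset_left)
    rw [Finset.disjoint_left]
    intro z hz hzL
    rw [Finset.mem_sdiff] at hzL
    exact hzL.2 (hDe ▸ Finset.mem_inter.2 ⟨hLD hzL.1, hz⟩)
  · by_cases hd : Disjoint Z (L \ (A ∪ C))
    · exact Or.inl hd
    right
    rw [Finset.not_disjoint_iff] at hd
    obtain ⟨z, hz, hzL⟩ := hd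
    obtain ⟨P, hP, hzP⟩ := pend_cov hG hA hC hne hL hzL
    refine ⟨P, hP, ?_⟩
    have key : ∀ A C : Finset β, IsBlock G A → A ⊆ Y → C ⊆ Y → PF G A C P → Z ⊆ P := by
      rintro A C hA hAY hCY ⟨-, D, hD, E, h1, h2, h3, rfl⟩
      obtain ⟨x, hx⟩ := hG.ne A hA.1
      rw [Finset.mem_sdiff] at hzP
      have c1 : Cr Y D := ⟨⟨x, Finset.mem_inter.2 ⟨hAY hx, h1 hx⟩⟩, fun h => h2 (hCY.trans h)⟩
      have c2 : Cr Y E := ⟨⟨x, Finset.mem_inter.2 ⟨hAY hx, h3.2.1 hx⟩⟩,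
        fun h => h2 ((hCY.trans h).trans h3.2.2.1.1)⟩
      have d1 : Z ⊆ D := by
        by_contra h
        exact hf.eF G hGF Z hZ Y hY he D hD ⟨⟨⟨z, Finset.mem_inter.2 ⟨hz, hzP.1⟩⟩, h⟩, c1⟩
      have d2 : Disjoint Z E := by
        by_contra h
        rw [Finset.not_disjoint_iff] at h
        obtain ⟨w, hw, hwE⟩ := h
        exact hf.eF G hGF Z hZ Y hY he E h3.1
          ⟨⟨⟨w, Finset.mem_inter.2 ⟨hw, hwE⟩⟩, fun h => hzP.2 (h hz)⟩, c2⟩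
      exact Finset.subset_sdiff.2 ⟨d1, d2⟩
    rcases hP with h | h
    · exact key A C hA (Finset.union_subset_left hYA) (Finset.union_subset_right hYA) h
    · exact key C A hC (Finset.union_subset_right hYA) (Finset.union_subset_left hYA) h

lemma cherryR_iff {R : Clus β} (hR : Tr R) {A C : Finset β} : CherryR R A C ↔ Ch R A C := by
  constructor
  · rintro ⟨hne, P, h1, h2, h3⟩
    exact ⟨hR, h3 A h1, h3 C h2, hne, child_pair hR hne h1 h2 ▸ h1.2.1⟩
  · intro h
    refine ⟨h.ne, A ∪ C, h.child, ?_, ?_⟩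
    · have := h.symm.child
      rwa [Finset.union_comm] at this
    · intro D hD
      rcases h.cases hD.1 with rfl | rfl | h' | h'
      · exact h.a
      · exact h.c
      · exact absurd h' hD.2.2.1.2
      · obtain ⟨x, hx⟩ := hR.ne D hD.1
        exact absurd hx (Finset.disjoint_left.1 h' (hD.2.2.1.1 hx))

lemma cherryOf_iff {R : Clus β} (hR : Tr R) {A C : Finset β} : CherryOf R A C ↔ Ch R A C := by
  constructor
  · rintro ⟨hne, h1, h2, P, h3, h4⟩
    exact ⟨hR, h1, h2, hne, child_pair hR hne h3 h4 ▸ h3.2.1⟩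
  · intro h
    refine ⟨h.ne, h.a, h.c, A ∪ C, h.child, ?_⟩
    have := h.symm.child
    rwa [Finset.union_comm] at this

lemma exists_cherry {R : Clus β} (hR : Tr R) (hs : ¬ SingleLeaf R) : ∃ A C, Ch R A C := by
  have h0 : ¬ IsBlock R (grd R) := by
    intro h
    refine hs ⟨grd R, ?_⟩
    apply grd_block hR h
    simp
  obtain ⟨P, hP, hmin⟩ := Finset.exists_min_image (R.filter (fun D => ¬ IsBlock R D)) Finset.card
      ⟨grd R, Finset.mem_filter.2 ⟨hR.top, h0⟩⟩
  obtain ⟨hPR, hPb⟩ := Finset.mem_filter.1 hP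
  obtain ⟨D, hD, E, hE, hd, rfl, -⟩ := hR.bn P hPR hPb
  have hDp := (hR.ne D hD).card_pos
  have hEp := (hR.ne E hE).card_pos
  have hc := Finset.card_union_of_disjoint hd
  have hb : ∀ K ∈ R, K.card < (D ∪ E).card → IsBlock R K := by
    intro K hK hlt
    by_contra h
    have := hmin K (Finset.mem_filter.2 ⟨hK, h⟩)
    omega
  refine ⟨D, E, hR, hb D hD (by omega), hb E hE (by omega), ?_, hPR⟩
  rintro rfl
  obtain ⟨x, hx⟩ := hR.ne D hD
  exact Finset.disjoint_left.1 hd hx hx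

lemma not_deg3 {R : Clus β} (hR : Tr R) {P : Finset β} : ¬ Deg3 R P := by
  rintro ⟨D1, D2, D3, h1, h2, h3, n12, n13, n23⟩
  have e1 := child_pair hR n12 h1 h2
  have e2 := child_pair hR n13 h1 h3
  have hd : Disjoint D2 D3 := by
    rcases hR.lam D2 h2.1 D3 h3.1 with h | h | h
    · exact absurd (h2.2.2.2 D3 h3.1 h h3.2.2.1).symm n23
    · exact absurd (h3.2.2.2 D2 h2.1 h h2.2.2.1) n23
    · exact h
  have hd' : Disjoint D2 D1 := by
    rcases hR.lam D2 h2.1 D1 h1.1 with h | h | h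
    · exact absurd (h2.2.2.2 D1 h1.1 h h1.2.2.1) n12
    · exact absurd (h1.2.2.2 D2 h2.1 h h2.2.2.1).symm n12
    · exact h
  obtain ⟨x, hx⟩ := hR.ne D2 h2.1
  have : x ∈ P := h2.2.2.1.1 hx
  rw [e2] at this
  rcases Finset.mem_union.1 this with h | h
  · exact Finset.disjoint_left.1 hd' hx h
  · exact Finset.disjoint_left.1 hd hx h


def NoTrue (M : MapT β) : Prop := ∀ S p, M S = some p → p.2.2 = false

lemma NoTrue.map {M : MapT β} (h : NoTrue M) (S : Finset β) :
    (M S).map (fun p => (p.1, p.2.1, false)) = M S := by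
  rcases hM : M S with _ | ⟨a, b, c⟩
  · rfl
  · have := h S _ hM
    simp at this
    simp [this]

lemma NoTrue.bot {M : MapT β} (h : NoTrue M) (A : Finset β) : remapBot M A = M := by
  funext S
  unfold remapBot
  split
  · exact h.map S
  · rfl

lemma NoTrue.rif {M : MapT β} (h : NoTrue M) (c : Prop) (A : Finset β) : remapIf c A M = M := by
  funext S
  unfold remapIf
  split
  · exact h.map S
  · rfl

lemma AFs.ofG {R : Clus β} {F : List (Clus β)} {𝒴 : Finset (Finset β)} (h : Inv R F)
    (hf : AFs R F 𝒴) {G : Clus β} (hG : G ∈ F) {x : β} (hx : x ∈ grd G) :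
    ∃ Y ∈ 𝒴, x ∈ Y ∧ Y ⊆ grd G := by
  obtain ⟨Y, hY, hxY⟩ := hf.cov G hG x hx
  obtain ⟨H, hH, hs⟩ := hf.inF Y hY
  rw [pw_uniq h.dis hG hH hx (hs hxY)]
  exact ⟨Y, hY, hxY, hs⟩

lemma len_le {R : Clus β} {F : List (Clus β)} {𝒴 : Finset (Finset β)} (h : Inv R F)
    (hf : AFs R F 𝒴) : F.length ≤ 𝒴.card := by
  have hnd : F.Nodup := by
    refine List.Pairwise.imp_of_mem ?_ h.dis
    intro G H hG hH hd he
    subst he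
    obtain ⟨x, hx⟩ := (h.trF G hG).gne
    exact Finset.disjoint_left.1 hd hx hx
  have hex : ∀ G ∈ F, ∃ Y ∈ 𝒴, Y ⊆ grd G := by
    intro G hG
    obtain ⟨x, hx⟩ := (h.trF G hG).gne
    obtain ⟨Y, hY, -, hs⟩ := hf.ofG h hG hx
    exact ⟨Y, hY, hs⟩
  choose! f hf1 hf2 using hex
  rw [← List.toFinset_card_of_nodup hnd]
  apply Finset.card_le_card_of_injOn f
  · intro G hG
    exact hf1 G (by simpa using hG)
  · intro G hG H hH he
    have hG' : G ∈ F := by simpa using hG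
    have hH' : H ∈ F := by simpa using hH
    obtain ⟨x, hx⟩ := hf.ne _ (hf1 G hG')
    exact pw_uniq h.dis hG' hH' (hf2 G hG' hx) (hf2 H hH' (he ▸ hx))

noncomputable def unc (A C : Finset β) (G : Clus β) : Clus β :=
  if IsBlock G (A ∪ C) then insert A (insert C G) else G

lemma expand_all {M : MapT β} {A C : Finset β} (hM : M (A ∪ C) = some (A, C, false))
    (l l0 : List (Clus β)) :
    Relation.ReflTransGen (ExpandStep M) (l0 ++ l) (l0 ++ l.map (unc A C)) := by
  induction l generalizing l0 with
  | nil => simpa using Relation.ReflTransGen.refl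
  | cons G l ih =>
    have h2 := ih (l0 ++ [unc A C G])
    simp only [List.append_assoc, List.singleton_append] at h2
    rw [List.map_cons]
    refine Relation.ReflTransGen.trans ?_ h2
    by_cases hb : IsBlock G (A ∪ C)
    · apply Relation.ReflTransGen.single
      refine ⟨G, A ∪ C, A, C, false, hb, hM, l0, l, rfl, ?_⟩
      simp [unc, hb]
    · have : unc A C G = G := by simp [unc, hb]
      rw [this]

def Res (k : ℕ) (R : Clus β) (F : List (Clus β)) (M : MapT β) (𝒴 : Finset (Finset β)) : Prop :=
  ∃ s' : St β, Relation.ReflTransGen (AMFStep k) (R, F, M) s' ∧ SingleLeaf s'.1 ∧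
    s'.2.1.length ≤ k ∧
    (∀ S, (∃ G ∈ F, ∃ B, IsBlock G B ∧ S ⊆ B) → s'.2.2 S = M S) ∧
    ∃ out, Relation.ReflTransGen (ExpandStep s'.2.2) s'.2.1 out ∧
      ∀ G ∈ out, (∃ Y ∈ 𝒴, Y ⊆ grd R ∧ G = restr R Y) ∨ (G ∈ F ∧ Disjoint (grd G) (grd R))

lemma res_base {k : ℕ} {R : Clus β} {F : List (Clus β)} {M : MapT β} {𝒴 : Finset (Finset β)}
    (h : Inv R F) (hf : AFs R F 𝒴) (hk : 𝒴.card ≤ k) (hs : SingleLeaf R) : Res k R F M 𝒴 := by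
  refine ⟨(R, F, M), Relation.ReflTransGen.refl, hs, (len_le h hf).trans hk, fun _ _ => rfl, F,
    Relation.ReflTransGen.refl, ?_⟩
  intro G hG
  obtain ⟨A0, rfl⟩ := hs
  have hb0 : IsBlock ({A0} : Clus β) A0 := by simp [IsBlock]
  rcases h.cond G hG with ⟨h1, h2⟩ | ⟨h1, h2⟩
  · left
    obtain ⟨x, hx⟩ := (h.trF G hG).gne
    obtain ⟨B, hB, hxB, -⟩ := exists_block (h.trF G hG) (h.trF G hG).top hx
    have hBA : B = A0 := by simpa using (h2 B hB).1
    subst hBA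
    have hGe : G = {B} := by
      apply grd_block (h.trF G hG) hB
      rw [Finset.sdiff_nonempty, not_not]
      simpa using h1
    obtain ⟨Y, hY, hxY, hYG⟩ := hf.ofG h hG hx
    subst hGe
    have := hf.isol h.dis hG hY hxY hxB
    subst this
    exact ⟨Y, hY, by simp, by rw [restr_block_self h.trR hb0]⟩
  · exact Or.inr ⟨hG, h1⟩

lemma res_isol {k : ℕ} {R : Clus β} {F : List (Clus β)} {M : MapT β} {𝒴 : Finset (Finset β)}
    (h : Inv R F) (hf : AFs R F 𝒴) (hk : 𝒴.card ≤ k) (hM : NoTrue M) (hs : ¬ SingleLeaf R)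
    {A : Finset β} (hA : IsolRef R F A) (ih : Res k (rmBlock R A) F M 𝒴) : Res k R F M 𝒴 := by
  obtain ⟨hAR, hAF⟩ := hA
  obtain ⟨-, -, -, hg⟩ := isol_step h hAR hAF hs
  obtain ⟨s', h1, h2, h3, h4, out, h5, h6⟩ := ih
  refine ⟨s', ?_, h2, h3, h4, out, h5, ?_⟩
  · refine Relation.ReflTransGen.head ?_ h1
    refine ⟨(len_le h hf).trans hk, hs, Or.inl ⟨A, ⟨hAR, hAF⟩, ?_⟩⟩
    simp only [hM.bot]
  · intro G hG
    rcases h6 G hG with ⟨Y, hY, hYR, rfl⟩ | ⟨hGF, hd⟩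
    · left
      rw [hg] at hYR
      exact ⟨Y, hY, hYR.trans Finset.sdiff_subset, restr_restr hYR⟩
    · by_cases hd' : Disjoint (grd G) (grd R)
      · exact Or.inr ⟨hGF, hd'⟩
      left
      rw [Finset.not_disjoint_iff] at hd'
      obtain ⟨x, hx, hxR⟩ := hd'
      rw [hg] at hd
      have hxA : x ∈ A := by
        by_contra hxA
        exact Finset.disjoint_left.1 hd hx (Finset.mem_sdiff.2 ⟨hxR, hxA⟩)
      have hGe := pw_uniq h.dis hGF hAF hx (by simpa using hxA)
      subst hGe
      obtain ⟨Y, hY, hxY, -⟩ := hf.ofG h hGF hx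
      have := hf.isol h.dis hAF hY hxY hxA
      subst this
      exact ⟨Y, hY, sub_grd hAR.1, by rw [restr_block_self h.trR hAR]⟩

lemma res_split {k : ℕ} {R : Clus β} {l1 l2 new : List (Clus β)} {G : Clus β} {M : MapT β}
    {𝒴 : Finset (Finset β)}
    (h : Inv R (l1 ++ G :: l2)) (hGR : grd G ⊆ grd R) (hS : Split G new)
    (hstep : AMFStep k (R, l1 ++ G :: l2, M) (R, l1 ++ new ++ l2, M))
    (ih : Res k R (l1 ++ new ++ l2) M 𝒴) : Res k R (l1 ++ G :: l2) M 𝒴 := by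
  obtain ⟨s', h1, h2, h3, h4, out, h5, h6⟩ := ih
  have trG := h.trF G (by simp)
  refine ⟨s', Relation.ReflTransGen.head hstep h1, h2, h3, ?_, out, h5, ?_⟩
  · rintro S ⟨H, hH, B, hB, hSB⟩
    apply h4
    by_cases he : H = G
    · subst he
      obtain ⟨x, hx⟩ := trG.ne B hB.1
      obtain ⟨H', hH', hx'⟩ := hS.cov x (sub_grd hB.1 hx)
      obtain ⟨e1, e2, e3, e4⟩ := hS.each H' hH'
      refine ⟨H', by simp [hH'], B, ?_, hSB⟩
      rw [e3, restr_block trG e4]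
      refine ⟨hB, (e4 B hB).resolve_right fun hd => Finset.disjoint_left.1 hd hx hx'⟩
    · refine ⟨H, ?_, B, hB, hSB⟩
      simp at hH ⊢
      tauto
  · intro H hH
    refine (h6 H hH).imp_right ?_
    rintro ⟨hHF, hd⟩
    refine ⟨?_, hd⟩
    have : H ∉ new := by
      intro hn
      obtain ⟨e1, e2, -⟩ := hS.each H hn
      obtain ⟨x, hx⟩ := e1
      exact Finset.disjoint_left.1 hd hx (hGR (e2 hx))
    simp at hHF ⊢
    tauto

lemma res_con {k : ℕ} {R : Clus β} {l1 l2 : List (Clus β)} {G : Clus β} {M : MapT β}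
    {𝒴 : Finset (Finset β)} {A C : Finset β}
    (h : Inv R (l1 ++ G :: l2)) (hR : Ch R A C) (hG : Ch G A C)
    (hf : AFs (conCh R A C) (l1 ++ [conCh G A C] ++ l2) 𝒴)
    (hstep : AMFStep k (R, l1 ++ G :: l2, M) (conCh R A C, l1 ++ [conCh G A C] ++ l2,
      Function.update M (A ∪ C) (some (A, C, false))))
    (ih : Res k (conCh R A C) (l1 ++ [conCh G A C] ++ l2)
      (Function.update M (A ∪ C) (some (A, C, false))) 𝒴) : Res k R (l1 ++ G :: l2) M 𝒴 := by
  obtain ⟨s', h1, h2, h3, h4, out, h5, h6⟩ := ih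
  have hI := (con_step h hR hG).1
  have hGF : conCh G A C ∈ l1 ++ [conCh G A C] ++ l2 := by simp
  have hGR := (con_grd hR).1
  have hGG := (con_grd hG).1
  obtain ⟨x, hx⟩ := hR.tr.ne A hR.a.1
  have hbU : IsBlock (conCh G A C) (A ∪ C) := (con_block hG _).2 (Or.inl rfl)
  have hMU : s'.2.2 (A ∪ C) = some (A, C, false) := by
    rw [h4 (A ∪ C) ⟨_, hGF, A ∪ C, hbU, Finset.Subset.refl _⟩]
    simp
  refine ⟨s', Relation.ReflTransGen.head hstep h1, h2, h3, ?_, out.map (unc A C),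
    h5.trans (expand_all hMU out []), ?_⟩
  · rintro S ⟨H, hH, B, hB, hSB⟩
    rw [h4]
    · rw [Function.update_of_ne]
      rintro rfl
      have hxB := hSB (Finset.mem_union_left _ hx)
      have := pw_uniq h.dis hH (by simp : G ∈ l1 ++ G :: l2) (sub_grd hB.1 hxB) (sub_grd hG.a.1 hx)
      subst this
      have e1 := hB.2 A hG.a.1 (Finset.union_subset_left hSB)
      have e2 := hB.2 C hG.c.1 (Finset.union_subset_right hSB)
      exact hG.ne (e1.trans e2.symm)
    · by_cases he : H = G
      · subst he
        refine ⟨_, hGF, ?_⟩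
        by_cases hBA : B = A
        · exact ⟨_, hbU, hSB.trans (hBA ▸ Finset.subset_union_left)⟩
        by_cases hBC : B = C
        · exact ⟨_, hbU, hSB.trans (hBC ▸ Finset.subset_union_right)⟩
        exact ⟨B, (con_block hG B).2 (Or.inr ⟨hB, hBA, hBC⟩), hSB⟩
      · refine ⟨H, ?_, B, hB, hSB⟩
        simp at hH ⊢
        tauto
  · intro H' hH'
    rw [List.mem_map] at hH'
    obtain ⟨H, hH, rfl⟩ := hH'
    rcases h6 H hH with ⟨Y, hY, hYR, rfl⟩ | ⟨hHF, hd⟩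
    · left
      refine ⟨Y, hY, hGR ▸ hYR, ?_⟩
      have hsat := hf.satR hI hY
      unfold unc
      rw [restr_block (con_Tr hR) hsat]
      rcases hsat _ ((con_block hR _).2 (Or.inl rfl)) with hs | hs
      · rw [if_pos ⟨(con_block hR _).2 (Or.inl rfl), hs⟩]
        exact (con_restr_sub hR hs).1.symm
      · rw [if_neg, con_restr_dis hR hs]
        rintro ⟨-, hs'⟩
        exact Finset.disjoint_left.1 hs (Finset.mem_union_left _ hx)
          (hs' (Finset.mem_union_left _ hx))
    · right
      rw [hGR] at hd
      have hne : H ≠ conCh G A C := by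
        rintro rfl
        rw [hGG] at hd
        exact Finset.disjoint_left.1 hd (sub_grd hG.a.1 hx) (sub_grd hR.a.1 hx)
      have : unc A C H = H := by
        unfold unc
        rw [if_neg]
        intro hb
        exact Finset.disjoint_left.1 hd (sub_grd hb.1 (Finset.mem_union_left _ hx))
          (sub_grd hR.a.1 hx)
      rw [this]
      refine ⟨?_, hd⟩
      simp at hHF ⊢
      tauto

theorem main_ind (k n : ℕ) : ∀ (R : Clus β) (F : List (Clus β)) (M : MapT β)
    (𝒴 : Finset (Finset β)), R.card + (k - F.length) < n → Inv R F → AFs R F 𝒴 →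
    (∀ 𝒴', AFs R F 𝒴' → 𝒴.card ≤ 𝒴'.card) → NoTrue M → 𝒴.card ≤ k → Res k R F M 𝒴 := by
  induction n with
  | zero => intro R F M 𝒴 h; omega
  | succ n IH =>
  intro R F M 𝒴 hn h hf hmin hM hk
  by_cases hs : SingleLeaf R
  · exact res_base h hf hk hs
  have hlen := (len_le h hf).trans hk
  by_cases hiso : ∃ A, IsolRef R F A
  · obtain ⟨A, hA⟩ := hiso
    obtain ⟨s1, s2, s3, -⟩ := isol_step h hA.1 hA.2 hs
    exact res_isol h hf hk hM hs hA (IH _ _ _ _ (by omega) s1 ((s2 𝒴).1 hf)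
      (fun 𝒴' h' => hmin 𝒴' ((s2 𝒴').2 h')) hM hk)
  by_cases hcom : ∃ A C, IsCommon R F A C
  · obtain ⟨A, C, hc⟩ := hcom
    obtain ⟨hcR, G, hGF, hcG⟩ := hc
    have hR := (cherryR_iff h.trR).1 hcR
    have hG := (cherryOf_iff (h.trF G hGF)).1 hcG
    have hYU : ∃ Y ∈ 𝒴, A ∪ C ⊆ Y := by
      obtain ⟨Y, hY, Z, hZ, hAY, hCZ, he | he | he⟩ := tricho h hf hR
      · subst he
        exact ⟨Y, hY, Finset.union_subset hAY hCZ⟩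
      · subst he
        obtain ⟨𝒴', m1, m2⟩ := merge h hf hGF hR hG hY hZ hCZ
        have := hmin 𝒴' m1
        omega
      · subst he
        obtain ⟨𝒴', m1, m2⟩ := merge h hf hGF hR.symm hG.symm hZ hY hAY
        have := hmin 𝒴' m1
        omega
    obtain ⟨l1, l2, rfl⟩ := List.append_of_mem hGF
    obtain ⟨s1, s2, s3⟩ := con_step h hR hG
    have hf' := s3 𝒴 hf hYU
    have hcard := con_card hR
    refine res_con h hR hG hf' ?_ (IH _ _ _ _ ?_ s1 hf' (fun 𝒴' h' => hmin 𝒴' (s2 𝒴' h')) ?_ hk)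
    · refine ⟨hlen, hs, Or.inr (Or.inl ⟨hiso, A, C, ⟨hcR, G, hGF, hcG⟩, G, _, hGF, hcG,
        ⟨l1, l2, rfl, rfl⟩, A ∪ C, A ∪ C, hR.child, hG.child, false, ?_, rfl⟩)⟩
      simp only [Bool.false_eq_true, false_iff, not_and]
      intro hd
      exact absurd hd (not_deg3 h.trR)
    · simp only [List.length_append, List.length_cons, List.length_nil] at hn ⊢
      omega
    · intro S p hp
      by_cases hS : S = A ∪ C
      · subst hS
        simp at hp
        rw [← hp]
      · rw [Function.update_of_ne hS] at hp
        exact hM S p hp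
  have hsplit : ∀ l1 G l2 new, F = l1 ++ G :: l2 → grd G ⊆ grd R → Split G new → 2 ≤ new.length →
      (∀ Y ∈ 𝒴, Y ⊆ grd G → ∃ H ∈ new, Y ⊆ grd H) →
      AMFStep k (R, F, M) (R, l1 ++ new ++ l2, M) → Res k R F M 𝒴 := by
    intro l1 G l2 new hF hGR hS hl hY hst
    subst hF
    obtain ⟨s1, s2, s3⟩ := split_step h hGR hS
    have hf' := s3 𝒴 hf hY
    have hlen' := (len_le s1 hf').trans hk
    refine res_split h hGR hS hst (IH _ _ _ _ ?_ s1 hf' (fun 𝒴' h' => hmin 𝒴' (s2 𝒴' h')) hM hk)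
    simp only [List.length_append, List.length_cons] at hn hlen' ⊢
    omega
  have hcontra : ∀ A C, Ch R A C → IsContra R F A C := by
    intro A C hR
    have := (cherryR_iff h.trR).2 hR
    exact ⟨this, fun hc => hcom ⟨A, C, this, hc⟩⟩
  have hcut : ∀ A C, Ch R A C → A ∈ 𝒴 → Res k R F M 𝒴 := by
    intro A C hR hA
    obtain ⟨G, hGF, hGA⟩ := h.blkEx hR.a
    have hGne : G ≠ {A} := by
      rintro rfl
      exact hiso ⟨A, hR.a, hGF⟩
    obtain ⟨x, hx⟩ := hR.tr.ne A hR.a.1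
    have hGR := (h.left hGF (sub_grd hGA.1 hx) (sub_grd hR.a.1 hx)).1
    obtain ⟨l1, l2, hF⟩ := List.append_of_mem hGF
    have hsp := cut_split (h.trF G hGF) hGA hGne
    refine hsplit l1 G l2 _ hF hGR hsp (by simp) ?_ ?_
    · intro Y hY hYG
      by_cases he : Y = A
      · exact ⟨{A}, by simp, by simp [he]⟩
      · have hd := hf.dis Y hY A hA he
        have hs' : Y ⊆ grd G \ A := Finset.subset_sdiff.2 ⟨hYG, hd⟩
        refine ⟨_, List.mem_cons_of_mem _ (List.mem_singleton_self _), ?_⟩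
        rw [(restr_grd (h.trF G hGF).top Finset.sdiff_subset ((hf.ne Y hY).mono hs')).1]
        exact hs'
    · refine ⟨hlen, hs, Or.inr (Or.inr ⟨hiso, hcom, A, C, Or.inl ⟨hcontra A C hR, G, _, M, hGF, hGA,
        ⟨l1, l2, hF, rfl⟩, ?_, rfl⟩⟩)⟩
      by_cases hc : ∃ P D, IsChild G A P ∧ IsChild G D P ∧ D ≠ A ∧
          (∀ E, IsChild G E P → E = A ∨ E = D) ∧ IsBlock G D
      · obtain ⟨P, D, c1, c2, c3, c4, c5⟩ := hc
        exact Or.inl ⟨P, D, c1, c2, c3, c4, c5, (hM.bot D).symm⟩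
      · exact Or.inr ⟨hc, rfl⟩
  obtain ⟨A, C, hR⟩ := exists_cherry h.trR hs
  obtain ⟨Y, hY, Z, hZ, hAY, hCZ, he | he | he⟩ := tricho h hf hR
  · subst he
    obtain ⟨G, hGF, hYG⟩ := hf.inF Y hY
    obtain ⟨x, hx⟩ := hR.tr.ne A hR.a.1
    obtain ⟨y, hy⟩ := hR.tr.ne C hR.c.1
    have hGA := h.blk hGF hR.a hx (hYG (hAY hx))
    have hGC := h.blk hGF hR.c hy (hYG (hCZ hy))
    have hGR := (h.left hGF (sub_grd hGA.1 hx) (sub_grd hR.a.1 hx)).1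
    have trG := h.trF G hGF
    have hu : A ∪ C ∉ G := by
      intro hu
      exact (hcontra A C hR).2 ⟨G, hGF, (cherryOf_iff trG).2 ⟨trG, hGA, hGC, hR.ne, hu⟩⟩
    obtain ⟨new, n1, n2, n3, L, hL, n4, n5⟩ := pend_split trG hGA hGC hR.ne hu
    obtain ⟨l1, l2, hF⟩ := List.append_of_mem hGF
    refine hsplit l1 G l2 new hF hGR n2 n3 ?_ ?_
    · intro Z hZ hZG
      rcases pend_AF hGF hGR hf trG hGA hGC hR.ne hR.u hY (Finset.union_subset hAY hCZ) hYG hL Z hZ hZG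
        with h' | ⟨P, h', h''⟩
      · exact n4 Z h' hZG
      · obtain ⟨H, hH, hs'⟩ := n5 P h'
        exact ⟨H, hH, h''.trans hs'⟩
    · have hAne : A ≠ grd G := by
        intro he
        have := he ▸ sub_grd hGC.1
        exact Finset.disjoint_left.1 hR.dis (this hy) hy
      have hCne : C ≠ grd G := by
        intro he
        have := he ▸ sub_grd hGA.1
        exact Finset.disjoint_left.1 hR.dis hx (this hx)
      obtain ⟨PA, hPA⟩ := exists_parent trG hGA.1 hAne
      obtain ⟨PC, hPC⟩ := exists_parent trG hGC.1 hCne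
      refine ⟨hlen, hs, Or.inr (Or.inr ⟨hiso, hcom, A, C, Or.inr ⟨hcontra A C hR, G, new, _, M, hGF,
        hGA, hGC, n1, ⟨l1, l2, hF, rfl⟩, ⟨PA, PC, L, hPA, hPC, hL, ?_⟩, rfl⟩⟩)⟩
      rw [hM.rif, hM.rif]
  · subst he
    exact hcut Y C hR hY
  · subst he
    exact hcut Z A hR.symm hZ


lemma mem_foldr_grd (F : List (Clus β)) (x : β) :
    x ∈ F.foldr (fun G s => grd G ∪ s) ∅ ↔ ∃ G ∈ F, x ∈ grd G := by
  induction F with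
  | nil => simp
  | cons G F ih => simp [ih]

lemma Phy.aug {X : Finset β} {T : Clus β} {ρ : β} (h : Phy X T) (hρ : ρ ∉ X) :
    Phy (insert ρ X) (aug T ρ) := by
  have hm : ∀ C, C ∈ Phylo.aug T ρ ↔ C = {ρ} ∨ C = insert ρ X ∨ C ∈ T := by
    intro C; simp [Phylo.aug, h.grd]
  refine ⟨?_, ?_, ?_, ?_, ?_⟩
  · intro C hC
    rcases (hm C).1 hC with rfl | rfl | hC
    · simp
    · simp
    · exact h.ne C hC
  · intro C hC
    rcases (hm C).1 hC with rfl | rfl | hC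
    · simp
    · simp
    · exact (h.sub C hC).trans (Finset.subset_insert _ _)
  · have key : ∀ C ∈ T, C ⊆ insert ρ X := fun C hC => (h.sub C hC).trans (Finset.subset_insert _ _)
    have key2 : ∀ C ∈ T, Disjoint C {ρ} := fun C hC => by
      rw [Finset.disjoint_singleton_right]; exact fun hh => hρ (h.sub C hC hh)
    intro C hC D hD
    rcases (hm C).1 hC with rfl | rfl | hC <;> rcases (hm D).1 hD with rfl | rfl | hD
    · simp
    · simp
    · exact Or.inr (Or.inr (key2 D hD).symm)
    · simp
    · simp
    · exact Or.inr (Or.inl (key D hD))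
    · exact Or.inr (Or.inr (key2 C hC))
    · exact Or.inl (key C hC)
    · exact h.lam C hC D hD
  · exact (hm _).2 (Or.inr (Or.inl rfl))
  · intro x hx
    rcases Finset.mem_insert.1 hx with rfl | hx
    · exact (hm _).2 (Or.inl rfl)
    · exact (hm _).2 (Or.inr (Or.inr (h.sing x hx)))

lemma Bn.isBin {G : Clus β} (hb : Bn G) (ne : ∀ C ∈ G, C.Nonempty) : IsBin G := by
  intro C hC hB
  obtain ⟨D, hD, E, hE, hdis, rfl, hs⟩ := hb C hC hB
  obtain ⟨d, hd⟩ := ne D hD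
  obtain ⟨e, he⟩ := ne E hE
  have hd' : d ∉ E := Finset.disjoint_left.1 hdis hd
  have he' : e ∉ D := Finset.disjoint_right.1 hdis he
  have c1 : D ⊂ D ∪ E := ⟨Finset.subset_union_left, fun h => he' (h (Finset.mem_union_right _ he))⟩
  have c2 : E ⊂ D ∪ E := ⟨Finset.subset_union_right, fun h => hd' (h (Finset.mem_union_left _ hd))⟩
  refine ⟨D, E, ?_, ⟨hD, hC, c1, ?_⟩, ⟨hE, hC, c2, ?_⟩, ?_⟩
  · rintro rfl; exact hd' hd
  · intro K hK hDK hKC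
    rcases hs K hK hKC with h | h
    · exact Finset.Subset.antisymm h hDK
    · exact absurd (h (hDK hd)) hd'
  · intro K hK hDK hKC
    rcases hs K hK hKC with h | h
    · exact absurd (h (hDK he)) he'
    · exact Finset.Subset.antisymm h hDK
  · rintro K ⟨hK, -, hKC, hmax⟩
    rcases hs K hK hKC with h | h
    · exact Or.inl (hmax D hD h c1).symm
    · exact Or.inr (hmax E hE h c2).symm

lemma Phy.refines {W : Finset β} {G G' : Clus β} (h : Phy W G) (h' : Phy W G') (hs : G ⊆ G') :
    Refines G' G := ⟨hs, fun A => by rw [h.block, h'.block]⟩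

lemma Phy.binRes {W : Finset β} {G G' : Clus β} (h : Phy W G) (h' : Phy W G') (hs : G ⊆ G')
    (hb : Bn G') : BinRes G' G := ⟨h.refines h' hs, hb.isBin h'.ne⟩

lemma Phy.sat {W : Finset β} {U : Clus β} (h : Phy W U) (S : Finset β) : Sat U S := by
  intro B hB
  obtain ⟨x, -, rfl⟩ := (h.block B).1 hB
  by_cases hx : x ∈ S
  · left; simpa using hx
  · right; simpa using hx

lemma below_aug {X : Finset β} {ρ : β} {T U : Clus β} (hρ : ρ ∉ X) (hT : Phy X T)
    (hU : Phy (insert ρ X) U) (hb : Bn U) (hs : aug T ρ ⊆ U) :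
    aug (below U X) ρ = U ∧ BinRes (below U X) T := by
  have hTU : T ⊆ U := fun C hC => hs (by simp [aug, hC])
  have hm : ∀ C, C ∈ below U X ↔ C ∈ U ∧ C ⊆ X := by intro C; simp [below]
  have hP : Phy X (below U X) := by
    refine ⟨fun C hC => hU.ne C ((hm C).1 hC).1, fun C hC => ((hm C).1 hC).2, ?_, ?_, ?_⟩
    · intro C hC D hD
      exact hU.lam C ((hm C).1 hC).1 D ((hm D).1 hD).1
    · exact (hm X).2 ⟨hTU hT.top, Finset.Subset.refl _⟩
    · intro x hx
      exact (hm _).2 ⟨hTU (hT.sing x hx), by simpa using hx⟩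
  constructor
  · ext D
    have : D ∈ aug (below U X) ρ ↔ D = {ρ} ∨ D = insert ρ X ∨ D ∈ below U X := by
      simp [aug, hP.grd]
    rw [this, hm]
    constructor
    · rintro (rfl | rfl | h)
      · exact hU.sing ρ (by simp)
      · exact hU.top
      · exact h.1
    · intro hD
      by_cases hρD : ρ ∈ D
      · have hDs := hU.sub D hD
        rcases hU.lam D hD X (hTU hT.top) with h | h | h
        · exact absurd (h hρD) hρ
        · right; left
          exact Finset.Subset.antisymm hDs (Finset.insert_subset hρD h)
        · left
          ext y
          rw [Finset.mem_singleton]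
          constructor
          · intro hy
            rcases Finset.mem_insert.1 (hDs hy) with h' | h'
            · exact h'
            · exact absurd h' (Finset.disjoint_left.1 h hy)
          · rintro rfl; exact hρD
      · right; right
        refine ⟨hD, fun y hy => ?_⟩
        rcases Finset.mem_insert.1 (hU.sub D hD hy) with rfl | h'
        · exact absurd hy hρD
        · exact h'
  · refine hT.binRes hP (fun C hC => (hm C).2 ⟨hTU hC, hT.sub C hC⟩) ?_
    intro C hC hB
    obtain ⟨hCU, hCX⟩ := (hm C).1 hC
    have hB' : ¬ IsBlock U C := by
      rintro ⟨-, h⟩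
      exact hB ⟨hC, fun D hD => h D ((hm D).1 hD).1⟩
    obtain ⟨D, hD, E, hE, hdis, rfl, hs⟩ := hb C hCU hB'
    exact ⟨D, (hm D).2 ⟨hD, Finset.subset_union_left.trans hCX⟩, E,
      (hm E).2 ⟨hE, Finset.subset_union_right.trans hCX⟩, hdis, rfl,
      fun K hK => hs K ((hm K).1 hK).1⟩

lemma restr_mono {G H : Clus β} (h : G ⊆ H) (S : Finset β) : restr G S ⊆ restr H S := by
  intro E hE
  obtain ⟨hn, D, hD, rfl⟩ := mem_restr.1 hE
  exact mem_restr.2 ⟨hn, D, h hD, rfl⟩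

/-- edge-disjoint coverings of the binary resolutions give agreement forests. -/
lemma AFs.isAF {X : Finset β} {ρ : β} {T1 T2 U1 U2 : Clus β} (hρ : ρ ∉ X)
    (hT1 : Phy X T1) (hT2 : Phy X T2) (hU1 : Phy (insert ρ X) U1) (hU2 : Phy (insert ρ X) U2)
    (hs1 : aug T1 ρ ⊆ U1) (hs2 : aug T2 ρ ⊆ U2) {𝒴 : Finset (Finset β)}
    (h : AFs U1 [U2] 𝒴) : IsAF X ρ T1 T2 (𝒴.toList.map (fun Y => restr U1 Y)) := by
  have hA1 := hT1.aug hρ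
  have hA2 := hT2.aug hρ
  have hsub : ∀ Y ∈ 𝒴, Y ⊆ insert ρ X := by
    intro Y hY
    obtain ⟨G, hG, hYG⟩ := h.inF Y hY
    rw [List.mem_singleton] at hG
    subst hG
    rwa [hU2.grd] at hYG
  have hr : ∀ Y ∈ 𝒴, Phy Y (restr U1 Y) := fun Y hY => hU1.restr (hsub Y hY) (h.ne Y hY)
  have hmem : ∀ G, G ∈ 𝒴.toList.map (fun Y => restr U1 Y) ↔ ∃ Y ∈ 𝒴, restr U1 Y = G := by
    intro G; simp
  have hcov : ∀ x ∈ insert ρ X, ∃ G ∈ 𝒴.toList.map (fun Y => restr U1 Y), x ∈ grd G := by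
    intro x hx
    obtain ⟨Y, hY, hxY⟩ := h.cov U2 (by simp) x (by rwa [hU2.grd])
    exact ⟨_, (hmem _).2 ⟨Y, hY, rfl⟩, by rwa [(hr Y hY).grd]⟩
  have hpw : ∀ r : Finset β → Finset β → Prop, (∀ Y ∈ 𝒴, ∀ Z ∈ 𝒴, Y ≠ Z → r Y Z) →
      (𝒴.toList.map (fun Y => restr U1 Y)).Pairwise (fun G H => r (grd G) (grd H)) := by
    intro r hh
    rw [List.pairwise_map]
    refine List.Pairwise.imp_of_mem ?_ 𝒴.nodup_toList
    intro Y Z hY hZ hne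
    rw [Finset.mem_toList] at hY hZ
    rw [(hr Y hY).grd, (hr Z hZ).grd]
    exact hh Y hY Z hZ hne
  refine ⟨⟨?_, ?_, ?_⟩, ?_, ?_, ?_, ?_, ?_, ?_⟩
  · intro G hG
    obtain ⟨Y, hY, rfl⟩ := (hmem _).1 hG
    exact (hr Y hY).isPhylo.1
  · exact hpw (fun Y Z => Disjoint Y Z) h.dis
  · ext x
    rw [mem_foldr_grd, hA1.grd]
    constructor
    · rintro ⟨G, hG, hx⟩
      obtain ⟨Y, hY, rfl⟩ := (hmem _).1 hG
      rw [(hr Y hY).grd] at hx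
      exact hsub Y hY hx
    · exact hcov x
  · rw [hA1.grd, hA2.grd]
  · intro G hG
    obtain ⟨Y, hY, rfl⟩ := (hmem _).1 hG
    rw [(hr Y hY).grd]
    exact (hr Y hY).isPhylo
  · intro G hG
    obtain ⟨Y, hY, rfl⟩ := (hmem _).1 hG
    rw [(hr Y hY).grd]
    have e : restr U1 Y = restr U2 Y := h.agr U2 (by simp) Y hY (by rw [hU2.grd]; exact hsub Y hY)
      (by rw [hU1.grd]; exact hsub Y hY)
    refine ⟨(hA1.restr (hsub Y hY) (h.ne Y hY)).refines (hr Y hY) (restr_mono hs1 Y),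
      (hA2.restr (hsub Y hY) (h.ne Y hY)).refines (hr Y hY) ?_⟩
    rw [e]; exact restr_mono hs2 Y
  · exact hcov ρ (by simp)
  · apply hpw (fun Y Z => ∀ C, ¬ (EdgeInSpan (Phylo.aug T1 ρ) Y C ∧ EdgeInSpan (Phylo.aug T1 ρ) Z C))
    rintro Y hY Z hZ hne C ⟨⟨hC, h1⟩, ⟨-, h2⟩⟩
    exact h.eR Y hY Z hZ hne C (hs1 hC) ⟨h1, h2⟩
  · apply hpw (fun Y Z => ∀ C, ¬ (EdgeInSpan (Phylo.aug T2 ρ) Y C ∧ EdgeInSpan (Phylo.aug T2 ρ) Z C))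
    rintro Y hY Z hZ hne C ⟨⟨hC, h1⟩, ⟨-, h2⟩⟩
    exact h.eF U2 (by simp) Y hY Z hZ hne C (hs2 hC) ⟨h1, h2⟩

/-- For each relevant maximum agreement forest `F` of size `k`
there are binary resolutions of the input trees and a binary resolution of `F`
calculated by allMAFs¹. -/
theorem relevant_MAF_has_binary_resolution_by_allMAFs1
    {β : Type} [DecidableEq β] (X : Finset β) (ρ : β) (hρ : ρ ∉ X)
    (T1 T2 : Clus β) (h1 : IsPhylo X T1) (h2 : IsPhylo X T2)
    (F : List (Clus β)) (k : ℕ) (hF : IsRelMAF X ρ T1 T2 F) (hk : F.length = k) :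
    ∃ Th1 Th2 Fh, BinRes Th1 T1 ∧ BinRes Th2 T2 ∧ BinResF Fh F ∧
      allMAFs1Run Th1 Th2 ρ k Fh := by
  obtain ⟨⟨⟨⟨-, hdis, hun⟩, -, hph, href, -, he1, he2⟩, hmin⟩, -⟩ := hF
  have hT1 := h1.phy
  have hT2 := h2.phy
  have hA1 := hT1.aug hρ
  have hA2 := hT2.aug hρ
  rw [hA1.grd] at hun
  have hmemY : ∀ Y, Y ∈ (F.map grd).toFinset ↔ ∃ G ∈ F, grd G = Y := by intro Y; simp
  generalize h𝒴 : (F.map grd).toFinset = 𝒴 at hmemY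
  have hcard : 𝒴.card ≤ k := by
    rw [← h𝒴, ← hk]
    simpa using (F.map grd).toFinset_card_le
  have hsub : ∀ Y ∈ 𝒴, Y ⊆ insert ρ X := by
    intro Y hY x hx
    obtain ⟨G, hG, rfl⟩ := (hmemY Y).1 hY
    rw [← hun, mem_foldr_grd]
    exact ⟨G, hG, hx⟩
  have hg : ∀ Y, ∃ U G, Y ∈ 𝒴 → G ∈ F ∧ grd G = Y ∧ Phy Y G ∧ G ⊆ U ∧ Phy Y U ∧ Bn U := by
    intro Y
    by_cases hY : Y ∈ 𝒴
    · obtain ⟨G, hG, rfl⟩ := (hmemY Y).1 hY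
      have hGp := (hph G hG).phy
      obtain ⟨U, hU1, hU2, hU3, -⟩ := exists_bin_ext ∅ (fun _ => ∅) hGp (by simp) (by simp) (by simp)
      exact ⟨U, G, fun _ => ⟨hG, rfl, hGp, hU1, hU2, hU3⟩⟩
    · exact ⟨∅, ∅, fun h => absurd h hY⟩
  choose g c hg using hg
  have hne : ∀ Y ∈ 𝒴, Y.Nonempty := fun Y hY => (hg Y hY).2.2.1.ne Y (hg Y hY).2.2.1.top
  have hcne : ∀ Y ∈ 𝒴, ∀ Z ∈ 𝒴, Y ≠ Z → c Y ≠ c Z := by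
    intro Y hY Z hZ h hc
    exact h (by rw [← (hg Y hY).2.1, ← (hg Z hZ).2.1, hc])
  have hYd : ∀ Y ∈ 𝒴, ∀ Z ∈ 𝒴, Y ≠ Z → Disjoint Y Z := by
    intro Y hY Z hZ h
    have := pw_all (r := fun G H : Clus β => Disjoint (grd G) (grd H))
      (fun _ _ h => h.symm) hdis (hg Y hY).1 (hg Z hZ).1 (hcne Y hY Z hZ h)
    rwa [(hg Y hY).2.1, (hg Z hZ).2.1] at this
  have hE : ∀ T : Clus β, F.Pairwise (fun G H => ∀ C, ¬ (EdgeInSpan T (grd G) C ∧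
      EdgeInSpan T (grd H) C)) → ∀ Y ∈ 𝒴, ∀ Z ∈ 𝒴, Y ≠ Z → ∀ D ∈ T, ¬ (Cr Y D ∧ Cr Z D) := by
    intro T hT Y hY Z hZ h D hD ⟨hc1, hc2⟩
    have := pw_all (r := fun G H : Clus β => ∀ C, ¬ (EdgeInSpan T (grd G) C ∧ EdgeInSpan T (grd H) C))
      (fun _ _ h C hh => h C ⟨hh.2, hh.1⟩) hT (hg Y hY).1 (hg Z hZ).1 (hcne Y hY Z hZ h) D
    rw [(hg Y hY).2.1, (hg Z hZ).2.1] at this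
    exact this ⟨⟨hD, hc1⟩, ⟨hD, hc2⟩⟩
  have hR : ∀ Y ∈ 𝒴, restr (Phylo.aug T1 ρ) Y ⊆ g Y ∧ restr (Phylo.aug T2 ρ) Y ⊆ g Y := by
    intro Y hY
    obtain ⟨hc, hcY, -, hs, -⟩ := hg Y hY
    have := href _ hc
    rw [hcY] at this
    exact ⟨this.1.1.trans hs, this.2.1.trans hs⟩
  have hgb : ∀ Y ∈ 𝒴, Phy Y (g Y) ∧ Bn (g Y) := fun Y hY => (hg Y hY).2.2.2.2
  obtain ⟨U1, hs1, hU1, hb1, hr1, hd1⟩ := exists_bin_ext 𝒴 g hA1 hgb (fun Y hY => (hR Y hY).1)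
    (hE _ he1)
  obtain ⟨U2, hs2, hU2, hb2, hr2, hd2⟩ := exists_bin_ext 𝒴 g hA2 hgb (fun Y hY => (hR Y hY).2)
    (hE _ he2)
  have hrg : ∀ U : Clus β, Phy (insert ρ X) U → Bn U → (∀ Y ∈ 𝒴, restr U Y ⊆ g Y) →
      ∀ Y ∈ 𝒴, restr U Y = g Y := by
    intro U hU hb hr Y hY
    have ht := restr_Tr (hU.tr hb) (hU.sat Y) (by rw [hU.grd]; exact hsub Y hY) (hne Y hY)
    exact (bin_max (hU.restr (hsub Y hY) (hne Y hY)) ht.bn (hgb Y hY).1 (hr Y hY)).symm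
  have hg1 := hrg U1 hU1 hb1 hr1
  have hg2 := hrg U2 hU2 hb2 hr2
  obtain ⟨ha1, hB1⟩ := below_aug hρ hT1 hU1 hb1 hs1
  obtain ⟨ha2, hB2⟩ := below_aug hρ hT2 hU2 hb2 hs2
  have hInv : Inv U1 [U2] := by
    refine ⟨hU1.tr hb1, ?_, by simp, ?_, ?_⟩
    · simpa using hU2.tr hb2
    · intro G hG
      rw [List.mem_singleton] at hG; subst hG
      left
      refine ⟨by rw [hU1.grd, hU2.grd], fun B hB => ?_⟩
      rw [hU2.block] at hB; rwa [hU1.block]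
    · intro x hx
      exact ⟨U2, by simp, by rwa [hU2.grd, ← hU1.grd]⟩
  have hAF : AFs U1 [U2] 𝒴 := by
    refine ⟨hne, hYd, ?_, ?_, ?_, ?_, hd1, ?_⟩
    · intro Y hY
      exact ⟨U2, by simp, by rw [hU2.grd]; exact hsub Y hY⟩
    · intro G hG x hx
      rw [List.mem_singleton] at hG; subst hG
      rw [hU2.grd, ← hun, mem_foldr_grd] at hx
      obtain ⟨G, hG, hx⟩ := hx
      exact ⟨grd G, (hmemY _).2 ⟨G, hG, rfl⟩, hx⟩
    · intro G hG Y hY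
      rw [List.mem_singleton] at hG; subst hG
      exact hU2.sat Y
    · intro G hG Y hY _ _
      rw [List.mem_singleton] at hG; subst hG
      rw [hg1 Y hY, hg2 Y hY]
    · intro G hG
      rw [List.mem_singleton] at hG; subst hG
      exact hd2
  have hmin' : ∀ 𝒴', AFs U1 [U2] 𝒴' → 𝒴.card ≤ 𝒴'.card := by
    intro 𝒴' h
    have := hmin _ (h.isAF hρ hT1 hT2 hU1 hU2 hs1 hs2)
    simp at this
    omega
  obtain ⟨s', hrun, hsl, hlen, hM, out, hex, hout⟩ := main_ind k _ U1 [U2] (fun _ => none) 𝒴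
    (Nat.lt_succ_self _) hInv hAF hmin' (by intro S p h; simp at h) hcard
  have hout' : ∀ G ∈ out, ∃ Y ∈ 𝒴, G = g Y := by
    intro G hG
    rcases hout G hG with ⟨Y, hY, -, rfl⟩ | ⟨hG', hd⟩
    · exact ⟨Y, hY, hg1 Y hY⟩
    · rw [List.mem_singleton] at hG'; subst hG'
      rw [hU1.grd, hU2.grd] at hd
      simp at hd
  refine ⟨below U1 X, below U2 X, out, hB1, hB2, ?_, s', ?_, hsl, hlen, hex, ?_⟩
  · intro G hG
    obtain ⟨Y, hY, rfl⟩ := hout' G hG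
    obtain ⟨a, -, b, d, e, f⟩ := hg Y hY
    exact ⟨c Y, a, b.binRes e d f⟩
  · unfold initSt
    rw [ha1, ha2]; exact hrun
  · intro G hG A hA
    obtain ⟨Y, hY, rfl⟩ := hout' G hG
    obtain ⟨x, hx, rfl⟩ := ((hgb Y hY).1.block A).1 hA
    exact hM _ ⟨U2, by simp, {x}, (hU2.block _).2 ⟨x, hsub Y hY hx, rfl⟩, Finset.Subset.refl _⟩

end Phylo
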